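/- arXiv:0903.4597 — 2 statements merged into one kernel-verified Lean document; each statement's English description precedes it below -/
import Mathlib

section
/- For every n ≥ 1, k ≥ 1 and i ≥ 0, there is a homotopy equivalence of topological spaces RX_{k,n}^{2i+1} ≃ X_{⌊k/2⌋,n}^{i}, where ⌊k/2⌋ is the greatest integer ≤ k/2. (Theorem A of the paper.) -/
open Polynomial

/-- The monic real polynomial of degree `k` with lower-order coefficient vector `c`. -/
noncomputable def toPolyR (k : ℕ) (c : Fin k → ℝ) : Polynomial ℝ :=
  Polynomial.X ^ k + ∑ i : Fin k, Polynomial.C (c i) * Polynomial.X ^ (i : ℕ)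

/-- The monic complex polynomial of degree `k` with lower-order coefficient vector `c`. -/
noncomputable def toPolyC (k : ℕ) (c : Fin k → ℂ) : Polynomial ℂ :=
  Polynomial.X ^ k + ∑ i : Fin k, Polynomial.C (c i) * Polynomial.X ^ (i : ℕ)

/-- `RX_{k,n}^l`: tuples of monic real degree-`k` polynomials with gcd of degree `≤ l`,
as a subset of `ℝ^{k(n+1)}` via coefficient vectors. -/
def RXset (k n l : ℕ) : Set (Fin (n + 1) → Fin k → ℝ) :=
  {f | (Finset.univ.gcd fun j => toPolyR k (f j)).natDegree ≤ l}

/-- `X_{k,n}^l`: tuples of monic complex degree-`k` polynomials with gcd of degree `≤ l`. -/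
def Xset (k n l : ℕ) : Set (Fin (n + 1) → Fin k → ℂ) :=
  {f | (Finset.univ.gcd fun j => toPolyC k (f j)).natDegree ≤ l}

/-- `Y_{k,n}^l`: elements of `RX_{k,n}^l` with no common real root. -/
def Yset (k n l : ℕ) : Set (Fin (n + 1) → Fin k → ℝ) :=
  {f | f ∈ RXset k n l ∧ ∀ x : ℝ, ∃ j, (toPolyR k (f j)).eval x ≠ 0}

section EquivalenceProof

open scoped unitInterval Topology NNReal
open Set Filter

/-- The ambient space: a deformation parameter and a sequence of coefficient sequences. -/
abbrev Amb : Type := ℝ≥0 × (ℕ → ℕ → ℝ)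

/-- Continuity of a map `I × T → T` over a subset, with target the subset. -/
structure ZFlow (E : Set Amb) (H : ↥I × Amb → Amb) : Prop where
  cont : ContinuousOn H (univ ×ˢ E)
  maps : ∀ t, ∀ x ∈ E, H (t, x) ∈ E
  zero : ∀ t, ∀ x ∈ E, x.1 = 0 → (H (t, x)).1 = 0

/-- `E` can be compressed into its part over the parameter `0`, keeping that part over `0`. -/
def Good (E : Set Amb) : Prop :=
  ∃ H : ↥I × Amb → Amb, ZFlow E H ∧ (∀ x ∈ E, H (0, x) = x) ∧ ∀ x ∈ E, (H (1, x)).1 = 0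

theorem Good.of_concat {E : Set Amb} {J G : ↥I × Amb → Amb} (hJ : ZFlow E J) (hG : ZFlow E G)
    (h0 : ∀ x ∈ E, J (0, x) = x) (h1 : ∀ x ∈ E, G (0, x) = J (1, x))
    (h2 : ∀ x ∈ E, (G (1, x)).1 = 0) : Good E := by
  let p : I → I := fun t => projIcc 0 1 zero_le_one (2 * (t : ℝ))
  let q : I → I := fun t => projIcc 0 1 zero_le_one (2 * (t : ℝ) - 1)
  have hp : Continuous p := continuous_projIcc.comp (by fun_prop)
  have hq : Continuous q := continuous_projIcc.comp (by fun_prop)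
  have hp1 : ∀ t : I, (1 / 2 : ℝ) ≤ t → p t = 1 := fun t ht =>
    projIcc_of_right_le _ (by linarith)
  have hq0 : ∀ t : I, (t : ℝ) ≤ 1 / 2 → q t = 0 := fun t ht =>
    projIcc_of_le_left _ (by linarith)
  refine ⟨fun z => if (z.1 : ℝ) ≤ 1 / 2 then J (p z.1, z.2) else G (q z.1, z.2), ⟨?_, ?_, ?_⟩,
    ?_, ?_⟩
  · have hcl1 : IsClosed {z : ↥I × Amb | (z.1 : ℝ) ≤ 1 / 2} :=
      isClosed_le (by fun_prop) continuous_const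
    have hcl2 : IsClosed {z : ↥I × Amb | (1 / 2 : ℝ) ≤ z.1} :=
      isClosed_le continuous_const (by fun_prop)
    have c1 : ContinuousOn (fun z : ↥I × Amb => J (p z.1, z.2)) (univ ×ˢ E) :=
      hJ.cont.comp (by fun_prop) (fun z hz => ⟨trivial, hz.2⟩)
    have c2 : ContinuousOn (fun z : ↥I × Amb => G (q z.1, z.2)) (univ ×ˢ E) :=
      hG.cont.comp (by fun_prop) (fun z hz => ⟨trivial, hz.2⟩)
    refine ContinuousOn.if (p := fun z : ↥I × Amb => (z.1 : ℝ) ≤ 1 / 2) ?_ ?_ ?_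
    · rintro ⟨t, x⟩ ⟨⟨-, hx⟩, hf⟩
      have hf' : (t : ℝ) = 1 / 2 :=
        frontier_le_subset_eq (f := fun z : ↥I × Amb => (z.1 : ℝ)) (by fun_prop)
          continuous_const hf
      simp only
      rw [hp1 t hf'.ge, hq0 t hf'.le, h1 x hx]
    · exact c1.mono inter_subset_left
    · exact c2.mono inter_subset_left
  · intro t x hx
    by_cases h : (t : ℝ) ≤ 1 / 2
    · simp only [h, if_true]; exact hJ.maps _ x hx
    · simp only [h, if_false]; exact hG.maps _ x hx
  · intro t x hx hx0
    by_cases h : (t : ℝ) ≤ 1 / 2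
    · simp only [h, if_true]; exact hJ.zero _ x hx hx0
    · simp only [h, if_false]; exact hG.zero _ x hx hx0
  · intro x hx
    have : p 0 = 0 := projIcc_of_le_left _ (by simp)
    simp [this, h0 x hx]
  · intro x hx
    have : q 1 = 1 := projIcc_of_right_le _ (by norm_num)
    have h : ¬ (((1 : I) : ℝ) ≤ 1 / 2) := by norm_num
    simp only [h, if_false, this]
    exact h2 x hx

/-- Compressibility passes to homotopy retracts, all maps being compatible with the zero fibre. -/
theorem Good.of_retract {A B : Set Amb} (i : Amb → Amb) (r : Amb × Amb → Amb) (K : ↥I × Amb → Amb)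
    (hi : ContinuousOn i A) (hr : ContinuousOn r (B ×ˢ A)) (hiA : MapsTo i A B)
    (hrB : ∀ y ∈ B, ∀ x ∈ A, r (y, x) ∈ A) (hi0 : ∀ x ∈ A, x.1 = 0 → (i x).1 = 0)
    (hr0 : ∀ y ∈ B, ∀ x ∈ A, y.1 = 0 → (r (y, x)).1 = 0)
    (hK : ZFlow A K) (hK0 : ∀ x ∈ A, K (0, x) = x) (hK1 : ∀ x ∈ A, K (1, x) = r (i x, x))
    (hB : Good B) : Good A := by
  obtain ⟨H, hH, H0, H1⟩ := hB
  refine Good.of_concat (J := K) (G := fun z => r (H (z.1, i z.2), z.2)) hK ⟨?_, ?_, ?_⟩ hK0 ?_ ?_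
  · refine hr.comp (ContinuousOn.prodMk (hH.cont.comp (continuousOn_fst.prodMk
      (hi.comp continuousOn_snd fun z hz => hz.2)) fun z hz => ⟨trivial, hiA hz.2⟩)
      continuousOn_snd) ?_
    exact fun z hz => ⟨hH.maps _ _ (hiA hz.2), hz.2⟩
  · exact fun t x hx => hrB _ (hH.maps _ _ (hiA hx)) _ hx
  · exact fun t x hx h => hr0 _ (hH.maps _ _ (hiA hx)) _ hx (hH.zero _ _ (hiA hx) (hi0 x hx h))
  · intro x hx
    simp [H0 _ (hiA hx), hK1 x hx]
  · exact fun x hx => hr0 _ (hH.maps _ _ (hiA hx)) _ hx (H1 _ (hiA hx))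

theorem Good.of_strict_retract {A B : Set Amb} (i : Amb → Amb) (r : Amb × Amb → Amb)
    (hi : ContinuousOn i A) (hr : ContinuousOn r (B ×ˢ A)) (hiA : MapsTo i A B)
    (hrB : ∀ y ∈ B, ∀ x ∈ A, r (y, x) ∈ A) (hi0 : ∀ x ∈ A, x.1 = 0 → (i x).1 = 0)
    (hr0 : ∀ y ∈ B, ∀ x ∈ A, y.1 = 0 → (r (y, x)).1 = 0)
    (hri : ∀ x ∈ A, r (i x, x) = x) (hB : Good B) : Good A :=
  Good.of_retract i r Prod.snd hi hr hiA hrB hi0 hr0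
    ⟨continuousOn_snd, fun _ _ h => h, fun _ _ _ h => h⟩ (fun _ _ => rfl)
    (fun x hx => (hri x hx).symm) hB

theorem eventually_forall_mem_of_continuousOn {E O : Set Amb} {m : ↥I × Amb → Amb}
    (hm : ContinuousOn m (univ ×ˢ E)) (hO : IsOpen O) {x : Amb} (hx : x ∈ E)
    (h : ∀ t, m (t, x) ∈ O) : ∀ᶠ y in 𝓝[E] x, ∀ t, m (t, y) ∈ O := by
  have h2 : ∀ᶠ y in 𝓝 x, ∀ t ∈ (univ : Set I), y ∈ E → m (t, y) ∈ O := by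
    refine isCompact_univ.eventually_forall_of_forall_eventually ?_
    intro t _
    have h4 := (hm (t, x) ⟨trivial, hx⟩).preimage_mem_nhdsWithin (hO.mem_nhds (h t))
    have h5 := eventually_nhdsWithin_iff.1 h4
    have h6 : Tendsto (Prod.swap : Amb × I → ↥I × Amb) (𝓝 (x, t)) (𝓝 (t, x)) :=
      continuous_swap.tendsto (x, t)
    filter_upwards [h6.eventually h5] with z hz hz'
    exact hz ⟨trivial, hz'⟩
  rw [eventually_nhdsWithin_iff]
  filter_upwards [h2] with y hy hyE t
  exact hy t trivial hyE

/-- Cut-off functions near a relatively closed subset. -/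
theorem exists_cutoff (E S N : Set Amb) (hS : IsClosed S) (hN : ∀ x ∈ E, x ∈ S → N ∈ 𝓝[E] x) :
    ∃ l u : Amb → I, ContinuousOn l E ∧ ContinuousOn u E ∧
      (∀ x ∈ E, (∀ᶠ x' in 𝓝[E] x, l x' = 0) ∨ N ∈ 𝓝[E] x) ∧
      (∀ x ∈ E, l x ≠ 1 → u x = 1) ∧ (∀ x ∈ E, x ∈ S → ∀ᶠ x' in 𝓝[E] x, u x' = 0) ∧
      (∀ x ∈ E, x ∈ S → ∀ᶠ x' in 𝓝[E] x, l x' = 1) := by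
  classical
  let S' : Set E := Subtype.val ⁻¹' S
  let N' : Set E := interior (Subtype.val ⁻¹' N)
  have hS' : IsClosed S' := hS.preimage continuous_subtype_val
  have hd : Disjoint N'ᶜ S' := by
    rw [Set.disjoint_left]
    intro x hx hxS
    apply hx
    rw [mem_interior_iff_mem_nhds]
    exact preimage_coe_mem_nhds_subtype.2 (hN x x.2 hxS)
  obtain ⟨f, hf0, hf1, hf⟩ := exists_continuous_zero_one_of_isClosed
    (isOpen_interior.isClosed_compl) hS' hd
  let P : ℝ → I := projIcc 0 1 zero_le_one
  have hP : Continuous P := continuous_projIcc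
  let L : E → I := fun x => P (3 * f x - 1)
  let U : E → I := fun x => P (5 - 6 * f x)
  have key : ∀ F : E → I, Continuous F →
      ContinuousOn (fun x => if h : x ∈ E then F ⟨x, h⟩ else 0) E := by
    intro F hF
    rw [continuousOn_iff_continuous_domRestrict]
    convert hF using 1
    ext x
    simp
  have ev : ∀ (F : E → I) (c : I) (x : E), (∀ᶠ y in 𝓝 x, F y = c) →
      ∀ᶠ y in 𝓝[E] (x : Amb), (if h : y ∈ E then F ⟨y, h⟩ else 0) = c := by
    intro F c x h
    rw [nhdsWithin_eq_map_subtype_coe x.2, eventually_map]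
    filter_upwards [h] with y hy
    simpa using hy
  refine ⟨fun x => if h : x ∈ E then L ⟨x, h⟩ else 0, fun x => if h : x ∈ E then U ⟨x, h⟩ else 0,
    key L (hP.comp (by fun_prop)), key U (hP.comp (by fun_prop)), ?_, ?_, ?_, ?_⟩
  · intro x hx
    by_cases h : f ⟨x, hx⟩ < 1 / 3
    · left
      have : ∀ᶠ y : E in 𝓝 ⟨x, hx⟩, f y < 1 / 3 :=
        (f.continuous.tendsto _).eventually (gt_mem_nhds h)
      refine ev L 0 ⟨x, hx⟩ ?_
      filter_upwards [this] with y hy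
      exact projIcc_of_le_left _ (by linarith)
    · right
      have hx' : (⟨x, hx⟩ : E) ∈ N' := by
        by_contra hc
        have := hf0 hc
        simp only [Pi.zero_apply] at this
        rw [this] at h
        norm_num at h
      rw [mem_interior_iff_mem_nhds, preimage_coe_mem_nhds_subtype] at hx'
      exact hx'
  · intro x hx h
    simp only [hx, dite_true] at h ⊢
    refine projIcc_of_right_le _ ?_
    by_contra! hc
    exact h (projIcc_of_right_le _ (by linarith))
  · intro x hx hxS
    have h1 : f ⟨x, hx⟩ = 1 := hf1 (show (⟨x, hx⟩ : E) ∈ S' from hxS)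
    have : ∀ᶠ y : E in 𝓝 ⟨x, hx⟩, 5 / 6 < f y :=
      (f.continuous.tendsto _).eventually (lt_mem_nhds (by rw [h1]; norm_num))
    refine ev U 0 ⟨x, hx⟩ ?_
    filter_upwards [this] with y hy
    exact projIcc_of_le_left _ (by linarith)
  · intro x hx hxS
    have h1 : f ⟨x, hx⟩ = 1 := hf1 (show (⟨x, hx⟩ : E) ∈ S' from hxS)
    have : ∀ᶠ y : E in 𝓝 ⟨x, hx⟩, 5 / 6 < f y :=
      (f.continuous.tendsto _).eventually (lt_mem_nhds (by rw [h1]; norm_num))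
    refine ev L 1 ⟨x, hx⟩ ?_
    filter_upwards [this] with y hy
    exact projIcc_of_right_le _ (by linarith)

theorem continuousOn_patch {X Y : Type*} [TopologicalSpace X] [TopologicalSpace Y] {E N : Set X}
    [DecidablePred (· ∈ N)] {f g : X → Y} (hf : ContinuousOn f (E ∩ N)) (hg : ContinuousOn g E)
    (h : ∀ x ∈ E, N ∈ 𝓝[E] x ∨ ∀ᶠ x' in 𝓝[E] x, x' ∈ N → f x' = g x') :
    ContinuousOn (fun x => if x ∈ N then f x else g x) E := by
  intro x hx
  rcases h x hx with h | h
  · have hxN : x ∈ N := mem_of_mem_nhdsWithin hx h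
    have : ContinuousWithinAt f E x :=
      (hf x ⟨hx, hxN⟩).mono_of_mem_nhdsWithin (inter_mem self_mem_nhdsWithin h)
    refine this.congr_of_eventuallyEq ?_ (by simp [hxN])
    filter_upwards [h] with y hy
    simp [hy]
  · refine (hg x hx).congr_of_eventuallyEq ?_ ?_
    · filter_upwards [h] with y hy
      split_ifs with hyN
      · exact hy hyN
      · rfl
    · split_ifs with hxN
      · exact h.self_of_nhdsWithin hx hxN
      · rfl

/-- Replace the coefficient of index `d` in the `a`-th sequence. -/
def setCoeff (a d : ℕ) (x : Amb) (r : ℝ) : Amb :=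
  (x.1, Function.update x.2 a (Function.update (x.2 a) d r))

theorem continuous_setCoeff (a d : ℕ) : Continuous fun z : Amb × ℝ => setCoeff a d z.1 z.2 := by
  unfold setCoeff
  refine (continuous_fst.comp continuous_fst).prodMk ?_
  refine Continuous.update (by fun_prop) a ?_
  exact Continuous.update (by fun_prop) d continuous_snd

@[simp] theorem setCoeff_fst (a d : ℕ) (x : Amb) (r : ℝ) : (setCoeff a d x r).1 = x.1 := rfl

@[simp] theorem setCoeff_coeff (a d : ℕ) (x : Amb) (r : ℝ) : (setCoeff a d x r).2 a d = r := by
  simp [setCoeff]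

theorem setCoeff_of_ne (a d : ℕ) (x : Amb) (r : ℝ) {j m : ℕ} (h : ¬ (j = a ∧ m = d)) :
    (setCoeff a d x r).2 j m = x.2 j m := by
  unfold setCoeff
  by_cases hj : j = a
  · subst hj
    have : m ≠ d := fun hm => h ⟨rfl, hm⟩
    simp [this]
  · simp [hj]

theorem setCoeff_eq_self (a d : ℕ) (x : Amb) {r : ℝ} (h : x.2 a d = r) :
    setCoeff a d x r = x := by
  subst h
  simp [setCoeff]

@[simp] theorem setCoeff_setCoeff (a d : ℕ) (x : Amb) (r r' : ℝ) :
    setCoeff a d (setCoeff a d x r) r' = setCoeff a d x r' := by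
  simp [setCoeff]

/-- Compressibility of a stratum and of its complement imply compressibility. -/
theorem Good.of_strata (a d : ℕ) {E L O : Set Amb} (hO : IsOpen O) (hE : E = L ∩ O)
    (hL : ∀ x ∈ L, ∀ r, setCoeff a d x r ∈ L)
    (hS : Good (E ∩ {x | x.2 a d = 0})) (hU : Good (E ∩ {x | x.2 a d ≠ 0})) : Good E := by
  classical
  obtain ⟨H, hH, H0, H1⟩ := hS
  obtain ⟨K, hK, K0, K1⟩ := hU
  let kill : Amb → Amb := fun x => setCoeff a d x 0
  have hkill : Continuous kill := (continuous_setCoeff a d).comp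
      (continuous_id.prodMk continuous_const)
  let c : Amb → ℝ := fun x => x.2 a d
  have hc : Continuous c := by fun_prop
  let m : ↥I × Amb → Amb := fun z => setCoeff a d (H (z.1, kill z.2)) (c z.2)
  let E0 : Set Amb := {x | kill x ∈ E}
  have hkm : ∀ x ∈ E0, kill x ∈ E ∩ {x | x.2 a d = 0} := fun x hx => ⟨hx, by simp [kill]⟩
  have hm : ContinuousOn m (univ ×ˢ E0) := by
    refine (continuous_setCoeff a d).comp_continuousOn (ContinuousOn.prodMk ?_ (by fun_prop))
    exact hH.cont.comp (by fun_prop) fun z hz => ⟨trivial, hkm _ hz.2⟩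
  have hmL : ∀ t, ∀ x ∈ E0, m (t, x) ∈ L := by
    intro t x hx
    have := (hH.maps t _ (hkm x hx)).1
    rw [hE] at this
    exact hL _ this.1 _
  have hm0 : ∀ x, x ∈ E0 → m (0, x) = x := by
    intro x hx
    simp only [m]
    rw [H0 _ (hkm x hx)]
    simp only [kill, setCoeff_setCoeff]
    exact setCoeff_eq_self _ _ _ rfl
  let N : Set Amb := {x | x ∈ E0 ∧ ∀ t, m (t, x) ∈ O}
  have hN : ∀ x ∈ E, x ∈ {x | c x = 0} → N ∈ 𝓝[E] x := by
    intro x hx hx0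
    have hkx : kill x = x := setCoeff_eq_self _ _ _ hx0
    have hxE0 : x ∈ E0 := by simpa [E0, hkx] using hx
    have hE0 : E0 ∈ 𝓝[E] x := by
      have h1 : kill ⁻¹' O ∈ 𝓝 x := hkill.continuousAt.preimage_mem_nhds (by
        rw [hkx]; rw [hE] at hx; exact hO.mem_nhds hx.2)
      filter_upwards [self_mem_nhdsWithin, mem_nhdsWithin_of_mem_nhds h1] with y hy hy'
      simp only [E0, mem_ofPred_eq]
      rw [hE] at hy ⊢
      exact ⟨hL _ hy.1 _, hy'⟩
    have h2 := eventually_forall_mem_of_continuousOn hm hO hxE0 fun t => by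
      have : m (t, x) = H (t, x) := by
        simp only [m]
        rw [hkx]
        refine setCoeff_eq_self _ _ _ ?_
        rw [(hH.maps t x ⟨hx, hx0⟩).2]
        exact hx0.symm
      rw [this]
      have := (hH.maps t x ⟨hx, hx0⟩).1
      rw [hE] at this
      exact this.2
    have h3 : ∀ᶠ y in 𝓝[E] x, y ∈ E0 → ∀ t, m (t, y) ∈ O :=
      mem_nhdsWithin_of_mem_nhds (eventually_nhdsWithin_iff.1 h2)
    filter_upwards [hE0, h3] with y hy hy'
    exact ⟨hy, hy' hy⟩
  obtain ⟨l, u, hl, hu, hlN, hlu, hu0, hl1⟩ :=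
    exists_cutoff E {x | c x = 0} N (isClosed_eq hc continuous_const) hN
  let J : ↥I × Amb → Amb := fun z => if z ∈ Prod.snd ⁻¹' N then m (l z.2 * z.1, z.2) else z.2
  have hJc : ContinuousOn J (univ ×ˢ E) := by
    refine continuousOn_patch ?_ continuousOn_snd ?_
    · refine hm.comp (ContinuousOn.prodMk ?_ continuousOn_snd) fun z hz => ⟨trivial, hz.2.1⟩
      exact (hl.comp continuousOn_snd fun z hz => hz.1.2).mul continuousOn_fst
    · rintro ⟨t, x⟩ ⟨-, hx⟩
      rw [nhdsWithin_prod_eq]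
      rcases hlN x hx with h | h
      · right
        filter_upwards [h.prod_inr (𝓝[univ] t)] with z hz hzN
        rw [hz, zero_mul]
        exact hm0 _ hzN.1
      · left
        exact Eventually.prod_inr h (𝓝[univ] t)
  have hJN : ∀ t, ∀ x ∈ N, J (t, x) = m (l x * t, x) := by
    intro t x hx
    have : ((t, x) : ↥I × Amb) ∈ (Prod.snd ⁻¹' N : Set (↥I × Amb)) := hx
    simp only [J, this, if_true]
  have hJN' : ∀ t x, x ∉ N → J (t, x) = x := by
    intro t x hx
    have : ((t, x) : ↥I × Amb) ∉ (Prod.snd ⁻¹' N : Set (↥I × Amb)) := hx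
    simp only [J, this, if_false]
  have hJcoef : ∀ t, ∀ x, (J (t, x)).2 a d = x.2 a d := by
    intro t x
    by_cases h : x ∈ N
    · rw [hJN t x h]; simp [m, c]
    · rw [hJN' t x h]
  have hJ : ZFlow E J := by
    refine ⟨hJc, ?_, ?_⟩
    · intro t x hx
      by_cases h : x ∈ N
      · rw [hJN t x h, hE]
        exact ⟨hmL _ _ h.1, h.2 _⟩
      · rwa [hJN' t x h]
    · intro t x hx hx0
      by_cases h : x ∈ N
      · rw [hJN t x h]
        simp only [m, setCoeff_fst]
        exact hH.zero _ _ (hkm x h.1) hx0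
      · rwa [hJN' t x h]
  have hJ1c : ContinuousOn (fun x => J (1, x)) E :=
    hJc.comp (by fun_prop) fun x hx => ⟨trivial, hx⟩
  let V : Set Amb := {x | c x ≠ 0}
  have hJV : ∀ x ∈ E, x ∈ V → J (1, x) ∈ E ∩ {x | x.2 a d ≠ 0} := by
    intro x hx hxV
    refine ⟨hJ.maps _ _ hx, ?_⟩
    simp only [mem_ofPred_eq, hJcoef]
    exact hxV
  have hlJ : ∀ x ∈ E, l x = 1 → (J (1, x)).1 = 0 := by
    intro x hx hlx
    have hxN : x ∈ N := by
      rcases hlN x hx with h | h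
      · have := h.self_of_nhdsWithin hx
        rw [hlx] at this
        exact absurd this one_ne_zero
      · exact mem_of_mem_nhdsWithin hx h
    rw [hJN _ _ hxN, hlx, one_mul]
    exact H1 _ (hkm x hxN.1)
  refine Good.of_concat (J := J) (G := fun z => if z ∈ Prod.snd ⁻¹' V then
    K (u z.2 * z.1, J (1, z.2)) else J (1, z.2)) hJ ⟨?_, ?_, ?_⟩ ?_ ?_ ?_
  · refine continuousOn_patch ?_ (hJ1c.comp continuousOn_snd fun z hz => hz.2) ?_
    · refine hK.cont.comp (ContinuousOn.prodMk ?_ ?_) fun z hz => ⟨trivial, hJV _ hz.1.2 hz.2⟩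
      · exact (hu.comp continuousOn_snd fun z hz => hz.1.2).mul continuousOn_fst
      · exact hJ1c.comp continuousOn_snd fun z hz => hz.1.2
    · rintro ⟨t, x⟩ ⟨-, hx⟩
      rw [nhdsWithin_prod_eq]
      by_cases h : c x = 0
      · right
        have hE' : ∀ᶠ y in 𝓝[E] x, y ∈ E := self_mem_nhdsWithin
        filter_upwards [(hu0 x hx h).prod_inr (𝓝[univ] t), hE'.prod_inr (𝓝[univ] t)]
          with z hz hzE hzN
        rw [hz, zero_mul]
        exact K0 _ (hJV _ hzE hzN)
      · left
        have : V ∈ 𝓝 x := (isOpen_ne_fun hc continuous_const).mem_nhds h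
        have h' : ∀ᶠ y in 𝓝[E] x, y ∈ V := mem_nhdsWithin_of_mem_nhds this
        exact h'.prod_inr (𝓝[univ] t)
  · intro t x hx
    simp only [mem_preimage]
    split_ifs with h
    · exact (hK.maps _ _ (hJV x hx h)).1
    · exact hJ.maps _ _ hx
  · intro t x hx hx0
    simp only [mem_preimage]
    split_ifs with h
    · exact hK.zero _ _ (hJV x hx h) (hJ.zero _ _ hx hx0)
    · exact hJ.zero _ _ hx hx0
  · intro x hx
    by_cases h : x ∈ N
    · rw [hJN _ _ h, mul_zero, hm0 _ h.1]
    · rw [hJN' _ _ h]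
  · intro x hx
    simp only [mem_preimage, mul_zero]
    split_ifs with h
    · exact K0 _ (hJV x hx h)
    · rfl
  · intro x hx
    simp only [mem_preimage, mul_one]
    split_ifs with h
    · by_cases hlx : l x = 1
      · exact hK.zero _ _ (hJV x hx h) (hlJ x hx hlx)
      · rw [hlu x hx hlx]
        exact K1 _ (hJV x hx h)
    · refine hlJ x hx ((hl1 x hx ?_).self_of_nhdsWithin hx)
      by_contra hc'
      exact h hc'

section Algebra

variable {F : Type*} [Field F] [Algebra ℝ F]

/-- The basis element `z ^ (a % 2) * w ^ (a / 2)`. -/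
noncomputable def basisElt (z w : F[X]) (a : ℕ) : F[X] := z ^ (a % 2) * w ^ (a / 2)

/-- The polynomial with given real coefficients in the basis `basisElt`. -/
noncomputable def phi (z w : F[X]) (N : ℕ) : (ℕ → ℝ) →ₗ[ℝ] F[X] :=
  ∑ a ∈ Finset.range N, (LinearMap.proj a : (ℕ → ℝ) →ₗ[ℝ] ℝ).smulRight (basisElt z w a)

theorem phi_apply (z w : F[X]) (N : ℕ) (y : ℕ → ℝ) :
    phi z w N y = ∑ a ∈ Finset.range N, y a • basisElt z w a := by
  simp [phi]

theorem phi_of_le (z w : F[X]) {K N : ℕ} (h : K ≤ N) {y : ℕ → ℝ} (hy : ∀ a, K ≤ a → y a = 0) :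
    phi z w N y = phi z w K y := by
  rw [phi_apply, phi_apply]
  symm
  refine Finset.sum_subset (by simpa using h) fun a _ ha => ?_
  rw [hy a (by simpa using ha), zero_smul]

theorem phi_single (z w : F[X]) {N a : ℕ} (h : a < N) (r : ℝ) :
    phi z w N (Pi.single a r) = r • basisElt z w a := by
  rw [phi_apply, Finset.sum_eq_single a]
  · simp
  · intro b _ hb
    simp [hb]
  · intro ha
    simp [h] at ha

/-- `F[X]` is a model, over the parameter `s`, of the ring `ℝ[w, z] / (z ^ 2 = s * w - 1)`. -/
structure IsModel (s : ℝ) (κ : ℕ) (z w : F[X]) : Prop where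
  kappa : κ = 1 ∨ κ = 2
  sq : z * z = s • w - 1
  deg : ∀ N y d, d < N → (∀ a, d < a → y a = 0) → y d ≠ 0 →
    (phi z w N y).natDegree = d / κ ∧ phi z w N y ≠ 0
  surj : ∀ (f : F[X]) m, f.degree < (m : ℕ) → ∃ y : ℕ → ℝ, (∀ a, κ * m ≤ a → y a = 0) ∧
    phi z w (κ * m) y = f

theorem IsModel.eq_zero {s : ℝ} {κ : ℕ} {z w : F[X]} (M : IsModel s κ z w) {N : ℕ} {y : ℕ → ℝ}
    (hy : ∀ a, N ≤ a → y a = 0) (h : phi z w N y = 0) : y = 0 := by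
  by_contra hne
  obtain ⟨a, ha⟩ : ∃ a, y a ≠ 0 := by
    by_contra! hc
    exact hne (funext hc)
  have haN : ∀ b, y b ≠ 0 → b ≤ N := fun b hb => by
    by_contra! hc
    exact hb (hy b hc.le)
  have h1 : y (Nat.findGreatest (fun a => y a ≠ 0) N) ≠ 0 :=
    Nat.findGreatest_spec (P := fun a => y a ≠ 0) (haN a ha) ha
  have hlt : Nat.findGreatest (fun a => y a ≠ 0) N < N := by
    by_contra! hc
    exact h1 (hy _ hc)
  refine (M.deg N y _ hlt ?_ h1).2 h
  intro b hb
  by_contra hb'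
  exact absurd (Nat.le_findGreatest (P := fun a => y a ≠ 0) (haN b hb') hb') (by omega)

theorem IsModel.natDegree_le {s : ℝ} {κ : ℕ} {z w : F[X]} (M : IsModel s κ z w) {N d : ℕ}
    {y : ℕ → ℝ} (hy : ∀ a, d < a → y a = 0) : (phi z w N y).natDegree ≤ d / κ := by
  by_cases h : phi z w N y = 0
  · simp [h]
  · let y' : ℕ → ℝ := fun a => if a < N then y a else 0
    have hyy : phi z w N y = phi z w N y' := by
      rw [phi_apply, phi_apply]
      refine Finset.sum_congr rfl fun a ha => ?_
      simp only [y', Finset.mem_range.1 ha, if_true]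
    rw [hyy] at h ⊢
    obtain ⟨a, ha⟩ : ∃ a, y' a ≠ 0 := by
      by_contra! hc
      exact h (by rw [funext hc]; exact map_zero _)
    have haN : ∀ b, y' b ≠ 0 → b ≤ d ∧ b < N := fun b hb => by
      simp only [y', ne_eq, ite_eq_right_iff, Classical.not_imp] at hb
      refine ⟨?_, hb.1⟩
      by_contra! hc
      exact hb.2 (hy b hc)
    have h1 : y' (Nat.findGreatest (fun a => y' a ≠ 0) d) ≠ 0 :=
      Nat.findGreatest_spec (P := fun a => y' a ≠ 0) (haN a ha).1 ha
    rw [(M.deg N y' _ (haN _ h1).2 ?_ h1).1]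
    · exact Nat.div_le_div_right (Nat.findGreatest_le d)
    · intro b hb
      by_contra hb'
      exact absurd (Nat.le_findGreatest (P := fun a => y' a ≠ 0) (haN b hb').1 hb') (by omega)

/-- Structure constants of the multiplication in the basis `basisElt`. -/
noncomputable def basisMul (s : ℝ) (p a : ℕ) : ℕ → ℝ :=
  if p % 2 = 1 ∧ a % 2 = 1 then Pi.single (p + a) s - Pi.single (p + a - 2) 1
  else Pi.single (p + a) 1

/-- Multiplication of coefficient sequences. -/
noncomputable def seqMul (P : ℕ) (s : ℝ) (h y : ℕ → ℝ) : ℕ → ℝ :=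
  ∑ p ∈ Finset.range P, ∑ a ∈ Finset.range P, (h p * y a) • basisMul s p a

theorem phi_basisMul {s : ℝ} {z w : F[X]} (hsq : z * z = s • w - 1) {N p a : ℕ} (h : p + a < N) :
    phi z w N (basisMul s p a) = basisElt z w p * basisElt z w a := by
  unfold basisMul
  split_ifs with hpa
  · rw [map_sub, phi_single _ _ h, phi_single _ _ (by omega)]
    unfold basisElt
    have e1 : (p + a) % 2 = 0 := by omega
    have e2 : (p + a - 2) % 2 = 0 := by omega
    have e3 : (p + a) / 2 = p / 2 + a / 2 + 1 := by omega
    have e4 : (p + a - 2) / 2 = p / 2 + a / 2 := by omega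
    rw [e1, e2, e3, e4, hpa.1, hpa.2]
    calc s • (z ^ 0 * w ^ (p / 2 + a / 2 + 1)) - (1 : ℝ) • (z ^ 0 * w ^ (p / 2 + a / 2))
        = (s • w - 1) * (w ^ (p / 2) * w ^ (a / 2)) := by
          rw [one_smul, sub_mul, smul_mul_assoc, pow_succ, pow_add, pow_zero]
          ring_nf
      _ = _ := by rw [← hsq]; ring
  · rw [phi_single _ _ h, one_smul]
    unfold basisElt
    have e3 : (p + a) / 2 = p / 2 + a / 2 := by omega
    have e1 : (p + a) % 2 = p % 2 + a % 2 := by omega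
    rw [e1, e3, pow_add, pow_add]
    ring

theorem phi_seqMul {s : ℝ} {z w : F[X]} (hsq : z * z = s • w - 1) {N P : ℕ} (h : 2 * P ≤ N + 1)
    (x y : ℕ → ℝ) : phi z w N (seqMul P s x y) = phi z w P x * phi z w P y := by
  unfold seqMul
  rw [phi_apply z w P, phi_apply z w P, Finset.sum_mul_sum, map_sum]
  refine Finset.sum_congr rfl fun p hp => ?_
  rw [map_sum]
  refine Finset.sum_congr rfl fun a ha => ?_
  rw [Finset.mem_range] at hp ha
  rw [map_smul, phi_basisMul hsq (by omega), smul_mul_smul_comm]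

theorem basisMul_eq_zero (s : ℝ) {p a m : ℕ} (h : p + a < m) : basisMul s p a m = 0 := by
  unfold basisMul
  have h1 : m ≠ p + a := by omega
  have h2 : m ≠ p + a - 2 := by omega
  split_ifs <;> simp [h1, h2]

theorem seqMul_apply (P : ℕ) (s : ℝ) (h y : ℕ → ℝ) (m : ℕ) : seqMul P s h y m =
    ∑ p ∈ Finset.range P, ∑ a ∈ Finset.range P, h p * y a * basisMul s p a m := by
  simp [seqMul, Finset.sum_apply]

theorem seqMul_eq_zero {P : ℕ} {s : ℝ} {h y : ℕ → ℝ} {p a m : ℕ} (hh : ∀ b, p < b → h b = 0)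
    (hy : ∀ b, a < b → y b = 0) (hm : p + a < m) : seqMul P s h y m = 0 := by
  rw [seqMul_apply]
  refine Finset.sum_eq_zero fun p' _ => Finset.sum_eq_zero fun a' _ => ?_
  by_cases h1 : p < p'
  · simp [hh _ h1]
  by_cases h2 : a < a'
  · simp [hy _ h2]
  rw [basisMul_eq_zero _ (by omega), mul_zero]

theorem continuous_basisMul (p a m : ℕ) : Continuous fun s : ℝ => basisMul s p a m := by
  unfold basisMul
  split_ifs
  · by_cases h : m = p + a
    · subst h
      simp only [Pi.sub_apply, Pi.single_eq_same]
      fun_prop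
    · simp only [Pi.sub_apply, Pi.single_eq_of_ne h]
      fun_prop
  · fun_prop

theorem continuous_seqMul (P : ℕ) :
    Continuous fun q : ℝ × (ℕ → ℝ) × (ℕ → ℝ) => seqMul P q.1 q.2.1 q.2.2 := by
  refine continuous_pi fun m => ?_
  simp only [seqMul_apply]
  refine continuous_finsetSum _ fun p _ => continuous_finsetSum _ fun a _ => ?_
  have := (continuous_basisMul p a m).comp (continuous_fst : Continuous
    fun q : ℝ × (ℕ → ℝ) × (ℕ → ℝ) => q.1)
  have h2 : Continuous fun q : ℝ × (ℕ → ℝ) × (ℕ → ℝ) => q.2.1 p * q.2.2 a := by fun_prop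
  exact h2.mul this

end Algebra

/-- The element `w` of the real model over `s > 0`. -/
noncomputable def realW (s : ℝ) : ℝ[X] := s⁻¹ • (X ^ 2 + 1)

theorem basisElt_real_natDegree {s : ℝ} (hs : 0 < s) (a : ℕ) :
    (basisElt X (realW s) a).natDegree = a ∧ basisElt X (realW s) a ≠ 0 := by
  have h1 : (X ^ 2 + 1 : ℝ[X]).natDegree = 2 := by compute_degree!
  have h2 : (realW s).natDegree = 2 := by
    unfold realW
    rw [natDegree_smul _ (inv_ne_zero hs.ne'), h1]
  have h3 : realW s ≠ 0 := by
    intro h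
    rw [h] at h2
    simp at h2
  unfold basisElt
  refine ⟨?_, mul_ne_zero (pow_ne_zero _ X_ne_zero) (pow_ne_zero _ h3)⟩
  rw [natDegree_mul (pow_ne_zero _ X_ne_zero) (pow_ne_zero _ h3), natDegree_pow, natDegree_pow, h2,
    natDegree_X]
  omega

theorem isModel_real {s : ℝ} (hs : 0 < s) : IsModel s 1 X (realW s) := by
  have hb := basisElt_real_natDegree hs
  have hlt : ∀ (y : ℕ → ℝ) d, (phi X (realW s) d y).degree < (d : ℕ) := by
    intro y d
    rw [← mem_degreeLT, phi_apply]
    refine Submodule.sum_mem _ fun a ha => Submodule.smul_mem _ _ ?_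
    rw [mem_degreeLT, degree_eq_natDegree (hb a).2, (hb a).1]
    exact_mod_cast Finset.mem_range.1 ha
  have hsucc : ∀ (y : ℕ → ℝ) d, phi X (realW s) (d + 1) y =
      phi X (realW s) d y + y d • basisElt X (realW s) d := by
    intro y d
    rw [phi_apply, phi_apply, Finset.sum_range_succ]
  refine ⟨Or.inl rfl, ?_, ?_, ?_⟩
  · unfold realW
    rw [smul_smul, mul_inv_cancel₀ hs.ne', one_smul]
    ring
  · intro N y d hd hy hyd
    rw [phi_of_le _ _ (show d + 1 ≤ N by omega) (fun a ha => hy a (by omega)), hsucc]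
    have h1 : (y d • basisElt X (realW s) d).degree = d := by
      rw [degree_eq_natDegree (smul_ne_zero hyd (hb d).2), natDegree_smul _ hyd, (hb d).1]
    have h2 := degree_add_eq_right_of_degree_lt (h1 ▸ hlt y d)
    rw [h1] at h2
    refine ⟨by rw [natDegree_eq_of_degree_eq_some h2, Nat.div_one], fun h => ?_⟩
    rw [h] at h2
    simp at h2
  · intro f m
    induction m generalizing f with
    | zero =>
      intro hf
      refine ⟨0, fun _ _ => rfl, ?_⟩
      rw [map_zero]
      symm
      simpa [degree_eq_bot] using hf
    | succ m ih =>
      intro hf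
      let b := basisElt X (realW s) m
      let r := f.coeff m / b.leadingCoeff
      have hl : b.leadingCoeff ≠ 0 := leadingCoeff_ne_zero.2 (hb m).2
      obtain ⟨y, hy, hyf⟩ := ih (f - r • b) (by
        rw [degree_lt_iff_coeff_zero]
        intro a ha
        rcases ha.eq_or_lt with h | h
        · subst h
          have : b.coeff m = b.leadingCoeff := by
            rw [leadingCoeff, (hb m).1]
          rw [coeff_sub, coeff_smul, this, smul_eq_mul, div_mul_cancel₀ _ hl, sub_self]
        · have h1 : f.coeff a = 0 := (degree_lt_iff_coeff_zero _ _).1 hf a (by exact_mod_cast h)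
          have h2 : b.coeff a = 0 := coeff_eq_zero_of_natDegree_lt (by rw [(hb m).1]; exact h)
          rw [coeff_sub, coeff_smul, h1, h2, smul_zero, sub_zero])
      rw [one_mul] at hy hyf
      refine ⟨y + Pi.single m r, fun a ha => ?_, ?_⟩
      · have h2 : a ≠ m := by omega
        simp [hy a (by omega), h2]
      · rw [map_add, one_mul, phi_single _ _ (Nat.lt_succ_self m), phi_of_le _ _ m.le_succ hy, hyf]
        simp [b]

theorem phi_complex_even (M : ℕ) (y : ℕ → ℝ) : phi (C Complex.I) X (2 * M) y =
    ∑ b ∈ Finset.range M, C ((y (2 * b) : ℂ) + y (2 * b + 1) * Complex.I) * X ^ b := by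
  rw [phi_apply]
  induction M with
  | zero => simp
  | succ M ih =>
    rw [Finset.sum_range_succ _ M, ← ih, show 2 * (M + 1) = 2 * M + 1 + 1 by ring,
      Finset.sum_range_succ, Finset.sum_range_succ, add_assoc]
    congr 1
    unfold basisElt
    have e1 : 2 * M % 2 = 0 := by omega
    have e2 : (2 * M + 1) % 2 = 1 := by omega
    have e3 : 2 * M / 2 = M := by omega
    have e4 : (2 * M + 1) / 2 = M := by omega
    rw [e1, e2, e3, e4]
    rw [map_add, add_mul, map_mul]
    simp only [pow_zero, one_mul, pow_one]
    rw [← algebraMap_smul ℂ (y (2 * M)), ← algebraMap_smul ℂ (y (2 * M + 1)), smul_eq_C_mul,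
      smul_eq_C_mul, mul_assoc]
    rfl

theorem coeff_phi_complex {N : ℕ} {y : ℕ → ℝ} (hy : ∀ a, N ≤ a → y a = 0) (b : ℕ) :
    (phi (C Complex.I) X N y).coeff b = (y (2 * b) : ℂ) + y (2 * b + 1) * Complex.I := by
  rw [← phi_of_le _ _ (show N ≤ 2 * N by omega) hy, phi_complex_even, finsetSum_coeff]
  simp only [coeff_C_mul, coeff_X_pow]
  by_cases h : b < N
  · rw [Finset.sum_eq_single b]
    · simp
    · intro c _ hc
      simp [hc.symm]
    · simp [h]
  · rw [hy (2 * b) (by omega), hy (2 * b + 1) (by omega), Finset.sum_eq_zero]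
    · simp
    · intro c hc
      have : b ≠ c := by
        rw [Finset.mem_range] at hc
        omega
      simp [this]

theorem isModel_complex : IsModel 0 2 (C Complex.I) (X : ℂ[X]) := by
  refine ⟨Or.inr rfl, ?_, ?_, ?_⟩
  · rw [← C_mul, Complex.I_mul_I]
    simp
  · intro N y d hd hy hyd
    have hc := coeff_phi_complex (fun a (ha : N ≤ a) => hy a (by omega))
    have h1 : (phi (C Complex.I) X N y).coeff (d / 2) ≠ 0 := by
      rw [hc]
      intro h
      have hre := congrArg Complex.re h
      have him := congrArg Complex.im h
      simp at hre him
      rcases Nat.even_or_odd' d with ⟨e, he | he⟩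
      · rw [he, show 2 * (2 * e / 2) = 2 * e by omega] at hre
        exact hyd (he ▸ hre)
      · rw [show 2 * (d / 2) + 1 = d by omega] at him
        exact hyd him
    refine ⟨natDegree_eq_of_le_of_coeff_ne_zero ?_ h1, fun h => h1 (by rw [h, coeff_zero])⟩
    rw [natDegree_le_iff_coeff_eq_zero]
    intro b hb
    rw [hc, hy (2 * b) (by omega), hy (2 * b + 1) (by omega)]
    simp
  · intro f m hf
    let y : ℕ → ℝ := fun a => if a % 2 = 0 then (f.coeff (a / 2)).re else (f.coeff (a / 2)).im
    have hy : ∀ a, 2 * m ≤ a → y a = 0 := by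
      intro a ha
      have : f.coeff (a / 2) = 0 := (degree_lt_iff_coeff_zero _ _).1 hf _ (by omega)
      simp [y, this]
    refine ⟨y, hy, ?_⟩
    ext b
    rw [coeff_phi_complex hy]
    have e1 : (2 * b) % 2 = 0 := by omega
    have e2 : (2 * b + 1) % 2 = 1 := by omega
    have e3 : 2 * b / 2 = b := by omega
    have e4 : (2 * b + 1) / 2 = b := by omega
    simp only [y, e1, e2, e3, e4, if_true, one_ne_zero, if_false]
    exact Complex.re_add_im _

theorem exists_combination_natDegree_le {F ι : Type*} [Field F] [Fintype ι] (Y : ι → F[X]) (j₀ : ι)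
    (h₀ : Y j₀ ≠ 0) {B : ℕ} (hB : ∀ j, (Y j).natDegree ≤ B) {f : F[X]}
    (hf : f ∈ Ideal.span (range Y)) {D : ℕ} (hD : f.natDegree ≤ (Y j₀).natDegree + D)
    (hBD : B ≤ D) :
    ∃ H : ι → F[X], f = ∑ j, H j * Y j ∧ (∀ j, j ≠ j₀ → (H j).natDegree ≤ (Y j₀).natDegree) ∧
      (H j₀).natDegree ≤ D := by
  classical
  obtain ⟨H, hH⟩ := (Ideal.mem_span_range_iff_exists_fun).1 hf
  let R : ι → F[X] := fun j => H j % Y j₀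
  let q : F[X] := H j₀ + ∑ j ∈ Finset.univ.erase j₀, H j / Y j₀ * Y j
  have hR : ∀ j, (R j).natDegree ≤ (Y j₀).natDegree := fun j =>
    natDegree_le_natDegree (EuclideanDomain.mod_lt (H j) h₀).le
  have hsum : f = q * Y j₀ + ∑ j ∈ Finset.univ.erase j₀, R j * Y j := by
    rw [← hH, ← Finset.add_sum_erase _ _ (Finset.mem_univ j₀), add_mul, add_assoc, Finset.sum_mul,
      ← Finset.sum_add_distrib]
    congr 1
    refine Finset.sum_congr rfl fun j _ => ?_
    have := EuclideanDomain.div_add_mod (H j) (Y j₀)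
    calc H j * Y j = (Y j₀ * (H j / Y j₀) + H j % Y j₀) * Y j := by rw [this]
      _ = _ := by simp only [R]; ring
  have hq : q.natDegree ≤ D := by
    by_cases hq0 : q = 0
    · simp [hq0]
    have h1 : (q * Y j₀).natDegree ≤ (Y j₀).natDegree + D := by
      rw [eq_sub_of_add_eq hsum.symm]
      refine (natDegree_sub_le _ _).trans (max_le hD ?_)
      refine natDegree_sum_le_of_forall_le _ _ fun j _ => ?_
      refine natDegree_mul_le.trans (add_le_add (hR j) ((hB j).trans hBD))
    rw [natDegree_mul hq0 h₀] at h1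
    omega
  refine ⟨fun j => if j = j₀ then q else R j, ?_, ?_, ?_⟩
  · rw [← Finset.add_sum_erase _ _ (Finset.mem_univ j₀)]
    simp only [if_true]
    rw [hsum]
    congr 1
    refine Finset.sum_congr rfl fun j hj => ?_
    rw [if_neg (Finset.ne_of_mem_erase hj)]
  · intro j hj
    simpa [hj] using hR j
  · simpa using hq

section Openness

variable {F : Type*} [Field F] [Algebra ℝ F]

/-- Common divisors of the polynomials with the given coefficient sequences have degree at most
`(2 * i + 1) / κ`. -/
def BoundedGcd (κ N i : ℕ) (z w : F[X]) (y : ℕ → ℕ → ℝ) : Prop :=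
  ∀ g : F[X], (∀ j, g ∣ phi z w N (y j)) → g.natDegree ≤ (2 * i + 1) / κ

/-- Support conditions on a family of coefficient sequences. -/
structure SuppCond (j₀ d K a : ℕ) (y : ℕ → ℕ → ℝ) : Prop where
  le : j₀ ≤ a
  top : ∀ b, d < b → y j₀ b = 0
  ne : y j₀ d ≠ 0
  supp : ∀ j, ∀ b, K ≤ b → y j b = 0
  zero : ∀ j, a < j → y j = 0

/-- The combination of the sequences `y j` with multipliers `h j`. -/
noncomputable def seqComb (P : ℕ) (s : ℝ) (a : ℕ) (h y : ℕ → ℕ → ℝ) : ℕ → ℝ :=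
  ∑ j ∈ Finset.range (a + 1), seqMul P s (h j) (y j)

/-- Degree bound for the distinguished multiplier. -/
def multBound (d K i : ℕ) : ℕ := 2 * (d + K + i) + 1

theorem IsModel.phi_seqComb {s : ℝ} {κ : ℕ} {z w : F[X]} (M : IsModel s κ z w) {N P a K : ℕ}
    {h y : ℕ → ℕ → ℝ} (hy : ∀ j, ∀ b, K ≤ b → y j b = 0) (hKN : K ≤ N) (hKP : K ≤ P) :
    phi z w (2 * P) (seqComb P s a h y) =
      ∑ j ∈ Finset.range (a + 1), phi z w P (h j) * phi z w N (y j) := by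
  unfold seqComb
  rw [map_sum]
  refine Finset.sum_congr rfl fun j _ => ?_
  rw [phi_seqMul M.sq (by omega), phi_of_le z w hKN (hy j), phi_of_le z w hKP (hy j)]

theorem IsModel.exists_linearIndependent {s : ℝ} {κ : ℕ} {z w : F[X]} (M : IsModel s κ z w)
    {j₀ d K a N i : ℕ} {y : ℕ → ℕ → ℝ} (hd : d < N) (hK : K ≤ N) (hy : SuppCond j₀ d K a y)
    (hc : BoundedGcd κ N i z w y) :
    ∃ h : Fin (d + multBound d K i - 2 * i) → ℕ → ℕ → ℝ,
      (∀ q b, multBound d K i < b → h q j₀ b = 0) ∧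
      (∀ q j, j ≠ j₀ → ∀ b, 2 * d + 1 < b → h q j b = 0) ∧
      LinearIndependent ℝ fun q => fun m : Fin (d + multBound d K i + 1) =>
        seqComb (d + multBound d K i + 1) s a (h q) y m := by
  set L := multBound d K i with hL
  unfold multBound at hL
  let Y : Fin (a + 1) → F[X] := fun j => phi z w N (y j)
  let J₀ : Fin (a + 1) := ⟨j₀, Nat.lt_succ_of_le hy.le⟩
  obtain ⟨hYd, hY0⟩ := M.deg N (y j₀) d hd hy.top hy.ne
  obtain ⟨g, hg⟩ := (IsPrincipalIdealRing.principal (Ideal.span (range Y))).principal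
  rw [Ideal.submodule_span_eq] at hg
  have hgdvd : ∀ j, g ∣ phi z w N (y j) := by
    intro j
    by_cases hj : j ≤ a
    · rw [← Ideal.mem_span_singleton, ← hg]
      exact Ideal.subset_span ⟨⟨j, Nat.lt_succ_of_le hj⟩, rfl⟩
    · rw [hy.zero j (by omega), map_zero]
      exact dvd_zero g
  have hg0 : g ≠ 0 := fun h => hY0 (zero_dvd_iff.1 (h ▸ hgdvd j₀))
  have hgdeg := hc g hgdvd
  have hκ := M.kappa
  have hE : ∀ q : Fin (d + L - 2 * i), ∃ h : ℕ → ℕ → ℝ, (∀ b, L < b → h j₀ b = 0) ∧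
      (∀ j, j ≠ j₀ → ∀ b, 2 * d + 1 < b → h j b = 0) ∧
      phi z w (2 * (d + L + 1)) (seqComb (d + L + 1) s a h y) = g * basisElt z w q := by
    intro q
    have hq := q.2
    have hbq : (basisElt z w q).natDegree ≤ q / κ := by
      have := M.natDegree_le (N := q + 1) (y := Pi.single (q : ℕ) 1) (d := q) (fun b hb => by
        simp [hb.ne'])
      rwa [phi_single _ _ (Nat.lt_succ_self _), one_smul] at this
    obtain ⟨H, hH, hH1, hH2⟩ := exists_combination_natDegree_le Y J₀ hY0 (B := K / κ)
      (fun j => M.natDegree_le fun b hb => hy.supp j b hb.le) (f := g * basisElt z w q)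
      (by rw [hg]; exact Ideal.mul_mem_right _ _ (Ideal.mem_span_singleton_self g)) (D := L / κ)
      (by
        refine natDegree_mul_le.trans ?_
        change _ ≤ (phi z w N (y j₀)).natDegree + _
        rw [hYd]
        rcases hκ with rfl | rfl <;> omega)
      (Nat.div_le_div_right (by omega))
    have hdegH : ∀ j : Fin (a + 1), (H j).degree < ((if j = J₀ then L / κ + 1 else d / κ + 1 :
        ℕ)) := by
      intro j
      refine degree_le_natDegree.trans_lt ?_
      split_ifs with hj
      · rw [hj]
        exact_mod_cast Nat.lt_succ_of_le hH2
      · have := hH1 j hj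
        change _ ≤ (phi z w N (y j₀)).natDegree at this
        rw [hYd] at this
        exact_mod_cast Nat.lt_succ_of_le this
    choose hh hh1 hh2 using fun j => M.surj (H j) _ (hdegH j)
    let h : ℕ → ℕ → ℝ := fun j => if hj : j < a + 1 then hh ⟨j, hj⟩ else 0
    have hsup : ∀ j b, (if j = j₀ then L else 2 * d + 1) < b → h j b = 0 := by
      intro j b hb
      simp only [h]
      split_ifs with hj
      · apply hh1
        have : (⟨j, hj⟩ : Fin (a + 1)) = J₀ ↔ j = j₀ := by simp [J₀, Fin.ext_iff]
        simp only [this]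
        split_ifs at hb ⊢ <;> rcases hκ with rfl | rfl <;> omega
      · rfl
    refine ⟨h, fun b hb => hsup j₀ b (by simpa using hb), fun j hj b hb => hsup j b
      (by simpa [hj] using hb), ?_⟩
    rw [M.phi_seqComb hy.supp hK (by omega), hH, Finset.sum_range]
    refine Finset.sum_congr rfl fun j _ => ?_
    congr 1
    have hjj : h j = hh j := dif_pos j.2
    rw [← hh2 j, hjj]
    refine phi_of_le _ _ ?_ (hh1 j)
    split_ifs <;> rcases hκ with rfl | rfl <;> omega
  choose h h1 h2 h3 using hE
  refine ⟨h, h1, h2, ?_⟩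
  rw [Fintype.linearIndependent_iff]
  intro c hcz
  set P := d + L + 1 with hP
  have hzero : ∑ q, c q • seqComb P s a (h q) y = 0 := by
    funext m
    by_cases hm : m < P
    · have := congrFun hcz ⟨m, hm⟩
      simpa using this
    · simp only [Finset.sum_apply, Pi.smul_apply, Pi.zero_apply]
      refine Finset.sum_eq_zero fun q _ => ?_
      rw [seqComb, Finset.sum_apply, Finset.sum_eq_zero, smul_zero]
      intro j _
      by_cases hj : j = j₀
      · subst hj
        exact seqMul_eq_zero (h1 q) hy.top (by omega)
      · exact seqMul_eq_zero (h2 q j hj) (fun b hb => hy.supp j b hb.le) (a := K) (by omega)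
  have h4 := congrArg (phi z w (2 * P)) hzero
  simp only [map_sum, map_smul, h3, map_zero] at h4
  have h5 : g * ∑ q, c q • basisElt z w q = 0 := by
    rw [← h4, Finset.mul_sum]
    simp only [mul_smul_comm]
  have h6 := (mul_eq_zero.1 h5).resolve_left hg0
  let y' : ℕ → ℝ := ∑ q : Fin (d + L - 2 * i), c q • Pi.single (q : ℕ) (1 : ℝ)
  have h7 : y' = 0 := by
    refine M.eq_zero (N := d + L - 2 * i) ?_ ?_
    · intro b hb
      simp only [y', Finset.sum_apply]
      refine Finset.sum_eq_zero fun q _ => ?_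
      have : b ≠ q := by have := q.2; omega
      simp [this]
    · rw [← h6]
      simp only [y', map_sum, map_smul]
      refine Finset.sum_congr rfl fun q _ => ?_
      rw [phi_single _ _ q.2, one_smul]
  intro q
  have := congrFun h7 q
  simp only [y', Finset.sum_apply, Pi.smul_apply, Pi.zero_apply] at this
  rw [Finset.sum_eq_single q] at this
  · simpa using this
  · intro q' _ hq'
    have : (q : ℕ) ≠ q' := fun h => hq' (Fin.ext h.symm)
    simp [this]
  · simp

theorem IsModel.boundedGcd {s : ℝ} {κ : ℕ} {z w : F[X]} (M : IsModel s κ z w)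
    {j₀ d K a N i : ℕ} {y : ℕ → ℕ → ℝ} (hK : K ≤ N) (hy : SuppCond j₀ d K a y)
    {h : Fin (d + multBound d K i - 2 * i) → ℕ → ℕ → ℝ}
    (h1 : ∀ q b, multBound d K i < b → h q j₀ b = 0)
    (h2 : ∀ q j, j ≠ j₀ → ∀ b, 2 * d + 1 < b → h q j b = 0)
    (hli : LinearIndependent ℝ fun q => fun m : Fin (d + multBound d K i + 1) =>
        seqComb (d + multBound d K i + 1) s a (h q) y m) :
    BoundedGcd κ N i z w y := by
  intro g hg
  by_cases hg0 : g = 0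
  · simp [hg0]
  have hL : multBound d K i = 2 * (d + K + i) + 1 := rfl
  generalize multBound d K i = L at *
  generalize hP : d + L + 1 = P at *
  have hκ := M.kappa
  have hdeg : ∀ q, (phi z w (2 * P) (seqComb P s a (h q) y)).natDegree ≤ d / κ + L / κ := by
    intro q
    rw [M.phi_seqComb hy.supp hK (by omega)]
    refine natDegree_sum_le_of_forall_le _ _ fun j _ => natDegree_mul_le.trans ?_
    by_cases hj : j = j₀
    · subst hj
      have e1 := M.natDegree_le (N := P) (h1 q)
      have e2 := M.natDegree_le (N := N) hy.top
      omega
    · have e1 := M.natDegree_le (N := P) (h2 q j hj)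
      have e2 := M.natDegree_le (N := N) (d := K) fun b hb => hy.supp j b hb.le
      rcases hκ with rfl | rfl <;> omega
  have hdvd : ∀ q, ∃ G, phi z w (2 * P) (seqComb P s a (h q) y) = g * G := by
    intro q
    rw [M.phi_seqComb hy.supp hK (by omega)]
    exact Finset.dvd_sum fun j _ => (hg j).mul_left _
  choose G hG using hdvd
  set m := d / κ + L / κ + 1 - g.natDegree with hm
  have hGdeg : ∀ q, (G q).degree < (m : ℕ) := by
    intro q
    by_cases hGq : G q = 0
    · rw [hGq, degree_zero]
      exact WithBot.bot_lt_coe _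
    · rw [degree_eq_natDegree hGq]
      have := hdeg q
      rw [hG q, natDegree_mul hg0 hGq] at this
      exact_mod_cast (by omega : (G q).natDegree < m)
  choose u hu1 hu2 using fun q => M.surj (G q) m (hGdeg q)
  have hui : LinearIndependent ℝ fun q => fun b : Fin (κ * m) => u q b := by
    rw [Fintype.linearIndependent_iff] at hli ⊢
    intro c hc
    apply hli c
    have hu0 : ∑ q, c q • u q = 0 := by
      funext b
      by_cases hb : b < κ * m
      · simpa using congrFun hc ⟨b, hb⟩
      · simp only [Finset.sum_apply, Pi.smul_apply, Pi.zero_apply]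
        refine Finset.sum_eq_zero fun q _ => ?_
        rw [hu1 q b (by omega), smul_zero]
    have hG0 := congrArg (phi z w (κ * m)) hu0
    simp only [map_sum, map_smul, hu2, map_zero] at hG0
    have hv : ∑ q, c q • seqComb P s a (h q) y = 0 := by
      refine M.eq_zero (N := 2 * P) ?_ ?_
      · intro b hb
        simp only [Finset.sum_apply, Pi.smul_apply]
        refine Finset.sum_eq_zero fun q _ => ?_
        rw [seqComb, Finset.sum_apply, Finset.sum_eq_zero, smul_zero]
        intro j _
        by_cases hj : j = j₀
        · subst hj
          exact seqMul_eq_zero (h1 q) hy.top (by omega)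
        · exact seqMul_eq_zero (h2 q j hj) (fun b hb => hy.supp j b hb.le) (a := K) (by omega)
      · simp only [map_sum, map_smul, hG, ← mul_smul_comm]
        rw [← Finset.mul_sum, hG0, mul_zero]
    funext b
    simpa using congrFun hv b
  have hcard := hui.fintype_card_le_finrank
  rw [Fintype.card_fin, Module.finrank_fin_fun] at hcard
  rcases hκ with rfl | rfl <;> omega

end Openness

/-- The condition on common divisors, over all values of the parameter. -/
def AmbGcd (N i : ℕ) (x : Amb) : Prop :=
  (x.1 = 0 → BoundedGcd 2 N i (C Complex.I) X x.2) ∧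
    (x.1 ≠ 0 → BoundedGcd 1 N i X (realW x.1) x.2)

theorem continuous_seqComb (P a : ℕ) (h : ℕ → ℕ → ℝ) :
    Continuous fun x : Amb => seqComb P x.1 a h x.2 := by
  unfold seqComb
  refine continuous_finsetSum _ fun j _ => ?_
  exact (continuous_seqMul P).comp (f := fun x : Amb => ((x.1 : ℝ), h j, x.2 j)) (by fun_prop)

theorem isOpen_ambGcd {N i j₀ d K a : ℕ} (hd : d < N) (hK : K ≤ N) :
    ∃ O : Set Amb, IsOpen O ∧ ∀ x : Amb, SuppCond j₀ d K a x.2 → (x ∈ O ↔ AmbGcd N i x) := by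
  let r := d + multBound d K i - 2 * i
  let P := d + multBound d K i + 1
  let T : Set (Fin r → ℕ → ℕ → ℝ) := {h | (∀ q b, multBound d K i < b → h q j₀ b = 0) ∧
    ∀ q j, j ≠ j₀ → ∀ b, 2 * d + 1 < b → h q j b = 0}
  let f : (Fin r → ℕ → ℕ → ℝ) → Amb → Fin r → Fin P → ℝ := fun h x q m =>
    seqComb P x.1 a (h q) x.2 m
  have hf : ∀ h, Continuous (f h) := by
    intro h
    refine continuous_pi fun q => continuous_pi fun m => ?_
    exact (continuous_apply (m : ℕ)).comp (continuous_seqComb P a (h q))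
  refine ⟨⋃ h ∈ T, f h ⁻¹' {v | LinearIndependent ℝ v}, ?_, ?_⟩
  · exact isOpen_biUnion fun h _ => isOpen_setOfPred_linearIndependent.preimage (hf h)
  · intro x hx
    simp only [mem_iUnion, mem_preimage, exists_prop]
    constructor
    · rintro ⟨h, ⟨h1, h2⟩, hli⟩
      refine ⟨fun h0 => ?_, fun h0 => ?_⟩
      · refine isModel_complex.boundedGcd hK hx h1 h2 ?_
        have : (x.1 : ℝ) = 0 := by rw [h0]; rfl
        rw [← this]
        exact hli
      · exact (isModel_real (NNReal.coe_pos.2 (pos_iff_ne_zero.2 h0))).boundedGcd hK hx h1 h2 hli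
    · rintro ⟨hx0, hx1⟩
      by_cases h0 : x.1 = 0
      · obtain ⟨h, h1, h2, hli⟩ := isModel_complex.exists_linearIndependent hd hK hx (hx0 h0)
        refine ⟨h, ⟨h1, h2⟩, ?_⟩
        have : (x.1 : ℝ) = 0 := by rw [h0]; rfl
        rw [← this] at hli
        exact hli
      · obtain ⟨h, h1, h2, hli⟩ := (isModel_real (NNReal.coe_pos.2
          (pos_iff_ne_zero.2 h0))).exists_linearIndependent hd hK hx (hx1 h0)
        exact ⟨h, ⟨h1, h2⟩, hli⟩

/-- The product of the `p`-th basis element with a coefficient sequence. -/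
noncomputable def seqShift (N : ℕ) (s : ℝ) (p : ℕ) (y : ℕ → ℝ) : ℕ → ℝ :=
  seqMul N s (Pi.single p 1) y

theorem seqShift_apply {N p : ℕ} (hp : p < N) (s : ℝ) (y : ℕ → ℝ) (m : ℕ) :
    seqShift N s p y m = ∑ a ∈ Finset.range N, y a * basisMul s p a m := by
  rw [seqShift, seqMul_apply, Finset.sum_eq_single p]
  · simp
  · intro q _ hq
    simp [hq]
  · simp [hp]

theorem seqShift_eq_zero {N p d m : ℕ} (s : ℝ) {y : ℕ → ℝ} (hy : ∀ b, d < b → y b = 0)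
    (hm : p + d < m) : seqShift N s p y m = 0 :=
  seqMul_eq_zero (p := p) (fun b hb => by simp [hb.ne']) hy hm

theorem seqShift_top {N p d : ℕ} (hp : p < N) (hd : d < N) (s : ℝ) {y : ℕ → ℝ}
    (hy : ∀ b, d < b → y b = 0) :
    seqShift N s p y (p + d) = y d * if p % 2 = 1 ∧ d % 2 = 1 then s else 1 := by
  rw [seqShift_apply hp, Finset.sum_eq_single d]
  · unfold basisMul
    split_ifs with h
    · have : p + d ≠ p + d - 2 := by omega
      simp [this]
    · simp
  · intro a _ ha
    rcases lt_or_gt_of_ne ha with h | h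
    · rw [basisMul_eq_zero _ (by omega), mul_zero]
    · rw [hy a h, zero_mul]
  · simp [hd]

theorem seqShift_add {N p q : ℕ} (hp : p < N) (hq : q < N) (s : ℝ) (y : ℕ → ℝ)
    (hpq : p % 2 = 0 ∨ q % 2 = 0) : seqShift N s p y (p + q) = y q := by
  rw [seqShift_apply hp, Finset.sum_eq_single q]
  · unfold basisMul
    rw [if_neg (by omega)]
    simp
  · intro a _ ha
    unfold basisMul
    split_ifs with h
    · have h1 : p + q ≠ p + a := by omega
      have h2 : p + q ≠ p + a - 2 := by omega
      rw [Pi.sub_apply, Pi.single_eq_of_ne h1, Pi.single_eq_of_ne h2, sub_zero, mul_zero]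
    · have h1 : p + q ≠ p + a := by omega
      rw [Pi.single_eq_of_ne h1, mul_zero]
  · simp [hq]

theorem seqShift_zero_odd {N p q m : ℕ} (hp : p < N) (hq : q < N) (y : ℕ → ℝ) (hp2 : p % 2 = 1)
    (hq2 : q % 2 = 1) (hm : m + 2 = p + q) : seqShift N 0 p y m = - y q := by
  rw [seqShift_apply hp, Finset.sum_eq_single q]
  · unfold basisMul
    rw [if_pos ⟨hp2, hq2⟩]
    have h1 : m = p + q - 2 := by omega
    simp [← h1]
  · intro a _ ha
    unfold basisMul
    split_ifs with h
    · have h2 : m ≠ p + a - 2 := by omega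
      simp [h2]
    · have h1 : m ≠ p + a := by omega
      simp [h1]
  · simp [hq]

theorem dvd_phi_seqShift {F : Type*} [Field F] [Algebra ℝ F] {s : ℝ} {z w : F[X]}
    (hsq : z * z = s • w - 1) {N p : ℕ} {y : ℕ → ℝ} :
    phi z w N y ∣ phi z w (2 * N) (seqShift N s p y) := by
  rw [seqShift, phi_seqMul hsq (by omega)]
  exact dvd_mul_left _ _

theorem continuous_seqShift (N p : ℕ) :
    Continuous fun q : ℝ × (ℕ → ℝ) => seqShift N q.1 p q.2 :=
  (continuous_seqMul N).comp (f := fun q : ℝ × (ℕ → ℝ) => (q.1, Pi.single p 1, q.2)) (by fun_prop)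

/-- The polynomial represented by `β` is a multiple of the polynomial represented by `y`. -/
def IsMult (N : ℕ) (s : ℝ≥0) (y β : ℕ → ℝ) : Prop :=
  (s = 0 → phi (C Complex.I) X N y ∣ phi (C Complex.I) X N β) ∧
    (s ≠ 0 → phi X (realW s) N y ∣ phi X (realW s) N β)

theorem IsMult.smul {N : ℕ} {s : ℝ≥0} {y β : ℕ → ℝ} (h : IsMult N s y β) (r : ℝ) :
    IsMult N s y (r • β) := by
  refine ⟨fun h0 => ?_, fun h0 => ?_⟩
  · rw [map_smul]; exact (h.1 h0).trans (Dvd.intro_left (algebraMap ℝ ℂ[X] r) (by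
      rw [Algebra.smul_def]))
  · rw [map_smul]; exact (h.2 h0).trans (Dvd.intro_left (algebraMap ℝ ℝ[X] r) (by
      rw [Algebra.smul_def]))

theorem IsMult.sub {N : ℕ} {s : ℝ≥0} {y β γ : ℕ → ℝ} (h : IsMult N s y β) (h' : IsMult N s y γ) :
    IsMult N s y (β - γ) := by
  refine ⟨fun h0 => ?_, fun h0 => ?_⟩ <;> rw [map_sub]
  · exact dvd_sub (h.1 h0) (h'.1 h0)
  · exact dvd_sub (h.2 h0) (h'.2 h0)

theorem isMult_seqShift {N : ℕ} (s : ℝ≥0) (p : ℕ) {y : ℕ → ℝ}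
    (h : ∀ b, N ≤ b → seqShift N s p y b = 0) : IsMult N s y (seqShift N s p y) := by
  refine ⟨fun h0 => ?_, fun h0 => ?_⟩
  · rw [← phi_of_le _ _ (show N ≤ 2 * N by omega) h]
    refine dvd_phi_seqShift ?_
    rw [h0]
    exact isModel_complex.sq
  · rw [← phi_of_le _ _ (show N ≤ 2 * N by omega) h]
    exact dvd_phi_seqShift (isModel_real (NNReal.coe_pos.2 (pos_iff_ne_zero.2 h0))).sq

/-- If every sequence of `x` is a multiple of one from `x'`, up to multiples of a fixed one,
then a bound on common divisors passes from `x` to `x'`. -/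
theorem AmbGcd.of_isMult {N i : ℕ} {x x' : Amb} (hx : AmbGcd N i x) (hs : x'.1 = x.1)
    (h : ∀ j, ∃ j₁ j₂, ∃ r : ℝ, IsMult N x.1 (x'.2 j₁) (x.2 j - r • x'.2 j₂)) : AmbGcd N i x' := by
  choose j₁ j₂ r hr using h
  refine ⟨fun h0 g hg => ?_, fun h0 g hg => ?_⟩
  · rw [hs] at h0
    refine hx.1 h0 g fun j => ?_
    have h1 := (hg (j₁ j)).trans ((hr j).1 h0)
    rw [map_sub, map_smul, Algebra.smul_def] at h1
    exact (dvd_sub_left ((hg (j₂ j)).mul_left _)).1 h1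
  · rw [hs] at h0 hg
    refine hx.2 h0 g fun j => ?_
    have h1 := (hg (j₁ j)).trans ((hr j).2 h0)
    rw [map_sub, map_smul, Algebra.smul_def] at h1
    exact (dvd_sub_left ((hg (j₂ j)).mul_left _)).1 h1

theorem AmbGcd.of_smul {N i : ℕ} {x x' : Amb} (hx : AmbGcd N i x) (hs : x'.1 = x.1)
    (h : ∀ j, ∃ j₂, ∃ r : ℝ, x.2 j = r • x'.2 j₂) : AmbGcd N i x' := by
  refine hx.of_isMult hs fun j => ?_
  obtain ⟨j₂, r, hr⟩ := h j
  refine ⟨0, j₂, r, ?_⟩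
  rw [hr, sub_self]
  constructor <;> intro _ <;> simp

/-- The sequence of index `a` has leading index `d`, the previous ones are supported below `K`. -/
def freeSet (N i d K a : ℕ) : Set Amb :=
  {x | (∀ b, d < b → x.2 a b = 0) ∧ x.2 a d ≠ 0 ∧ (∀ j, j < a → ∀ b, K ≤ b → x.2 j b = 0) ∧
    (∀ j, a < j → x.2 j = 0) ∧ AmbGcd N i x}

/-- Prescribe the coefficients of index `t` of the sequences before `a`. -/
def sliceSet (N i d t a : ℕ) (v : ℕ → ℝ) : Set Amb :=
  freeSet N i d (t + 1) a ∩ {x | ∀ j, j < a → x.2 j t = v j}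

/-- Add multiples of `β` to the sequences before `a`. -/
def shear (a t : ℕ) (v : ℕ → ℝ) (x : Amb) (β : ℕ → ℝ) : Amb :=
  (x.1, fun j => if j < a then x.2 j + (v j - x.2 j t) • β else x.2 j)

theorem continuous_shear (a t : ℕ) (v : ℕ → ℝ) :
    Continuous fun q : Amb × (ℕ → ℝ) => shear a t v q.1 q.2 := by
  unfold shear
  refine (by fun_prop : Continuous fun q : Amb × (ℕ → ℝ) => q.1.1).prodMk ?_
  refine continuous_pi fun j => ?_
  split_ifs <;> fun_prop

theorem shear_zero (a t : ℕ) (v : ℕ → ℝ) (x : Amb) : shear a t v x 0 = x := by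
  simp [shear]

theorem AmbGcd.shear {N i a t : ℕ} {v : ℕ → ℝ} {x : Amb} {β γ : ℕ → ℝ}
    (h : AmbGcd N i (shear a t v x γ)) (hβ : IsMult N x.1 (x.2 a) (β - γ)) :
    AmbGcd N i (shear a t v x β) := by
  refine h.of_isMult rfl fun j => ⟨a, j, 1, ?_⟩
  have ha : (_root_.shear a t v x β).2 a = x.2 a := by simp [_root_.shear]
  rw [ha, one_smul]
  by_cases hj : j < a
  · have : (_root_.shear a t v x γ).2 j - (_root_.shear a t v x β).2 j =
        (-(v j - x.2 j t)) • (β - γ) := by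
      simp only [_root_.shear, hj, if_true]
      module
    rw [this]
    exact hβ.smul _
  · have : (_root_.shear a t v x γ).2 j - (_root_.shear a t v x β).2 j = (0 : ℝ) • (β - γ) := by
      simp [_root_.shear, hj]
    rw [this]
    exact hβ.smul _

theorem shear_mem_freeSet {N i d t a : ℕ} {v : ℕ → ℝ} {x : Amb} {β : ℕ → ℝ}
    (hx : x ∈ freeSet N i d (t + 1) a) (hβ : ∀ b, t < b → β b = 0)
    (h : AmbGcd N i (shear a t v x β)) : shear a t v x β ∈ freeSet N i d (t + 1) a := by
  obtain ⟨h1, h2, h3, h4, -⟩ := hx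
  refine ⟨by simpa [shear] using h1, by simpa [shear] using h2, ?_, ?_, h⟩
  · intro j hj b hb
    simp [shear, hj, h3 j hj b hb, hβ b (by omega)]
  · intro j hj
    have : ¬ j < a := by omega
    simp [shear, this, h4 j hj]

theorem shear_apply_top {a t : ℕ} {v : ℕ → ℝ} {x : Amb} {β : ℕ → ℝ} (hβ : β t = 1) {j : ℕ}
    (hj : j < a) : (shear a t v x β).2 j t = v j := by
  simp [shear, hj, hβ]

theorem shear_eq_self {a t : ℕ} {v : ℕ → ℝ} {x : Amb} (β : ℕ → ℝ) (h : ∀ j, j < a → x.2 j t = v j) :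
    shear a t v x β = x := by
  refine Prod.ext rfl (funext fun j => ?_)
  by_cases hj : j < a
  · simp [shear, hj, h j hj]
  · simp [shear, hj]

theorem freeSet_suppCond {N i d t a : ℕ} (hdt : d ≤ t) {x : Amb}
    (hx : x ∈ freeSet N i d (t + 1) a) : SuppCond a d (t + 1) a x.2 := by
  refine ⟨le_rfl, hx.1, hx.2.1, ?_, hx.2.2.2.1⟩
  intro j b hb
  rcases lt_trichotomy j a with h | h | h
  · exact hx.2.2.1 j h b hb
  · rw [h]; exact hx.1 b (by omega)
  · rw [hx.2.2.2.1 j h]; rfl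

theorem good_sliceSet_iff_of {N i d t a : ℕ} (hdt : d ≤ t) (ht : t < N) (v : ℕ → ℝ)
    {b₀ b₁ : Amb → ℕ → ℝ} (hc₀ : ContinuousOn b₀ (freeSet N i d (t + 1) a))
    (hc₁ : ContinuousOn b₁ (freeSet N i d (t + 1) a ∩ {x | x.1 ≠ 0}))
    (hs₀ : ∀ x ∈ freeSet N i d (t + 1) a, ∀ b, t < b → b₀ x b = 0)
    (hs₁ : ∀ x ∈ freeSet N i d (t + 1) a, x.1 ≠ 0 → ∀ b, t < b → b₁ x b = 0)
    (ht₀ : ∀ x ∈ freeSet N i d (t + 1) a, b₀ x t = 1)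
    (ht₁ : ∀ x ∈ freeSet N i d (t + 1) a, x.1 ≠ 0 → b₁ x t = 1)
    (hm₀ : ∀ x ∈ freeSet N i d (t + 1) a, x.1 = 0 → IsMult N x.1 (x.2 a) (b₀ x))
    (hm₁ : ∀ x ∈ freeSet N i d (t + 1) a, x.1 ≠ 0 → IsMult N x.1 (x.2 a) (b₁ x)) :
    Good (sliceSet N i d t a v) ↔ Good (freeSet N i d (t + 1) a) := by
  classical
  set T := freeSet N i d (t + 1) a with hT
  obtain ⟨O, hO, hOT⟩ := isOpen_ambGcd (N := N) (i := i) (j₀ := a) (d := d) (K := t + 1) (a := a)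
    (by omega) (by omega)
  have hsupp : ∀ x ∈ T, ∀ β : ℕ → ℝ, (∀ b, t < b → β b = 0) →
      SuppCond a d (t + 1) a (shear a t v x β).2 := by
    intro x hx β hβ
    obtain ⟨h1, h2, h3, h4, h5⟩ := freeSet_suppCond hdt hx
    refine ⟨le_rfl, by simpa [shear] using h2, by simpa [shear] using h3, ?_, ?_⟩
    · intro j b hb
      by_cases hj : j < a
      · simp [shear, hj, h4 j b hb, hβ b (by omega)]
      · simp [shear, hj, h4 j b hb]
    · intro j hj
      have : ¬ j < a := by omega
      simp [shear, this, h5 j hj]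
  let m : ↥I × Amb → Amb := fun z => shear a t v z.2 ((z.1 : ℝ) • b₀ z.2)
  have hm : ContinuousOn m (univ ×ˢ T) := by
    refine (continuous_shear a t v).comp_continuousOn (continuousOn_snd.prodMk ?_)
    exact ContinuousOn.fun_smul (by fun_prop) (hc₀.comp continuousOn_snd fun z hz => hz.2)
  have hmult : ∀ x ∈ T, ∀ β : ℕ → ℝ, IsMult N x.1 (x.2 a) β → AmbGcd N i (shear a t v x β) := by
    intro x hx β hβ
    refine AmbGcd.shear (γ := 0) ?_ (by rwa [sub_zero])
    rw [shear_zero]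
    exact hx.2.2.2.2
  have hmO : ∀ x ∈ T, ∀ r : I, m (r, x) ∈ O ↔ AmbGcd N i (m (r, x)) := fun x hx r =>
    hOT _ (hsupp x hx _ fun b hb => by simp [hs₀ x hx b hb])
  let W : Set Amb := {x | ∀ r, m (r, x) ∈ O}
  have hW : ∀ x ∈ T, x ∈ {x : Amb | x.1 = 0} → W ∈ 𝓝[T] x := by
    intro x hx hx0
    refine eventually_forall_mem_of_continuousOn hm hO hx fun r => ?_
    rw [hmO x hx]
    exact hmult x hx _ ((hm₀ x hx hx0).smul _)
  obtain ⟨l, u, hl, hu, hlN, hlu, hu0, hl1⟩ :=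
    exists_cutoff T {x | x.1 = 0} W (isClosed_eq continuous_fst continuous_const) hW
  let full : Amb → ℕ → ℝ := fun x => (l x : ℝ) • b₀ x + (1 - (l x : ℝ)) • b₁ x
  let U : Set Amb := {x | x.1 ≠ 0}
  let B : Amb → ℕ → ℝ := fun x => if x ∈ U then full x else b₀ x
  have hBc : ContinuousOn B T := by
    refine continuousOn_patch ?_ hc₀ fun x hx => ?_
    · have h1 : ContinuousOn (fun x => (l x : ℝ)) (T ∩ U) :=
        continuous_subtype_val.comp_continuousOn (hl.mono inter_subset_left)
      exact (h1.smul (hc₀.mono inter_subset_left)).add ((continuousOn_const.sub h1).smul hc₁)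
    · by_cases hx0 : x.1 = 0
      · right
        filter_upwards [hl1 x hx hx0] with y hy _
        simp [full, hy]
      · left
        exact mem_nhdsWithin_of_mem_nhds ((isOpen_ne_fun continuous_fst
            continuous_const).mem_nhds hx0)
  have hBs : ∀ x ∈ T, ∀ b, t < b → B x b = 0 := by
    intro x hx b hb
    by_cases h : x ∈ U
    · simp [B, h, full, hs₀ x hx b hb, hs₁ x hx h b hb]
    · simp [B, h, hs₀ x hx b hb]
  have hBt : ∀ x ∈ T, B x t = 1 := by
    intro x hx
    by_cases h : x ∈ U
    · simp [B, h, full, ht₀ x hx, ht₁ x hx h]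
    · simp [B, h, ht₀ x hx]
  have hBg : ∀ x ∈ T, ∀ r : I, AmbGcd N i (shear a t v x ((r : ℝ) • B x)) := by
    intro x hx r
    by_cases h : x ∈ U
    · have hB : B x = full x := if_pos h
      rw [hB]
      refine AmbGcd.shear (γ := ((r * l x : I) : ℝ) • b₀ x) ?_ ?_
      · rcases hlN x hx with h' | h'
        · rw [h'.self_of_nhdsWithin hx, mul_zero, Icc.coe_zero, zero_smul, shear_zero]
          exact hx.2.2.2.2
        · exact (hmO x hx _).1 (mem_of_mem_nhdsWithin hx h' _)
      · have : (r : ℝ) • full x - ((r * l x : I) : ℝ) • b₀ x =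
            ((r : ℝ) * (1 - (l x : ℝ))) • b₁ x := by
          simp only [full, Icc.coe_mul]
          module
        rw [this]
        exact (hm₁ x hx h).smul _
    · have hB : B x = b₀ x := if_neg h
      rw [hB]
      exact hmult x hx _ ((hm₀ x hx (by simpa [U] using h)).smul _)
  have hmem : ∀ x ∈ T, ∀ r : I, shear a t v x ((r : ℝ) • B x) ∈ T := fun x hx r =>
    shear_mem_freeSet hx (fun b hb => by simp [hBs x hx b hb]) (hBg x hx r)
  have hρ : ∀ x ∈ T, shear a t v x (B x) ∈ sliceSet N i d t a v := by
    intro x hx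
    refine ⟨?_, fun j hj => shear_apply_top (hBt x hx) hj⟩
    have := hmem x hx 1
    rwa [Icc.coe_one, one_smul] at this
  have hρc : ContinuousOn (fun x => shear a t v x (B x)) T :=
    (continuous_shear a t v).comp_continuousOn (continuousOn_id.prodMk hBc)
  constructor
  · intro hG
    refine Good.of_retract (fun x => shear a t v x (B x)) Prod.fst
      (fun z => shear a t v z.2 ((z.1 : ℝ) • B z.2)) hρc continuousOn_fst hρ
      (fun y hy x _ => hy.1) (fun x _ h => h) (fun y _ x _ h => h) ⟨?_, ?_, ?_⟩ ?_ ?_ hG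
    · refine (continuous_shear a t v).comp_continuousOn (continuousOn_snd.prodMk ?_)
      exact ContinuousOn.fun_smul (by fun_prop) (hBc.comp continuousOn_snd fun z hz => hz.2)
    · exact fun r x hx => hmem x hx r
    · exact fun r x hx h => h
    · intro x _
      simp [shear_zero]
    · intro x _
      simp
  · intro hG
    refine Good.of_strict_retract id (fun q => shear a t v q.1 (B q.1)) continuousOn_id
      (hρc.comp continuousOn_fst fun q hq => hq.1) (fun x hx => hx.1) (fun y hy x _ => hρ y hy)
      (fun x _ h => h) (fun y _ x _ h => h) (fun x hx => shear_eq_self _ hx.2) hG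

theorem good_sliceSet_iff {N i d t a : ℕ} (hdt : d ≤ t) (ht : t + 2 < N) (v : ℕ → ℝ) :
    Good (sliceSet N i d t a v) ↔ Good (freeSet N i d (t + 1) a) := by
  set T := freeSet N i d (t + 1) a with hT
  have hcont : ∀ p, Continuous fun x : Amb => seqShift N x.1 p (x.2 a) := fun p =>
    (continuous_seqShift N p).comp (f := fun x : Amb => ((x.1 : ℝ), x.2 a)) (by fun_prop)
  have hcont0 : ∀ p, Continuous fun x : Amb => seqShift N 0 p (x.2 a) := fun p =>
    (continuous_seqShift N p).comp (f := fun x : Amb => ((0 : ℝ), x.2 a)) (by fun_prop)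
  have hcoef : ∀ e, Continuous fun x : Amb => x.2 a e := fun e => by fun_prop
  obtain ⟨p, rfl⟩ := Nat.exists_eq_add_of_le' hdt
  by_cases hpd : p % 2 = 1 ∧ d % 2 = 1
  · obtain ⟨e, rfl⟩ : ∃ e, d = e + 1 := ⟨d - 1, by omega⟩
    have hpos : ∀ x ∈ T, x.2 a e ^ 2 + x.2 a (e + 1) ^ 2 ≠ 0 := fun x hx => by
      have := hx.2.1
      positivity
    refine good_sliceSet_iff_of (b₀ := fun x => (x.2 a e ^ 2 + x.2 a (e + 1) ^ 2)⁻¹ •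
      (x.2 a e • seqShift N 0 (p + 1) (x.2 a) - x.2 a (e + 1) • seqShift N 0 (p + 2) (x.2 a)))
      (b₁ := fun x => ((x.1 : ℝ) * x.2 a (e + 1))⁻¹ • seqShift N x.1 p (x.2 a)) hdt (by omega) v
      ?_ ?_ ?_ ?_ ?_ ?_ ?_ ?_
    · refine ContinuousOn.fun_smul (ContinuousOn.fun_inv₀ (by fun_prop) hpos)
        (Continuous.continuousOn ?_)
      exact ((hcoef e).smul (hcont0 _)).sub ((hcoef (e + 1)).smul (hcont0 _))
    · refine ContinuousOn.fun_smul (ContinuousOn.fun_inv₀ (by fun_prop) fun x hx => ?_)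
        (hcont p).continuousOn
      exact mul_ne_zero (by exact_mod_cast hx.2) hx.1.2.1
    · intro x hx b hb
      have key : x.2 a e * seqShift N 0 (p + 1) (x.2 a) b =
          x.2 a (e + 1) * seqShift N 0 (p + 2) (x.2 a) b := by
        rcases Nat.lt_or_ge (p + e + 3) b with h | h
        · rw [seqShift_eq_zero 0 hx.1 (by omega), seqShift_eq_zero 0 hx.1 (by omega)]
          ring
        · rcases h.eq_or_lt with rfl | h
          · rw [seqShift_eq_zero 0 hx.1 (by omega), show p + e + 3 = p + 2 + (e + 1) by ring,
              seqShift_top (by omega) (by omega) 0 hx.1, if_pos (by omega)]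
            ring
          · obtain rfl : b = p + e + 2 := by omega
            nth_rw 1 [show p + e + 2 = p + 1 + (e + 1) by ring]
            rw [show p + e + 2 = p + 2 + e by ring,
              seqShift_add (by omega) (by omega) 0 _ (by omega),
              seqShift_add (by omega) (by omega) 0 _ (by omega)]
            ring
      simp [key]
    · intro x hx _ b hb
      simp [seqShift_eq_zero (N := N) (x.1 : ℝ) hx.1 (show p + (e + 1) < b by omega)]
    · intro x hx
      have h1 : seqShift N 0 (p + 1) (x.2 a) (p + (e + 1)) = x.2 a e := by
        rw [show p + (e + 1) = p + 1 + e by ring]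
        exact seqShift_add (by omega) (by omega) 0 _ (by omega)
      have h2 : seqShift N 0 (p + 2) (x.2 a) (p + (e + 1)) = - x.2 a (e + 1) :=
        seqShift_zero_odd (by omega) (by omega) _ (by omega) (by omega) (by omega)
      have := hpos x hx
      simp only [Pi.smul_apply, Pi.sub_apply, h1, h2, smul_eq_mul]
      field_simp
      ring
    · intro x hx h0
      have h1 := seqShift_top (p := p) (N := N) (by omega) (by omega) (x.1 : ℝ) hx.1
      rw [if_pos hpd] at h1
      have h2 : (x.1 : ℝ) ≠ 0 := by exact_mod_cast h0
      have h3 := hx.2.1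
      simp only [Pi.smul_apply, h1, smul_eq_mul]
      field_simp
    · intro x hx h0
      have hh : ∀ q, q ≤ p + 2 → IsMult N x.1 (x.2 a) (seqShift N 0 q (x.2 a)) := by
        intro q hq
        have h1 : (x.1 : ℝ) = 0 := by rw [h0]; rfl
        have := isMult_seqShift (N := N) x.1 q (y := x.2 a) fun b hb => by
          rcases Nat.lt_or_ge (q + (e + 1)) b with h | h
          · exact seqShift_eq_zero _ hx.1 h
          · obtain rfl : b = q + (e + 1) := by omega
            omega
        rwa [h1] at this
      exact (((hh _ (by omega)).smul _).sub ((hh _ le_rfl).smul _)).smul _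
    · intro x hx h0
      exact (isMult_seqShift x.1 p fun b hb => seqShift_eq_zero _ hx.1 (by omega)).smul _
  · have hc : ContinuousOn (fun x : Amb => (x.2 a d)⁻¹ • seqShift N x.1 p (x.2 a)) T :=
      ContinuousOn.fun_smul (ContinuousOn.fun_inv₀ (by fun_prop) fun x hx => hx.2.1)
          (hcont p).continuousOn
    have hs : ∀ x ∈ T, ∀ b, p + d < b → ((x.2 a d)⁻¹ • seqShift N x.1 p (x.2 a)) b = 0 := by
      intro x hx b hb
      simp [seqShift_eq_zero (N := N) (x.1 : ℝ) hx.1 hb]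
    have htop : ∀ x ∈ T, ((x.2 a d)⁻¹ • seqShift N x.1 p (x.2 a)) (p + d) = 1 := by
      intro x hx
      have h1 := seqShift_top (p := p) (N := N) (by omega) (by omega) (x.1 : ℝ) hx.1
      rw [if_neg hpd] at h1
      have h3 := hx.2.1
      simp [h1, h3]
    have hmul : ∀ x ∈ T, IsMult N x.1 (x.2 a) ((x.2 a d)⁻¹ • seqShift N x.1 p (x.2 a)) :=
      fun x hx => (isMult_seqShift x.1 p fun b hb => seqShift_eq_zero _ hx.1 (by omega)).smul _
    exact good_sliceSet_iff_of hdt (by omega) v hc (hc.mono inter_subset_left) hs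
      (fun x hx _ => hs x hx) htop (fun x hx _ => htop x hx) (fun x hx _ => hmul x hx)
      (fun x hx _ => hmul x hx)

/-- Families of sequences with `y 0` monic of index `k`, the next `a` ones supported below `k` and
the other ones zero. -/
def Mon (N i k a : ℕ) : Set Amb :=
  {x | x.2 0 k = 1 ∧ (∀ b, k < b → x.2 0 b = 0) ∧
    (∀ j, 1 ≤ j → j ≤ a → ∀ b, k ≤ b → x.2 j b = 0) ∧ (∀ j, a < j → x.2 j = 0) ∧ AmbGcd N i x}

/-- The support conditions of the strata of `Mon N i k (a + 1)`. -/
def monStratumSupp (k a d : ℕ) : Set Amb :=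
  {x | x.2 0 k = 1 ∧ (∀ b, k < b → x.2 0 b = 0) ∧
    (∀ j, 1 ≤ j → j ≤ a → ∀ b, k ≤ b → x.2 j b = 0) ∧ (∀ b, d ≤ b → x.2 (a + 1) b = 0) ∧
    (∀ j, a + 1 < j → x.2 j = 0)}

/-- The part of `Mon N i k (a + 1)` where the last sequence is supported below `d`. -/
def monStratum (N i k a d : ℕ) : Set Amb :=
  monStratumSupp k a d ∩ {x | AmbGcd N i x}

theorem monStratum_zero (N i k a : ℕ) : monStratum N i k a 0 = Mon N i k a := by
  ext x
  constructor
  · rintro ⟨⟨h1, h2, h3, h4, h5⟩, h6⟩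
    refine ⟨h1, h2, h3, fun j hj => ?_, h6⟩
    rcases Nat.lt_or_ge (a + 1) j with h | h
    · exact h5 j h
    · obtain rfl : j = a + 1 := by omega
      exact funext fun b => h4 b (Nat.zero_le b)
  · rintro ⟨h1, h2, h3, h4, h5⟩
    exact ⟨⟨h1, h2, h3, fun b _ => by rw [h4 _ (Nat.lt_succ_self a)]; rfl,
      fun j hj => h4 j (by omega)⟩, h5⟩

theorem monStratum_self (N i k a : ℕ) : monStratum N i k a k = Mon N i k (a + 1) := by
  ext x
  constructor
  · rintro ⟨⟨h1, h2, h3, h4, h5⟩, h6⟩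
    refine ⟨h1, h2, fun j hj hj' b hb => ?_, h5, h6⟩
    rcases Nat.lt_or_ge a j with h | h
    · obtain rfl : j = a + 1 := by omega
      exact h4 b hb
    · exact h3 j hj h b hb
  · rintro ⟨h1, h2, h3, h4, h5⟩
    exact ⟨⟨h1, h2, fun j hj hj' => h3 j hj (by omega), h3 (a + 1) (by omega) le_rfl, h4⟩, h5⟩

theorem good_freeSet_self {N i d a : ℕ} (h : Good (Mon N i d (a + 1))) :
    Good (freeSet N i d d (a + 1)) := by
  refine Good.of_strict_retract (B := Mon N i d (a + 1))
    (fun x => (x.1, fun j => if j = 0 then (x.2 (a + 1) d)⁻¹ • x.2 (a + 1) else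
      if j = a + 1 then x.2 0 else x.2 j))
    (fun q => (q.1.1, fun j => if j = 0 then q.1.2 (a + 1) else
      if j = a + 1 then q.2.2 (a + 1) d • q.1.2 0 else q.1.2 j)) ?_ ?_ ?_ ?_ ?_ ?_ ?_ h
  · refine ContinuousOn.prodMk (by fun_prop) (continuousOn_pi.2 fun j => ?_)
    split_ifs
    · exact ContinuousOn.fun_smul (ContinuousOn.fun_inv₀ (by fun_prop) fun x hx => hx.2.1)
        (by fun_prop)
    · fun_prop
    · fun_prop
  · refine Continuous.continuousOn ?_
    refine Continuous.prodMk (by fun_prop) (continuous_pi fun j => ?_)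
    split_ifs <;> fun_prop
  · rintro x ⟨h1, h2, h3, h4, h5⟩
    refine ⟨by simp [h2], fun b hb => by simp [h1 b hb], ?_, ?_, ?_⟩
    · intro j hj hj' b hb
      have hj0 : j ≠ 0 := by omega
      by_cases hja : j = a + 1
      · simpa [hj0, hja] using h3 0 (by omega) b hb
      · simpa [hj0, hja] using h3 j (by omega) b hb
    · intro j hj
      have hj0 : j ≠ 0 := by omega
      have hja : j ≠ a + 1 := by omega
      simpa [hj0, hja] using h4 j hj
    · refine h5.of_smul rfl fun j => ?_
      by_cases hj0 : j = 0
      · exact ⟨a + 1, 1, by simp [hj0]⟩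
      by_cases hja : j = a + 1
      · exact ⟨0, x.2 (a + 1) d, by simp [hja, smul_smul, h2]⟩
      · exact ⟨j, 1, by simp [hj0, hja]⟩
  · rintro y ⟨h1, h2, h3, h4, h5⟩ x hx
    have hx2 : x.2 (a + 1) d ≠ 0 := hx.2.1
    refine ⟨fun b hb => by simp [h2 b hb], by simpa [h1] using hx2, ?_, ?_, ?_⟩
    · intro j hj b hb
      by_cases hj0 : j = 0
      · simpa [hj0] using h3 (a + 1) (by omega) le_rfl b hb
      · simpa [hj0, hj.ne] using h3 j (by omega) hj.le b hb
    · intro j hj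
      have hj0 : j ≠ 0 := by omega
      have hja : j ≠ a + 1 := by omega
      simpa [hj0, hja] using h4 j hj
    · refine h5.of_smul rfl fun j => ?_
      by_cases hj0 : j = 0
      · exact ⟨a + 1, (x.2 (a + 1) d)⁻¹, by simp [hj0, smul_smul, hx2]⟩
      by_cases hja : j = a + 1
      · exact ⟨0, 1, by simp [hja]⟩
      · exact ⟨j, 1, by simp [hj0, hja]⟩
  · exact fun x _ hx => hx
  · exact fun y _ x _ hy => hy
  · rintro x ⟨h1, h2, h3, h4, h5⟩
    refine Prod.ext rfl (funext fun j => ?_)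
    by_cases hj0 : j = 0
    · simp [hj0]
    by_cases hja : j = a + 1
    · simp [hja, smul_smul, h2]
    · simp [hj0, hja]

theorem good_freeSet_of_le {N i d a t : ℕ} (h : Good (freeSet N i d d a)) (hdt : d ≤ t)
    (ht : t + 1 < N) : Good (freeSet N i d t a) := by
  induction t, hdt using Nat.le_induction with
  | base => exact h
  | succ t hdt ih =>
    rw [← good_sliceSet_iff hdt ht 0]
    convert ih (by omega) using 1
    ext x
    constructor
    · rintro ⟨⟨h1, h2, h3, h4, h5⟩, h6⟩
      refine ⟨h1, h2, fun j hj b hb => ?_, h4, h5⟩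
      rcases hb.eq_or_lt with rfl | hb
      · exact h6 j hj
      · exact h3 j hj b hb
    · rintro ⟨h1, h2, h3, h4, h5⟩
      exact ⟨⟨h1, h2, fun j hj b hb => h3 j hj b (by omega), h4, h5⟩, fun j hj => h3 j hj t le_rfl⟩

theorem monStratum_inter_ne (N i k a d : ℕ) :
    monStratum N i k a (d + 1) ∩ {x | x.2 (a + 1) d ≠ 0} =
      sliceSet N i d k (a + 1) (Pi.single 0 1) := by
  ext x
  constructor
  · rintro ⟨⟨⟨h1, h2, h3, h4, h5⟩, h6⟩, h7⟩
    refine ⟨⟨h4, h7, fun j hj b hb => ?_, h5, h6⟩, fun j hj => ?_⟩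
    · rcases Nat.eq_zero_or_pos j with rfl | h
      · exact h2 b hb
      · exact h3 j h (by omega) b (by omega)
    · rcases Nat.eq_zero_or_pos j with rfl | h
      · simpa using h1
      · simpa [h.ne'] using h3 j h (by omega) k le_rfl
  · rintro ⟨⟨h1, h2, h3, h4, h5⟩, h6⟩
    refine ⟨⟨⟨by simpa using h6 0 (by omega), h3 0 (by omega), ?_, h1, h4⟩, h5⟩, h2⟩
    intro j hj hj' b hb
    rcases hb.eq_or_lt with rfl | hb
    · have : j ≠ 0 := by omega
      simpa [this] using h6 j (by omega)
    · exact h3 j (by omega) b hb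

theorem good_mon_zero {N i k : ℕ} (hk : k < N) : Good (Mon N i k 0) := by
  have key : ∀ x : Amb, x.2 0 k = 1 → (∀ b, k < b → x.2 0 b = 0) → (∀ j, 0 < j → x.2 j = 0) →
      (AmbGcd N i x ↔ k ≤ 2 * i + 1 ∨ (x.1 = 0 ∧ k / 2 ≤ (2 * i + 1) / 2)) := by
    intro x h1 h2 h3
    have hdvd : ∀ {F : Type} [Field F] [Algebra ℝ F] (z w : F[X]) j,
        phi z w N (x.2 0) ∣ phi z w N (x.2 j) := by
      intro F _ _ z w j
      rcases Nat.eq_zero_or_pos j with rfl | h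
      · exact dvd_rfl
      · rw [h3 j h, map_zero]
        exact dvd_zero _
    have e0 := isModel_complex.deg N (x.2 0) k hk h2 (by simp [h1])
    have e1 : x.1 ≠ 0 → _ := fun h => (isModel_real (NNReal.coe_pos.2
      (pos_iff_ne_zero.2 h))).deg N (x.2 0) k hk h2 (by simp [h1])
    constructor
    · rintro ⟨a0, a1⟩
      by_cases h : x.1 = 0
      · have := a0 h _ (hdvd _ _)
        rw [e0.1] at this
        exact Or.inr ⟨h, this⟩
      · have := a1 h _ (hdvd _ _)
        rw [(e1 h).1] at this
        left
        omega
    · intro h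
      refine ⟨fun h0 g hg => ?_, fun h0 g hg => ?_⟩
      · refine (natDegree_le_of_dvd (hg 0) e0.2).trans ?_
        rw [e0.1]
        rcases h with h | h <;> omega
      · refine (natDegree_le_of_dvd (hg 0) (e1 h0).2).trans ?_
        rw [(e1 h0).1]
        rcases h with h | h
        · omega
        · exact absurd h.1 h0
  have key' : ∀ x ∈ Mon N i k 0, ∀ s : ℝ≥0, ((s, x.2) : Amb) ∈ Mon N i k 0 := by
    rintro x ⟨h1, h2, h3, h4, h5⟩ s
    refine ⟨h1, h2, h3, h4, ?_⟩
    rw [key x h1 h2 h4] at h5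
    refine (key (s, x.2) h1 h2 h4).2 (Or.inl ?_)
    omega
  refine ⟨fun z => (z.2.1 * unitInterval.toNNReal (unitInterval.symm z.1), z.2.2), ⟨?_, ?_, ?_⟩,
      ?_, ?_⟩
  · refine Continuous.continuousOn ?_
    refine Continuous.prodMk (Continuous.mul (by fun_prop) ?_) (by fun_prop)
    exact unitInterval.toNNReal_continuous.comp (by fun_prop)
  · exact fun t x hx => key' x hx _
  · intro t x hx h
    simp [h]
  · intro x hx
    simp
  · intro x hx
    simp

theorem good_mon {N i : ℕ} (a : ℕ) : ∀ k, k + 2 < N → Good (Mon N i k a) := by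
  induction a with
  | zero => exact fun k hk => good_mon_zero (by omega)
  | succ a iha =>
    intro k
    induction k using Nat.strong_induction_on with
    | _ k ihk =>
      intro hk
      have key : ∀ d, d ≤ k → Good (monStratum N i k a d) := by
        intro d
        induction d with
        | zero =>
          intro _
          rw [monStratum_zero]
          exact iha k hk
        | succ d ihd =>
          intro hd
          obtain ⟨O, hO, hOx⟩ := isOpen_ambGcd (N := N) (i := i) (j₀ := 0) (d := k) (K := k + 1)
            (a := a + 1) (by omega) (by omega)
          refine Good.of_strata (a + 1) d (L := monStratumSupp k a (d + 1)) hO ?_ ?_ ?_ ?_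
          · have hsupp : ∀ x ∈ monStratumSupp k a (d + 1), SuppCond 0 k (k + 1) (a + 1) x.2 := by
              rintro x ⟨h1, h2, h3, h4, h5⟩
              refine ⟨Nat.zero_le _, h2, by simp [h1], ?_, h5⟩
              intro j b hb
              rcases Nat.eq_zero_or_pos j with rfl | h
              · exact h2 b hb
              rcases lt_trichotomy j (a + 1) with h' | rfl | h'
              · exact h3 j h (by omega) b (by omega)
              · exact h4 b (by omega)
              · rw [h5 j h']
                rfl
            ext x
            exact and_congr_right fun hx => (hOx x (hsupp x hx)).symm
          · rintro x ⟨h1, h2, h3, h4, h5⟩ r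
            refine ⟨?_, fun b hb => ?_, fun j hj hj' b hb => ?_, fun b hb => ?_, fun j hj => ?_⟩
            · rw [setCoeff_of_ne _ _ _ _ (by omega), h1]
            · rw [setCoeff_of_ne _ _ _ _ (by omega), h2 b hb]
            · rw [setCoeff_of_ne _ _ _ _ (by omega), h3 j hj hj' b hb]
            · rw [setCoeff_of_ne _ _ _ _ (by omega), h4 b hb]
            · funext b
              rw [setCoeff_of_ne _ _ _ _ (by omega), h5 j hj]
          · convert ihd (by omega) using 1
            ext x
            constructor
            · rintro ⟨⟨⟨h1, h2, h3, h4, h5⟩, h6⟩, h7⟩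
              refine ⟨⟨h1, h2, h3, fun b hb => ?_, h5⟩, h6⟩
              rcases hb.eq_or_lt with rfl | hb
              · exact h7
              · exact h4 b hb
            · rintro ⟨⟨h1, h2, h3, h4, h5⟩, h6⟩
              exact ⟨⟨⟨h1, h2, h3, fun b hb => h4 b (by omega), h5⟩, h6⟩, h4 d le_rfl⟩
          · rw [monStratum_inter_ne, good_sliceSet_iff (by omega) hk]
            exact good_freeSet_of_le (good_freeSet_self (ihk d hd (by omega))) (by omega) (by omega)
      rw [← monStratum_self]
      exact key k le_rfl

/-- Maps and explicit homotopies between subsets give a homotopy equivalence. -/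
theorem nonempty_homotopyEquiv_of {X Y : Type*} [TopologicalSpace X] [TopologicalSpace Y]
    {A : Set X} {B : Set Y} {f : X → Y} {g : Y → X} {F : ↥I × X → X} {G : ↥I × Y → Y}
    (hf : ContinuousOn f A) (hg : ContinuousOn g B) (hfA : MapsTo f A B) (hgB : MapsTo g B A)
    (hF : ContinuousOn F (univ ×ˢ A)) (hG : ContinuousOn G (univ ×ˢ B))
    (hFA : ∀ t, ∀ x ∈ A, F (t, x) ∈ A) (hGB : ∀ t, ∀ y ∈ B, G (t, y) ∈ B)
    (hF0 : ∀ x ∈ A, F (0, x) = x) (hF1 : ∀ x ∈ A, F (1, x) = g (f x))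
    (hG0 : ∀ y ∈ B, G (0, y) = y) (hG1 : ∀ y ∈ B, G (1, y) = f (g y)) :
    Nonempty (ContinuousMap.HomotopyEquiv A B) := by
  refine ⟨⟨⟨hfA.restrict f A B, hf.mapsToRestrict hfA⟩, ⟨hgB.restrict g B A, hg.mapsToRestrict hgB⟩,
    ContinuousMap.Homotopic.symm ⟨⟨⟨fun z => ⟨F (z.1, z.2), hFA z.1 z.2 z.2.2⟩, ?_⟩, ?_, ?_⟩⟩,
    ContinuousMap.Homotopic.symm ⟨⟨⟨fun z => ⟨G (z.1, z.2), hGB z.1 z.2 z.2.2⟩, ?_⟩, ?_, ?_⟩⟩⟩⟩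
  · exact (hF.comp_continuous (f := fun z : ↥I × A => (z.1, (z.2 : X))) (by fun_prop)
      fun z => ⟨trivial, z.2.2⟩).subtype_mk _
  · exact fun x => Subtype.ext (hF0 x x.2)
  · exact fun x => Subtype.ext (hF1 x x.2)
  · exact (hG.comp_continuous (f := fun z : ↥I × B => (z.1, (z.2 : Y))) (by fun_prop)
      fun z => ⟨trivial, z.2.2⟩).subtype_mk _
  · exact fun x => Subtype.ext (hG0 x x.2)
  · exact fun x => Subtype.ext (hG1 x x.2)

theorem Good.nonempty_homotopyEquiv {E : Set Amb} (hE : Good E) :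
    Nonempty (ContinuousMap.HomotopyEquiv (E ∩ {x | x.1 = 0} : Set Amb) E) := by
  obtain ⟨H, hH, H0, H1⟩ := hE
  refine nonempty_homotopyEquiv_of (f := id) (g := fun x => H (1, x)) (F := H) (G := H)
    continuousOn_id (hH.cont.comp (by fun_prop) fun x hx => ⟨trivial, hx⟩) (fun x hx => hx.1)
    (fun x hx => ⟨hH.maps _ x hx, H1 x hx⟩) (hH.cont.mono (prod_mono_right inter_subset_left))
    hH.cont (fun t x hx => ⟨hH.maps t x hx.1, hH.zero t x hx.1 hx.2⟩) hH.maps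
    (fun x hx => H0 x hx.1) (fun x _ => rfl) H0 (fun x _ => rfl)

theorem exists_continuous_shift {E O : Set Amb} (hO : IsOpen O) (hEO : E ⊆ O) :
    ∃ e : Amb → ℝ≥0, ContinuousOn e E ∧ (∀ x ∈ E, e x ≠ 0) ∧
      ∀ x ∈ E, ∀ s, s ≤ e x → (x.1 + s, x.2) ∈ O := by
  let := TopologicalSpace.pseudoMetrizableSpacePseudoMetric E
  have hconv : ∀ x : E, Convex ℝ {r : ℝ | 0 < r ∧ ∀ s : ℝ≥0, (s : ℝ) ≤ r →
      ((x : Amb).1 + s, (x : Amb).2) ∈ O} := by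
    intro x
    refine Set.OrdConnected.convex ⟨fun r hr r' hr' q hq => ?_⟩
    exact ⟨hr.1.trans_le hq.1, fun s hs => hr'.2 s (hs.trans hq.2)⟩
  obtain ⟨g, hg⟩ := exists_continuous_forall_mem_convex_of_local_const hconv fun x => by
    have h1 : Continuous fun q : E × ℝ≥0 => (((q.1 : Amb).1 + q.2, (q.1 : Amb).2) : Amb) := by
      fun_prop
    have h2 : ∀ᶠ q in 𝓝 x ×ˢ 𝓝 (0 : ℝ≥0), (((q.1 : Amb).1 + q.2, (q.1 : Amb).2) : Amb) ∈ O := by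
      rw [← nhds_prod_eq]
      exact h1.continuousAt.eventually (hO.mem_nhds (by simpa using hEO x.2))
    obtain ⟨p, hp, q, hq, hpq⟩ := eventually_prod_iff.1 h2
    obtain ⟨ε, hε, hεq⟩ := Metric.eventually_nhds_iff.1 hq
    refine ⟨ε / 2, ?_⟩
    filter_upwards [hp] with y hy
    refine ⟨by positivity, fun s hs => hpq hy (hεq ?_)⟩
    rw [NNReal.dist_eq, NNReal.coe_zero, sub_zero, NNReal.abs_eq]
    linarith
  classical
  refine ⟨fun x => if h : x ∈ E then (g ⟨x, h⟩).toNNReal else 0, ?_, ?_, ?_⟩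
  · rw [continuousOn_iff_continuous_domRestrict]
    have : E.domRestrict (fun x => if h : x ∈ E then (g ⟨x, h⟩).toNNReal else 0) =
        fun x => (g x).toNNReal := by
      funext x
      exact dif_pos x.2
    rw [this]
    exact continuous_real_toNNReal.comp g.continuous
  · intro x hx
    simpa [hx] using (hg ⟨x, hx⟩).1
  · intro x hx s hs
    refine (hg ⟨x, hx⟩).2 s ?_
    simp only [dif_pos hx] at hs
    rwa [Real.le_toNNReal_iff_coe_le (hg ⟨x, hx⟩).1.le] at hs

theorem nonempty_homotopyEquiv_pos {E O : Set Amb} (hO : IsOpen O) (hEO : E ⊆ O)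
    (hOE : ∀ x ∈ E, ∀ s, (s, x.2) ∈ O → (s, x.2) ∈ E) :
    Nonempty (ContinuousMap.HomotopyEquiv (E ∩ {x | x.1 ≠ 0} : Set Amb) E) := by
  obtain ⟨e, he, he0, heO⟩ := exists_continuous_shift hO hEO
  let F : ↥I × Amb → Amb := fun z => (z.2.1 + unitInterval.toNNReal z.1 * e z.2, z.2.2)
  have hF : ContinuousOn F (univ ×ˢ E) := by
    have h1 : ContinuousOn (fun z : ↥I × Amb => e z.2) (univ ×ˢ E) :=
      he.comp continuousOn_snd fun z hz => hz.2
    refine ContinuousOn.prodMk (ContinuousOn.add (by fun_prop) (ContinuousOn.mul ?_ h1))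
      (by fun_prop)
    exact (unitInterval.toNNReal_continuous.comp continuous_fst).continuousOn
  have hFE : ∀ t, ∀ x ∈ E, F (t, x) ∈ E := fun t x hx =>
    hOE x hx _ (heO x hx _ (mul_le_of_le_one_left zero_le t.2.2))
  have hF0 : ∀ x, F (0, x) = x := fun x => by simp [F]
  refine nonempty_homotopyEquiv_of (f := id) (g := fun x => F (1, x)) (F := F) (G := F)
    continuousOn_id (hF.comp (by fun_prop) fun x hx => ⟨trivial, hx⟩) (fun x hx => hx.1)
    (fun x hx => ⟨hFE 1 x hx, ?_⟩) (hF.mono (prod_mono_right inter_subset_left)) hF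
    (fun t x hx => ⟨hFE t x hx.1, ?_⟩) hFE (fun x _ => hF0 x) (fun x _ => rfl) (fun x _ => hF0 x)
    (fun x _ => rfl)
  · simp [F, he0 x hx]
  · have : x.1 ≠ 0 := hx.2
    simp [F, this]

/-- Families of `n + 1` sequences that are monic of index `k`. -/
def MonFam (N i k n : ℕ) : Set Amb :=
  {x | (∀ j, j ≤ n → x.2 j k = 1 ∧ ∀ b, k < b → x.2 j b = 0) ∧ (∀ j, n < j → x.2 j = 0) ∧
    AmbGcd N i x}

theorem isMult_self {N : ℕ} {s : ℝ≥0} {y : ℕ → ℝ} : IsMult N s y y :=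
  ⟨fun _ => dvd_rfl, fun _ => dvd_rfl⟩

theorem isMult_zero {N : ℕ} {s : ℝ≥0} {y : ℕ → ℝ} : IsMult N s y 0 := by
  constructor <;> intro _ <;> simp

theorem good_monFam {N i k n : ℕ} (hk : k + 2 < N) : Good (MonFam N i k n) := by
  refine Good.of_strict_retract (B := Mon N i k n)
    (fun x => (x.1, fun j => if j = 0 then x.2 0 else if j ≤ n then x.2 j - x.2 0 else 0))
    (fun q => (q.1.1, fun j => if j = 0 then q.1.2 0 else if j ≤ n then q.1.2 j + q.1.2 0 else 0))
    ?_ ?_ ?_ ?_ ?_ ?_ ?_ (good_mon n k hk)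
  · refine Continuous.continuousOn (Continuous.prodMk (by fun_prop) (continuous_pi fun j => ?_))
    split_ifs <;> fun_prop
  · refine Continuous.continuousOn (Continuous.prodMk (by fun_prop) (continuous_pi fun j => ?_))
    split_ifs <;> fun_prop
  · rintro x ⟨h1, h2, h3⟩
    refine ⟨by simpa using (h1 0 (Nat.zero_le n)).1, by simpa using (h1 0 (Nat.zero_le n)).2,
      ?_, ?_, ?_⟩
    · intro j hj hj' b hb
      have hj0 : j ≠ 0 := by omega
      rcases hb.eq_or_lt with rfl | hb
      · simp [hj0, hj', (h1 j hj').1, (h1 0 (Nat.zero_le n)).1]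
      · simp [hj0, hj', (h1 j hj').2 b hb, (h1 0 (Nat.zero_le n)).2 b hb]
    · intro j hj
      have hj0 : j ≠ 0 := by omega
      simp [hj0, hj]
    · refine h3.of_isMult rfl fun j => ?_
      rcases Nat.lt_or_ge n j with hj | hj
      · exact ⟨0, 0, 0, by simpa [h2 j hj] using isMult_zero⟩
      by_cases hj0 : j = 0
      · exact ⟨0, 0, 0, by simpa [hj0] using isMult_self⟩
      · exact ⟨0, j, 1, by simpa [hj0, hj] using isMult_self⟩
  · rintro y ⟨h1, h2, h3, h4, h5⟩ x -
    refine ⟨fun j hj => ?_, fun j hj => ?_, ?_⟩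
    · by_cases hj0 : j = 0
      · simpa [hj0, h1] using h2
      · have h0 := h3 j (by omega) hj
        refine ⟨by simp [hj0, hj, h1, h0 k le_rfl], fun b hb => ?_⟩
        simp [hj0, hj, h2 b hb, h0 b hb.le]
    · have hj0 : j ≠ 0 := by omega
      simp [hj0, hj]
    · refine h5.of_isMult rfl fun j => ?_
      rcases Nat.lt_or_ge n j with hj | hj
      · exact ⟨0, 0, 0, by simpa [h4 j hj] using isMult_zero⟩
      by_cases hj0 : j = 0
      · exact ⟨0, 0, 0, by simpa [hj0] using isMult_self⟩
      · refine ⟨0, j, 1, ?_⟩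
        have : y.2 j - (1 : ℝ) • (y.2 j + y.2 0) = (-1 : ℝ) • y.2 0 := by module
        simpa only [hj0, hj, if_true, if_false, this] using isMult_self.smul (-1)
  · exact fun x _ hx => hx
  · exact fun y _ x _ hy => hy
  · rintro x ⟨h1, h2, h3⟩
    refine Prod.ext rfl (funext fun j => ?_)
    by_cases hj0 : j = 0
    · simp [hj0]
    by_cases hj : j ≤ n
    · simp [hj0, hj]
    · simp [hj0, hj, h2 j (by omega)]

theorem nonempty_homotopyEquiv_fibers {N i k n : ℕ} (hk : k + 2 < N) :
    Nonempty (ContinuousMap.HomotopyEquiv (MonFam N i k n ∩ {x | x.1 ≠ 0} : Set Amb)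
      (MonFam N i k n ∩ {x | x.1 = 0} : Set Amb)) := by
  obtain ⟨O, hO, hOx⟩ := isOpen_ambGcd (N := N) (i := i) (j₀ := 0) (d := k) (K := k + 1)
    (a := n) (by omega) (by omega)
  have hsupp : ∀ x ∈ MonFam N i k n, SuppCond 0 k (k + 1) n x.2 := by
    rintro x ⟨h1, h2, -⟩
    have h0 := h1 0 (Nat.zero_le n)
    refine ⟨Nat.zero_le n, h0.2, by simp [h0.1], fun j b hb => ?_, h2⟩
    rcases Nat.lt_or_ge n j with hj | hj
    · rw [h2 j hj]
      rfl
    · exact (h1 j hj).2 b hb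
  obtain ⟨e₁⟩ := nonempty_homotopyEquiv_pos (E := MonFam N i k n) hO
    (fun x hx => (hOx x (hsupp x hx)).2 hx.2.2)
    fun x hx s h => ⟨hx.1, hx.2.1, (hOx (s, x.2) (hsupp x hx)).1 h⟩
  obtain ⟨e₂⟩ := (good_monFam (i := i) (n := n) hk).nonempty_homotopyEquiv
  exact ⟨e₁.trans e₂.symm⟩

/-- Change the parameter to `s`, rescaling the coefficients so that the represented polynomials
are only multiplied by a constant. -/
noncomputable def rescale (k : ℕ) (s : ℝ≥0) (x : Amb) : Amb :=
  (s, fun j a => ((x.1 / s : ℝ≥0) : ℝ) ^ (k / 2 - a / 2) * x.2 j a)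

theorem phi_rescale {s s' : ℝ} (hs : s ≠ 0) (hs' : s' ≠ 0) {N k : ℕ} {y : ℕ → ℝ}
    (hy : ∀ b, k < b → y b = 0) :
    phi X (realW s') N (fun a => (s / s') ^ (k / 2 - a / 2) * y a) =
      (s / s') ^ (k / 2) • phi X (realW s) N y := by
  rw [phi_apply, phi_apply, Finset.smul_sum]
  refine Finset.sum_congr rfl fun a _ => ?_
  rcases Nat.lt_or_ge k a with h | h
  · simp [hy a h]
  · unfold basisElt realW
    have e : k / 2 = (k / 2 - a / 2) + a / 2 := by omega
    have key : (s / s') ^ (k / 2 - a / 2) * y a * (s'⁻¹) ^ (a / 2) =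
        (s / s') ^ (k / 2) * (y a * (s⁻¹) ^ (a / 2)) := by
      nth_rw 2 [e]
      rw [pow_add, div_pow s s' (a / 2), inv_pow, inv_pow]
      field_simp
    rw [_root_.smul_pow, _root_.smul_pow, mul_smul_comm, mul_smul_comm, smul_smul, smul_smul,
        smul_smul,
      key, mul_assoc]

theorem rescale_mem {N i k n : ℕ} {x : Amb} (hx : x ∈ MonFam N i k n) (h0 : x.1 ≠ 0) {s : ℝ≥0}
    (hs : s ≠ 0) : rescale k s x ∈ MonFam N i k n := by
  obtain ⟨h1, h2, h3⟩ := hx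
  refine ⟨fun j hj => ⟨?_, fun b hb => ?_⟩, fun j hj => ?_, fun h => absurd h hs, fun _ g hg => ?_⟩
  · simp [rescale, (h1 j hj).1]
  · simp [rescale, (h1 j hj).2 b hb]
  · funext a
    simp [rescale, h2 j hj]
  · refine h3.2 h0 g fun j => ?_
    have hx0 : (x.1 : ℝ) ≠ 0 := by exact_mod_cast h0
    have hs0 : (s : ℝ) ≠ 0 := by exact_mod_cast hs
    have hy : ∀ b, k < b → x.2 j b = 0 := by
      intro b hb
      rcases Nat.lt_or_ge n j with hj | hj
      · rw [h2 j hj]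
        rfl
      · exact (h1 j hj).2 b hb
    have h := hg j
    have e := phi_rescale hx0 hs0 (N := N) hy
    simp only [rescale, NNReal.coe_div] at h
    rw [e, smul_eq_C_mul] at h
    exact (dvd_C_mul (pow_ne_zero _ (div_ne_zero hx0 hs0))).1 h

theorem rescale_self (k : ℕ) {x : Amb} (h : x.1 ≠ 0) : rescale k x.1 x = x := by
  unfold rescale
  rw [div_self h]
  simp

theorem nonempty_homotopyEquiv_one (N i k n : ℕ) :
    Nonempty (ContinuousMap.HomotopyEquiv (MonFam N i k n ∩ {x | x.1 ≠ 0} : Set Amb)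
      (MonFam N i k n ∩ {x | x.1 = 1} : Set Amb)) := by
  let S : ↥I × Amb → ℝ≥0 := fun z =>
    unitInterval.toNNReal (unitInterval.symm z.1) * z.2.1 + unitInterval.toNNReal z.1
  have hSc : Continuous S := by
    refine Continuous.add (Continuous.mul ?_ (by fun_prop)) ?_
    · exact unitInterval.toNNReal_continuous.comp (by fun_prop)
    · exact unitInterval.toNNReal_continuous.comp (by fun_prop)
  have hS : ∀ t, ∀ x : Amb, x.1 ≠ 0 → S (t, x) ≠ 0 := by
    intro t x hx h
    obtain ⟨h1, h2⟩ := add_eq_zero.1 h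
    have h3 := unitInterval.toNNReal_add_toNNReal_symm t
    rw [h2, (mul_eq_zero.1 h1).resolve_right hx] at h3
    simp at h3
  have hc : ContinuousOn (fun z : ↥I × Amb => rescale k (S z) z.2)
      (univ ×ˢ (MonFam N i k n ∩ {x | x.1 ≠ 0})) := by
    refine ContinuousOn.prodMk hSc.continuousOn (continuousOn_pi.2 fun j => continuousOn_pi.2
      fun a => ?_)
    refine ContinuousOn.mul (ContinuousOn.pow ?_ _) (by fun_prop)
    refine NNReal.continuous_coe.comp_continuousOn ?_
    exact ContinuousOn.div₀ (by fun_prop) hSc.continuousOn fun z hz => hS z.1 z.2 hz.2.2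
  have h1 : ∀ x, S (1, x) = 1 := fun x => by simp [S]
  have h0 : ∀ x, S (0, x) = x.1 := fun x => by simp [S]
  refine nonempty_homotopyEquiv_of (f := fun x => rescale k (S (1, x)) x) (g := id)
    (F := fun z => rescale k (S z) z.2) (G := Prod.snd)
    (hc.comp (f := fun x : Amb => ((1 : I), x)) (by fun_prop) fun x hx => ⟨trivial, hx⟩)
    continuousOn_id (fun x hx => ⟨rescale_mem hx.1 hx.2 (hS 1 x hx.2), h1 x⟩) ?_ hc
    continuousOn_snd (fun t x hx => ⟨rescale_mem hx.1 hx.2 (hS t x hx.2), hS t x hx.2⟩)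
    (fun _ _ h => h) ?_ (fun x _ => rfl) (fun _ _ => rfl) ?_
  · rintro x ⟨hx, h⟩
    refine ⟨hx, ?_⟩
    change x.1 = 1 at h
    change x.1 ≠ 0
    rw [h]
    exact one_ne_zero
  · intro x hx
    simp only [h0]
    exact rescale_self k hx.2
  · intro y hy
    have h : y.1 = 1 := hy.2
    simp only [h1, id]
    rw [← h, rescale_self k (by rw [h]; exact one_ne_zero)]

section MonicPolynomials

variable {F : Type*} [Field F]

theorem coeff_monic_sum {k : ℕ} (c : Fin k → F) (b : ℕ) :
    (X ^ k + ∑ i : Fin k, C (c i) * X ^ (i : ℕ)).coeff b =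
      if h : b < k then c ⟨b, h⟩ else if b = k then 1 else 0 := by
  rw [coeff_add, coeff_X_pow, finsetSum_coeff]
  simp only [coeff_C_mul, coeff_X_pow]
  by_cases h : b < k
  · rw [Finset.sum_eq_single ⟨b, h⟩, if_neg h.ne, dif_pos h]
    · simp
    · intro i _ hi
      have : b ≠ i := fun h => hi (Fin.ext h.symm)
      simp [this]
    · simp
  · rw [Finset.sum_eq_zero, add_zero, dif_neg h]
    intro i _
    have : b ≠ i := by omega
    simp [this]

theorem eq_monic_sum {k : ℕ} {f : F[X]} (h1 : f.coeff k = 1) (h2 : ∀ b, k < b → f.coeff b = 0) :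
    f = X ^ k + ∑ i : Fin k, C (f.coeff i) * X ^ (i : ℕ) := by
  ext b
  rw [coeff_monic_sum (fun i : Fin k => f.coeff i)]
  split_ifs with h h'
  · rfl
  · rw [h', h1]
  · exact h2 b (by omega)

theorem natDegree_gcd_le_iff {ι : Type*} [Fintype ι] {p : ι → F[X]} {j : ι} (hj : p j ≠ 0)
    [NormalizedGCDMonoid F[X]] {l : ℕ} :
    (Finset.univ.gcd p).natDegree ≤ l ↔ ∀ g, (∀ j, g ∣ p j) → g.natDegree ≤ l := by
  have h0 : Finset.univ.gcd p ≠ 0 := fun h => hj (Finset.gcd_eq_zero_iff.1 h j (Finset.mem_univ j))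
  constructor
  · exact fun h g hg => (natDegree_le_of_dvd (Finset.dvd_gcd fun j _ => hg j) h0).trans h
  · exact fun h => h _ fun j => Finset.gcd_dvd (Finset.mem_univ j)

end MonicPolynomials

theorem toPolyR_ne_zero (k : ℕ) (c : Fin k → ℝ) : toPolyR k c ≠ 0 := by
  intro h
  have := coeff_monic_sum c k
  rw [show X ^ k + ∑ i : Fin k, C (c i) * X ^ (i : ℕ) = toPolyR k c from rfl, h] at this
  simp at this

theorem toPolyC_ne_zero (k : ℕ) (c : Fin k → ℂ) : toPolyC k c ≠ 0 := by
  intro h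
  have := coeff_monic_sum c k
  rw [show X ^ k + ∑ i : Fin k, C (c i) * X ^ (i : ℕ) = toPolyC k c from rfl, h] at this
  simp at this

theorem toPolyR_coeff {k b : ℕ} (c : Fin k → ℝ) :
    (toPolyR k c).coeff b = if h : b < k then c ⟨b, h⟩ else if b = k then 1 else 0 :=
  coeff_monic_sum c b

theorem toPolyC_coeff {k b : ℕ} (c : Fin k → ℂ) :
    (toPolyC k c).coeff b = if h : b < k then c ⟨b, h⟩ else if b = k then 1 else 0 :=
  coeff_monic_sum c b

theorem mem_RXset_iff {k n l : ℕ} {f : Fin (n + 1) → Fin k → ℝ} :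
    f ∈ RXset k n l ↔ ∀ g, (∀ j, g ∣ toPolyR k (f j)) → g.natDegree ≤ l :=
  natDegree_gcd_le_iff (j := 0) (toPolyR_ne_zero k (f 0))

theorem mem_Xset_iff {k n l : ℕ} {f : Fin (n + 1) → Fin k → ℂ} :
    f ∈ Xset k n l ↔ ∀ g, (∀ j, g ∣ toPolyC k (f j)) → g.natDegree ≤ l :=
  natDegree_gcd_le_iff (j := 0) (toPolyC_ne_zero k (f 0))

/-- A bound on common divisors of a family that vanishes after index `n`. -/
theorem forall_dvd_iff_fin {F : Type*} [Field F] {n : ℕ} {p : ℕ → F[X]} (h : ∀ j, n < j → p j = 0)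
    (g : F[X]) : (∀ j, g ∣ p j) ↔ ∀ j : Fin (n + 1), g ∣ p j := by
  refine ⟨fun hg j => hg j, fun hg j => ?_⟩
  rcases Nat.lt_or_ge n j with hj | hj
  · rw [h j hj]
    exact dvd_zero g
  · exact hg ⟨j, by omega⟩

theorem coeff_phi_real_top {N k : ℕ} {y : ℕ → ℝ} (hk : k < N) (hy : ∀ b, k < b → y b = 0) :
    (phi X (realW 1) N y).coeff k = y k := by
  have M := isModel_real one_pos
  have hW : (realW 1).Monic := by
    unfold realW
    rw [inv_one, one_smul]
    exact monic_X_pow_add_C 1 two_ne_zero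
  have hb : (basisElt X (realW 1) k).Monic := (monic_X_pow _).mul (hW.pow _)
  have hbk : (basisElt X (realW 1) k).coeff k = 1 := by
    have := hb.coeff_natDegree
    rwa [(basisElt_real_natDegree one_pos k).1] at this
  have e : phi X (realW 1) N y =
      y k • basisElt X (realW 1) k + phi X (realW 1) N (y - Pi.single k (y k)) := by
    rw [map_sub, phi_single _ _ hk]
    abel
  rw [e, coeff_add, coeff_smul, hbk]
  have h0 : (phi X (realW 1) N (y - Pi.single k (y k))).coeff k = 0 := by
    rcases Nat.eq_zero_or_pos k with rfl | hk0
    · have : y - Pi.single 0 (y 0) = 0 := by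
        funext b
        rcases Nat.eq_zero_or_pos b with rfl | h
        · simp
        · simp [hy b h, h.ne']
      rw [this, map_zero, coeff_zero]
    · refine coeff_eq_zero_of_natDegree_lt (lt_of_le_of_lt (M.natDegree_le (d := k - 1) ?_) ?_)
      · intro b hb
        by_cases hbk : b = k
        · simp [hbk]
        · simp [hbk, hy b (by omega)]
      · omega
  rw [h0, smul_eq_mul, mul_one, add_zero]

theorem continuous_coeff_phi {F : Type*} [Field F] [Algebra ℝ F] [TopologicalSpace F]
    [ContinuousAdd F] [ContinuousSMul ℝ F] (z w : F[X]) (N b : ℕ) :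
    Continuous fun y : ℕ → ℝ => (phi z w N y).coeff b := by
  simp only [phi_apply, finsetSum_coeff, coeff_smul]
  fun_prop

theorem exists_coordinates (k N : ℕ) (hk : k < N) : ∃ B : (Fin k → ℝ) → ℕ → ℝ, Continuous B ∧
    ∀ c, B c k = 1 ∧ (∀ b, k < b → B c b = 0) ∧ phi X (realW 1) N (B c) = toPolyR k c := by
  have M := isModel_real one_pos
  have h : ∀ i : ℕ, ∃ y : ℕ → ℝ, (∀ b, i < b → y b = 0) ∧
      (i < N → phi X (realW 1) N y = X ^ i) := by
    intro i
    obtain ⟨y, hy, hy'⟩ := M.surj (X ^ i) (i + 1) (by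
      rw [degree_X_pow]
      exact_mod_cast Nat.lt_succ_self i)
    rw [one_mul] at hy hy'
    exact ⟨y, fun b hb => hy b hb, fun hi => by rw [phi_of_le _ _ hi hy, hy']⟩
  choose y hy hy' using h
  have hsupp : ∀ c : Fin k → ℝ, ∀ b, k < b → (y k + ∑ i : Fin k, c i • y i) b = 0 := by
    intro c b hb
    simp only [Pi.add_apply, Finset.sum_apply, Pi.smul_apply]
    rw [hy k b hb, Finset.sum_eq_zero, add_zero]
    intro i _
    rw [hy i b (by omega), smul_zero]
  have hphi : ∀ c : Fin k → ℝ, phi X (realW 1) N (y k + ∑ i : Fin k, c i • y i) = toPolyR k c := by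
    intro c
    rw [map_add, map_sum, hy' k hk, toPolyR]
    congr 1
    refine Finset.sum_congr rfl fun i _ => ?_
    rw [map_smul, hy' i (by omega), smul_eq_C_mul]
  refine ⟨fun c => y k + ∑ i : Fin k, c i • y i, by fun_prop, fun c => ⟨?_, hsupp c, hphi c⟩⟩
  refine (coeff_phi_real_top hk (hsupp c)).symm.trans ?_
  rw [hphi, toPolyR_coeff]
  simp

theorem nonempty_homotopyEquiv_RXset {N i k n : ℕ} (hk : k < N) :
    Nonempty (ContinuousMap.HomotopyEquiv (MonFam N i k n ∩ {x | x.1 = 1} : Set Amb)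
      (RXset k n (2 * i + 1))) := by
  obtain ⟨B, hBc, hB⟩ := exists_coordinates k N hk
  have M := isModel_real one_pos
  let f : Amb → Fin (n + 1) → Fin k → ℝ := fun x j b => (phi X (realW 1) N (x.2 j)).coeff b
  let g : (Fin (n + 1) → Fin k → ℝ) → Amb := fun c =>
    (1, fun j => if h : j < n + 1 then B (c ⟨j, h⟩) else 0)
  have hgj : ∀ c, ∀ j : Fin (n + 1), (g c).2 j = B (c j) := fun c j => dif_pos j.2
  have hg0 : ∀ c j, n < j → (g c).2 j = 0 := fun c j hj => dif_neg (by omega)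
  have hfc : Continuous f := continuous_pi fun j => continuous_pi fun b =>
    (continuous_coeff_phi X (realW 1) N b).comp (f := fun x : Amb => x.2 j) (by fun_prop)
  have hgc : Continuous g := by
    refine continuous_const.prodMk (continuous_pi fun j => ?_)
    split_ifs
    · exact hBc.comp (by fun_prop)
    · exact continuous_const
  have hphi : ∀ x ∈ MonFam N i k n, ∀ j : Fin (n + 1),
      phi X (realW 1) N (x.2 j) = toPolyR k (f x j) := by
    intro x hx j
    have h := hx.1 j (by omega)
    refine eq_monic_sum (by rw [coeff_phi_real_top hk h.2, h.1]) fun b hb => ?_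
    refine coeff_eq_zero_of_natDegree_lt ((M.natDegree_le h.2).trans_lt ?_)
    omega
  have hfg : ∀ c, f (g c) = c := by
    intro c
    funext j b
    simp only [f, hgj, (hB _).2.2, toPolyR_coeff, b.2, dif_pos]
  have hgf : ∀ x ∈ MonFam N i k n ∩ {x | x.1 = 1}, g (f x) = x := by
    intro x hx
    refine Prod.ext hx.2.symm (funext fun j => ?_)
    rcases Nat.lt_or_ge n j with hj | hj
    · rw [hg0 _ j hj, hx.1.2.1 j hj]
    · have h1 := hgj (f x) ⟨j, by omega⟩
      have h2 := hphi x hx.1 ⟨j, by omega⟩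
      have h3 := hB (f x ⟨j, by omega⟩)
      have h4 := hx.1.1 j hj
      simp only at h1 h2
      rw [h1, ← sub_eq_zero]
      refine M.eq_zero (N := N) (fun b hb => ?_) ?_
      · rw [Pi.sub_apply, h3.2.1 b (by omega), h4.2 b (by omega), sub_zero]
      · rw [map_sub, h3.2.2, h2, sub_self]
  refine nonempty_homotopyEquiv_of (f := f) (g := g) (F := Prod.snd) (G := Prod.snd)
    hfc.continuousOn hgc.continuousOn ?_ ?_ continuousOn_snd continuousOn_snd (fun _ _ h => h)
    (fun _ _ h => h) (fun _ _ => rfl) (fun x hx => (hgf x hx).symm) (fun _ _ => rfl)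
    (fun c _ => (hfg c).symm)
  · rintro x ⟨hx, hx1⟩
    rw [mem_RXset_iff]
    intro q hq
    have hx1' : x.1 = 1 := hx1
    have := hx.2.2.2 (by rw [hx1']; exact one_ne_zero)
    rw [hx1', NNReal.coe_one] at this
    refine (this q ((forall_dvd_iff_fin (n := n) (fun j hj => ?_) q).2 fun j => ?_)).trans
      (Nat.div_one _).le
    · rw [hx.2.1 j hj, map_zero]
    · rw [hphi x hx]
      exact hq j
  · intro c hc
    rw [mem_RXset_iff] at hc
    refine ⟨⟨fun j hj => ?_, hg0 c, fun h => absurd h one_ne_zero, fun _ q hq => ?_⟩, rfl⟩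
    · have := hgj c ⟨j, by omega⟩
      simp only at this
      rw [this]
      exact ⟨(hB _).1, (hB _).2.1⟩
    · rw [Nat.div_one]
      refine hc q fun j => ?_
      have := hq j
      rw [hgj, show (((g c).1 : ℝ≥0) : ℝ) = 1 from rfl, (hB _).2.2] at this
      exact this

/-- The complex sequence with the given real and imaginary parts at even and odd indices. -/
noncomputable def toComplexSeq (y : ℕ → ℝ) (b : ℕ) : ℂ := y (2 * b) + y (2 * b + 1) * Complex.I

/-- The inverse of `toComplexSeq`. -/
noncomputable def ofComplexSeq (c : ℕ → ℂ) (a : ℕ) : ℝ :=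
  if a % 2 = 0 then (c (a / 2)).re else (c (a / 2)).im

theorem toComplexSeq_ofComplexSeq (c : ℕ → ℂ) : toComplexSeq (ofComplexSeq c) = c := by
  funext b
  have e1 : (2 * b) % 2 = 0 := by omega
  have e2 : (2 * b + 1) % 2 = 1 := by omega
  have e3 : 2 * b / 2 = b := by omega
  have e4 : (2 * b + 1) / 2 = b := by omega
  simp only [toComplexSeq, ofComplexSeq, e1, e2, e3, e4, if_true, one_ne_zero, if_false]
  exact Complex.re_add_im _

theorem ofComplexSeq_toComplexSeq (y : ℕ → ℝ) : ofComplexSeq (toComplexSeq y) = y := by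
  funext a
  unfold ofComplexSeq toComplexSeq
  split_ifs with h
  · rw [show 2 * (a / 2) = a by omega]
    simp
  · rw [show 2 * (a / 2) + 1 = a by omega]
    simp

theorem continuous_toComplexSeq : Continuous toComplexSeq := by
  unfold toComplexSeq
  fun_prop

theorem continuous_ofComplexSeq : Continuous ofComplexSeq := by
  refine continuous_pi fun a => ?_
  unfold ofComplexSeq
  split_ifs <;> fun_prop

theorem toComplexSeq_injective : Function.Injective toComplexSeq :=
  Function.LeftInverse.injective ofComplexSeq_toComplexSeq

/-- The condition on the complex leading coefficient of a sequence that is monic of index `k`. -/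
def IsLead (k : ℕ) (l : ℂ) : Prop := if k % 2 = 0 then l = 1 else l.im = 1

/-- A distinguished element satisfying `IsLead`. -/
noncomputable def leadUnit (k : ℕ) : ℂ := if k % 2 = 0 then 1 else Complex.I

theorem isLead_leadUnit (k : ℕ) : IsLead k (leadUnit k) := by
  unfold IsLead leadUnit
  split_ifs <;> simp

theorem IsLead.ne_zero {k : ℕ} {l : ℂ} (h : IsLead k l) : l ≠ 0 := by
  unfold IsLead at h
  rintro rfl
  split_ifs at h <;> simp at h

theorem leadUnit_ne_zero (k : ℕ) : leadUnit k ≠ 0 := (isLead_leadUnit k).ne_zero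

theorem IsLead.combination {k : ℕ} {l : ℂ} (h : IsLead k l) (t : ℝ) :
    IsLead k ((1 - t) * l + t * leadUnit k) := by
  unfold IsLead leadUnit at *
  split_ifs at * with hk
  · rw [h]
    ring
  · simp [h]

theorem monic_iff_isLead {k : ℕ} {y : ℕ → ℝ} :
    (y k = 1 ∧ ∀ b, k < b → y b = 0) ↔
      IsLead k (toComplexSeq y (k / 2)) ∧ ∀ b, k / 2 < b → toComplexSeq y b = 0 := by
  unfold IsLead
  constructor
  · rintro ⟨h1, h2⟩
    constructor
    · unfold toComplexSeq
      split_ifs with hk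
      · rw [show 2 * (k / 2) = k by omega, h1, h2 (k + 1) (by omega)]
        simp
      · rw [show 2 * (k / 2) + 1 = k by omega, h1]
        simp
    · intro b hb
      simp [toComplexSeq, h2 (2 * b) (by omega), h2 (2 * b + 1) (by omega)]
  · rintro ⟨h1, h2⟩
    rw [← ofComplexSeq_toComplexSeq y]
    unfold ofComplexSeq
    constructor
    · split_ifs at * with hk
      · simp [h1]
      · exact h1
    · intro b hb
      by_cases hbk : k / 2 < b / 2
      · simp [h2 _ hbk]
      · rw [if_neg (by omega), show b / 2 = k / 2 by omega]
        rw [if_pos (by omega)] at h1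
        simp [h1]

theorem phi_ofComplexSeq {N : ℕ} {c : ℕ → ℂ} {p : ℂ[X]} (hN : ∀ b, N ≤ 2 * b + 1 → c b = 0)
    (h : ∀ b, c b = p.coeff b) : phi (C Complex.I) X N (ofComplexSeq c) = p := by
  ext b
  have hsupp : ∀ a, N ≤ a → ofComplexSeq c a = 0 := fun a ha => by
    simp [ofComplexSeq, hN (a / 2) (by omega)]
  rw [coeff_phi_complex hsupp]
  exact (congrFun (toComplexSeq_ofComplexSeq c) b).trans (h b)

theorem nonempty_homotopyEquiv_Xset {N i k n : ℕ} (hk : k + 1 < N) :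
    Nonempty (ContinuousMap.HomotopyEquiv (MonFam N i k n ∩ {x | x.1 = 0} : Set Amb)
      (Xset (k / 2) n i)) := by
  have hI : (2 * i + 1) / 2 = i := by omega
  let m := k / 2
  let u := leadUnit k
  have hu : u ≠ 0 := leadUnit_ne_zero k
  let lead : Amb → ℕ → ℂ := fun x j => toComplexSeq (x.2 j) m
  have hTc : ∀ j b, Continuous fun x : Amb => toComplexSeq (x.2 j) b := fun j b =>
    (continuous_apply b).comp (continuous_toComplexSeq.comp (by fun_prop))
  have hlead : ∀ x ∈ MonFam N i k n, ∀ j ≤ n, IsLead k (lead x j) := fun x hx j hj =>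
    (monic_iff_isLead.1 (hx.1 j hj)).1
  have hcoeff : ∀ x ∈ MonFam N i k n, ∀ j ≤ n, ∀ b,
      (phi (C Complex.I) X N (x.2 j)).coeff b = toComplexSeq (x.2 j) b := fun x hx j hj b =>
    coeff_phi_complex (fun a ha => (hx.1 j hj).2 a (by omega)) b
  let f : Amb → Fin (n + 1) → Fin m → ℂ := fun x j b => (lead x j)⁻¹ * toComplexSeq (x.2 j) b
  let g : (Fin (n + 1) → Fin m → ℂ) → Amb := fun c => (0, fun j => if h : j < n + 1 then
    ofComplexSeq (fun b => u * (toPolyC m (c ⟨j, h⟩)).coeff b) else 0)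
  let F : ↥I × Amb → Amb := fun z => (0, fun j => if j ≤ n then
    ofComplexSeq (fun b => ((1 - (z.1 : ℝ)) * lead z.2 j + (z.1 : ℝ) * u) * (lead z.2 j)⁻¹ *
      toComplexSeq (z.2.2 j) b) else 0)
  have hgj : ∀ c, ∀ j : Fin (n + 1), (g c).2 j =
      ofComplexSeq (fun b => u * (toPolyC m (c j)).coeff b) := fun c j => dif_pos j.2
  have hg0 : ∀ c j, n < j → (g c).2 j = 0 := fun c j hj => dif_neg (by omega)
  have hfphi : ∀ x ∈ MonFam N i k n, ∀ j : Fin (n + 1), toPolyC m (f x j) =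
      C (lead x j)⁻¹ * phi (C Complex.I) X N (x.2 j) := by
    intro x hx j
    have hj : (j : ℕ) ≤ n := by omega
    ext b
    rw [toPolyC_coeff, coeff_C_mul, hcoeff x hx j hj]
    split_ifs with h1 h2
    · rfl
    · rw [h2]
      exact (inv_mul_cancel₀ (hlead x hx j hj).ne_zero).symm
    · rw [(monic_iff_isLead.1 (hx.1 j hj)).2 b (by omega), mul_zero]
  have hgphi : ∀ c, ∀ j : Fin (n + 1), phi (C Complex.I) X N ((g c).2 j) =
      C u * toPolyC m (c j) := by
    intro c j
    rw [hgj]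
    refine phi_ofComplexSeq (fun b hb => ?_) fun b => (coeff_C_mul _).symm
    rw [toPolyC_coeff, dif_neg (by omega), if_neg (by omega), mul_zero]
  have hFj : ∀ z : ↥I × Amb, ∀ j ≤ n, (F z).2 j =
    ofComplexSeq (fun b => ((1 - (z.1 : ℝ)) * lead z.2 j + (z.1 : ℝ) * u) * (lead z.2 j)⁻¹ *
      toComplexSeq (z.2.2 j) b) := fun z j hj => if_pos hj
  have hFphi : ∀ z : ↥I × Amb, z.2 ∈ MonFam N i k n → ∀ j ≤ n,
      phi (C Complex.I) X N ((F z).2 j) =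
        C (((1 - (z.1 : ℝ)) * lead z.2 j + (z.1 : ℝ) * u) * (lead z.2 j)⁻¹) *
          phi (C Complex.I) X N (z.2.2 j) := by
    intro z hz j hj
    rw [hFj z j hj]
    refine phi_ofComplexSeq (fun b hb => ?_) fun b => ?_
    · rw [(monic_iff_isLead.1 (hz.1 j hj)).2 b (by omega), mul_zero]
    · rw [coeff_C_mul, hcoeff z.2 hz j hj]
  have hfc : ContinuousOn f (MonFam N i k n ∩ {x | x.1 = 0}) := by
    refine continuousOn_pi.2 fun j => continuousOn_pi.2 fun b => ?_
    refine ContinuousOn.mul (ContinuousOn.inv₀ (hTc j m).continuousOn fun x hx => ?_)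
      (hTc j b).continuousOn
    exact (hlead x hx.1 j (by omega)).ne_zero
  have hgc : Continuous g := by
    refine continuous_const.prodMk (continuous_pi fun j => ?_)
    split_ifs with h
    · refine continuous_ofComplexSeq.comp (continuous_pi fun b => ?_)
      simp only [toPolyC_coeff]
      split_ifs <;> fun_prop
    · exact continuous_const
  have hFc : ContinuousOn F (univ ×ˢ (MonFam N i k n ∩ {x | x.1 = 0})) := by
    refine continuousOn_const.prodMk (continuousOn_pi.2 fun j => ?_)
    split_ifs with h
    · refine continuous_ofComplexSeq.comp_continuousOn (continuousOn_pi.2 fun b => ?_)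
      have h1 : ∀ b, Continuous fun z : ↥I × Amb => toComplexSeq (z.2.2 j) b := fun b =>
        (hTc j b).comp continuous_snd
      refine ContinuousOn.mul (ContinuousOn.mul (Continuous.continuousOn ?_)
        (ContinuousOn.inv₀ (h1 m).continuousOn fun z hz => ?_)) (h1 b).continuousOn
      · exact ((by fun_prop : Continuous fun z : ↥I × Amb => (1 - ((z.1 : ℝ) : ℂ))).mul (h1 m)).add
          (by fun_prop)
      · exact (hlead z.2 hz.2.1 j h).ne_zero
    · exact continuousOn_const
  have hfg : ∀ c, f (g c) = c := by
    intro c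
    funext j b
    simp only [f, lead, hgj, toComplexSeq_ofComplexSeq, toPolyC_coeff, lt_irrefl, dif_neg,
      not_false_eq_true, if_true, b.2, dif_pos]
    field_simp
  have hF0 : ∀ x ∈ MonFam N i k n ∩ {x | x.1 = 0}, F (0, x) = x := by
    rintro x ⟨hx, hx0⟩
    refine Prod.ext (Eq.symm hx0) (funext fun j => ?_)
    rcases Nat.lt_or_ge n j with hj | hj
    · rw [hx.2.1 j hj]
      exact if_neg (by omega)
    · rw [hFj _ j hj]
      apply toComplexSeq_injective
      rw [toComplexSeq_ofComplexSeq]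
      funext b
      have := (hlead x hx j hj).ne_zero
      simp [this]
  have hF1 : ∀ x ∈ MonFam N i k n ∩ {x | x.1 = 0}, F (1, x) = g (f x) := by
    rintro x ⟨hx, hx0⟩
    refine Prod.ext rfl (funext fun j => ?_)
    rcases Nat.lt_or_ge n j with hj | hj
    · rw [hg0 _ j hj]
      exact if_neg (by omega)
    · have h1 := hgj (f x) ⟨j, by omega⟩
      simp only at h1
      rw [hFj _ j hj, h1]
      congr 1
      funext b
      rw [hfphi x hx, coeff_C_mul, hcoeff x hx _ hj]
      simp [mul_assoc]
  refine nonempty_homotopyEquiv_of (f := f) (g := g) (F := F) (G := Prod.snd)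
    hfc hgc.continuousOn ?_ ?_ hFc continuousOn_snd ?_
    (fun _ _ h => h) hF0 hF1 (fun _ _ => rfl) (fun c _ => (hfg c).symm)
  · rintro x ⟨hx, hx0⟩
    rw [mem_Xset_iff]
    intro q hq
    have := hx.2.2.1 hx0 q ((forall_dvd_iff_fin (n := n) (fun j hj => ?_) q).2 fun j => ?_)
    · rwa [hI] at this
    · rw [hx.2.1 j hj, map_zero]
    · have h := hq j
      rw [show toPolyC (k / 2) (f x j) = _ from hfphi x hx j] at h
      exact (dvd_C_mul (inv_ne_zero (hlead x hx j (by omega)).ne_zero)).1 h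
  · intro c hc
    rw [mem_Xset_iff] at hc
    refine ⟨⟨fun j hj => ?_, hg0 c, fun _ q hq => ?_, fun h => absurd rfl h⟩, rfl⟩
    · have := hgj c ⟨j, by omega⟩
      simp only at this
      rw [this, monic_iff_isLead, toComplexSeq_ofComplexSeq]
      constructor
      · rw [toPolyC_coeff, dif_neg (lt_irrefl _), if_pos rfl, mul_one]
        exact isLead_leadUnit k
      · intro b hb
        rw [toPolyC_coeff, dif_neg (by omega), if_neg (by omega), mul_zero]
    · rw [hI]
      refine hc q fun j => ?_
      have := hq j
      rw [hgphi] at this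
      exact (dvd_C_mul hu).1 this
  · rintro t x ⟨hx, hx0⟩
    have hne : ∀ j ≤ n, ((1 - (t : ℝ)) * lead x j + (t : ℝ) * u) ≠ (0 : ℂ) := fun j hj =>
      ((hlead x hx j hj).combination t).ne_zero
    refine ⟨⟨fun j hj => ?_, fun j hj => if_neg (by omega), fun _ q hq => ?_,
      fun h => absurd rfl h⟩, rfl⟩
    · rw [hFj _ j hj, monic_iff_isLead, toComplexSeq_ofComplexSeq]
      constructor
      · rw [mul_assoc, show toComplexSeq (x.2 j) (k / 2) = lead x j from rfl,
          inv_mul_cancel₀ (hlead x hx j hj).ne_zero, mul_one]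
        exact (hlead x hx j hj).combination t
      · intro b hb
        rw [(monic_iff_isLead.1 (hx.1 j hj)).2 b hb, mul_zero]
    · refine hx.2.2.1 hx0 q ((forall_dvd_iff_fin (n := n) (fun j hj => ?_) q).2 fun j => ?_)
      · rw [hx.2.1 j hj, map_zero]
      · have hj : (j : ℕ) ≤ n := by omega
        have := hq j
        rw [hFphi (t, x) hx j hj] at this
        exact (dvd_C_mul (mul_ne_zero (hne j hj) (inv_ne_zero (hlead x hx j hj).ne_zero))).1 this

theorem nonempty_homotopyEquiv_RXset_Xset (n k i : ℕ) :
    Nonempty (ContinuousMap.HomotopyEquiv (RXset k n (2 * i + 1)) (Xset (k / 2) n i)) := by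
  obtain ⟨e₁⟩ := nonempty_homotopyEquiv_RXset (N := k + 3) (i := i) (k := k) (n := n) (by omega)
  obtain ⟨e₂⟩ := nonempty_homotopyEquiv_one (k + 3) i k n
  obtain ⟨e₃⟩ := nonempty_homotopyEquiv_fibers (N := k + 3) (i := i) (k := k) (n := n) (by omega)
  obtain ⟨e₄⟩ := nonempty_homotopyEquiv_Xset (N := k + 3) (i := i) (k := k) (n := n) (by omega)
  exact ⟨((e₁.symm.trans e₂.symm).trans e₃).trans e₄⟩

end EquivalenceProof

/-- **Theorem A.** For `n ≥ 1`, `k ≥ 1` and `i ≥ 0`, there is a homotopy equivalence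
`RX_{k,n}^{2i+1} ≃ X_{⌊k/2⌋,n}^{i}`. -/
theorem theoremA (n k i : ℕ) (hn : 1 ≤ n) (hk : 1 ≤ k) :
    Nonempty (ContinuousMap.HomotopyEquiv (RXset k n (2 * i + 1)) (Xset (k / 2) n i)) :=
  nonempty_homotopyEquiv_RXset_Xset n k i
end

section
/- For every k ≥ 1 and i ≥ 0, there is a homotopy equivalence between Y_{k,1}^{2i} and the disjoint union (coproduct, as a topological space) over q = 0, 1, …, k of the spaces X_{min(q,k−q),1}^{i}. (Proposition C(ii) of the paper.) -/
open Polynomial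

section Coefficients

lemma coeff_toPolyC (k : ℕ) (c : Fin k → ℂ) (n : ℕ) :
    (toPolyC k c).coeff n = if h : n < k then c ⟨n, h⟩ else if n = k then 1 else 0 := by
  simp only [toPolyC, coeff_add, coeff_X_pow, finsetSum_coeff, coeff_C_mul]
  by_cases h : n < k
  · rw [dif_pos h, if_neg h.ne, zero_add, Finset.sum_eq_single ⟨n, h⟩]
    · simp
    · intro j _ hj
      rw [if_neg, mul_zero]
      rintro rfl
      exact hj rfl
    · simp
  · rw [dif_neg h, Finset.sum_eq_zero, add_zero]
    intro j _
    rw [if_neg, mul_zero]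
    omega

lemma natDegree_toPolyC (k : ℕ) (c : Fin k → ℂ) : (toPolyC k c).natDegree = k := by
  apply natDegree_eq_of_le_of_coeff_ne_zero
  · rw [natDegree_le_iff_coeff_eq_zero]
    intro n hn
    rw [coeff_toPolyC, dif_neg (by omega), if_neg (by omega)]
  · simp [coeff_toPolyC]

lemma toPolyC_monic (k : ℕ) (c : Fin k → ℂ) : (toPolyC k c).Monic := by
  rw [Monic, leadingCoeff, natDegree_toPolyC]
  simp [coeff_toPolyC]

lemma toPolyC_coeff_s1 {k : ℕ} {p : ℂ[X]} (hp : p.Monic) (hk : p.natDegree = k) :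
    toPolyC k (fun j => p.coeff j) = p := by
  subst hk
  conv_rhs => rw [hp.as_sum]
  rw [toPolyC, Finset.sum_range]

lemma toPolyC_injective (k : ℕ) : Function.Injective (toPolyC k) := by
  intro c d h
  ext j
  have := congrArg (fun p => p.coeff j) h
  simpa [coeff_toPolyC] using this

lemma map_toPolyR (k : ℕ) (c : Fin k → ℝ) :
    (toPolyR k c).map Complex.ofRealHom = toPolyC k fun j => (c j : ℂ) := by
  simp [toPolyR, toPolyC, Polynomial.map_sum]

lemma toPolyR_monic (k : ℕ) (c : Fin k → ℝ) : (toPolyR k c).Monic := by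
  apply monic_of_injective Complex.ofRealHom.injective
  rw [map_toPolyR]
  exact toPolyC_monic _ _

/-- Every common divisor of `p` and `q` has degree at most `i`. -/
def CommonDegreeLE {F : Type*} [Field F] (i : ℕ) (p q : F[X]) : Prop :=
  ∀ d, d ∣ p → d ∣ q → d.natDegree ≤ i

lemma natDegree_gcd_le_iff_s1 {F : Type*} [Field F] [NormalizedGCDMonoid F[X]] (f : Fin 2 → F[X])
    (h : f 0 ≠ 0) (i : ℕ) :
    (Finset.univ.gcd f).natDegree ≤ i ↔ CommonDegreeLE i (f 0) (f 1) := by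
  constructor
  · intro H d h0 h1
    refine (natDegree_le_of_dvd (Finset.dvd_gcd ?_) ?_).trans H
    · intro j _
      fin_cases j
      · exact h0
      · exact h1
    · rw [Ne, Finset.gcd_eq_zero_iff]
      exact fun H => h (H 0 (Finset.mem_univ _))
  · intro H
    exact H _ (Finset.gcd_dvd (Finset.mem_univ _)) (Finset.gcd_dvd (Finset.mem_univ _))

lemma CommonDegreeLE.symm {F : Type*} [Field F] {i : ℕ} {p q : F[X]} (h : CommonDegreeLE i p q) :
    CommonDegreeLE i q p := fun d hq hp => h d hp hq

lemma CommonDegreeLE.add_mul {F : Type*} [Field F] {i : ℕ} {p q : F[X]}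
    (h : CommonDegreeLE i p q) (s : F[X]) : CommonDegreeLE i p (q + s * p) := fun d hp hq =>
  h d hp ((dvd_add_left (hp.mul_left s)).1 hq)

lemma CommonDegreeLE.map_taylor {F : Type*} [Field F] {i : ℕ} {p q : F[X]}
    (h : CommonDegreeLE i p q) (r : F) : CommonDegreeLE i (taylor r p) (taylor r q) := by
  have key : ∀ d g : F[X], d ∣ taylor r g → taylor (-r) d ∣ g := by
    rintro d g ⟨e, he⟩
    refine ⟨taylor (-r) e, ?_⟩
    rw [← taylor_mul, ← he, taylor_taylor, neg_add_cancel, taylor_zero]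
  intro d hp hq
  rw [← natDegree_taylor d (-r)]
  exact h _ (key _ _ hp) (key _ _ hq)

end Coefficients

section ContinuousFamilies

variable {T : Type*} [TopologicalSpace T]

/-- A family of complex polynomials all of whose coefficients depend continuously on the
parameter. -/
def CoeffContinuous (P : T → ℂ[X]) : Prop := ∀ n, Continuous fun t => (P t).coeff n

lemma CoeffContinuous.const (p : ℂ[X]) : CoeffContinuous fun _ : T => p :=
  fun _ => continuous_const

lemma CoeffContinuous.C {f : T → ℂ} (hf : Continuous f) :
    CoeffContinuous fun t => Polynomial.C (f t) := by
  intro n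
  simp only [coeff_C]
  split_ifs
  · exact hf
  · exact continuous_const

lemma CoeffContinuous.add {P Q : T → ℂ[X]} (hP : CoeffContinuous P) (hQ : CoeffContinuous Q) :
    CoeffContinuous fun t => P t + Q t := by
  intro n
  simp only [coeff_add]
  exact (hP n).add (hQ n)

lemma CoeffContinuous.sub {P Q : T → ℂ[X]} (hP : CoeffContinuous P) (hQ : CoeffContinuous Q) :
    CoeffContinuous fun t => P t - Q t := by
  intro n
  simp only [coeff_sub]
  exact (hP n).sub (hQ n)

lemma CoeffContinuous.mul {P Q : T → ℂ[X]} (hP : CoeffContinuous P) (hQ : CoeffContinuous Q) :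
    CoeffContinuous fun t => P t * Q t := by
  intro n
  simp only [coeff_mul]
  exact continuous_finsetSum _ fun x _ => (hP _).mul (hQ _)

lemma CoeffContinuous.pow {P : T → ℂ[X]} (hP : CoeffContinuous P) (m : ℕ) :
    CoeffContinuous fun t => P t ^ m := by
  induction m with
  | zero => simpa using CoeffContinuous.const 1
  | succ m ih => simpa only [pow_succ] using ih.mul hP

lemma CoeffContinuous.sum {ι : Type*} (s : Finset ι) {P : ι → T → ℂ[X]}
    (hP : ∀ j, CoeffContinuous (P j)) : CoeffContinuous fun t => ∑ j ∈ s, P j t := by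
  intro n
  simp only [finsetSum_coeff]
  exact continuous_finsetSum _ fun j _ => hP j n

lemma CoeffContinuous.star {P : T → ℂ[X]} (hP : CoeffContinuous P) :
    CoeffContinuous fun t => (P t).map (starRingEnd ℂ) := by
  intro n
  simp only [coeff_map]
  exact Complex.continuous_conj.comp (hP n)

lemma CoeffContinuous.toPolyC {k : ℕ} {c : T → Fin k → ℂ} (hc : Continuous c) :
    CoeffContinuous fun t => toPolyC k (c t) := by
  unfold _root_.toPolyC
  exact (CoeffContinuous.const _).add (.sum _ fun j =>
    (CoeffContinuous.C ((continuous_apply j).comp hc)).mul (.const _))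

lemma CoeffContinuous.taylor_toPolyC {k : ℕ} {c : T → Fin k → ℂ} (hc : Continuous c)
    {r : T → ℂ} (hr : Continuous r) :
    CoeffContinuous fun t => taylor (r t) (_root_.toPolyC k (c t)) := by
  simp only [_root_.toPolyC, map_add, taylor_X_pow, map_sum, taylor_mul, taylor_C]
  have h : CoeffContinuous fun t => (X + Polynomial.C (r t)) := (CoeffContinuous.const _).add (.C hr)
  exact (h.pow _).add (.sum _ fun j =>
    (CoeffContinuous.C ((continuous_apply j).comp hc)).mul (h.pow _))

lemma CoeffContinuous.eval {P : T → ℂ[X]} (hP : CoeffContinuous P) {m : ℕ}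
    (hm : ∀ t, (P t).natDegree ≤ m) (z : ℂ) : Continuous fun t => (P t).eval z := by
  have : (fun t => (P t).eval z) = fun t => ∑ j ∈ Finset.range (m + 1), (P t).coeff j * z ^ j := by
    ext t
    exact eval_eq_sum_range' (Nat.lt_succ_of_le (hm t)) z
  rw [this]
  exact continuous_finsetSum _ fun j _ => (hP j).mul continuous_const

/-- Pairs of coefficient vectors whose monic polynomials satisfy `Φ`. -/
def PairSet (a b : ℕ) (Φ : ℂ[X] → ℂ[X] → Prop) : Set ((Fin a → ℂ) × (Fin b → ℂ)) :=
  {x | Φ (toPolyC a x.1) (toPolyC b x.2)}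

variable {a b : ℕ} {Φ : ℂ[X] → ℂ[X] → Prop}

lemma PairSet.spec (x : PairSet a b Φ) : Φ (toPolyC a x.1.1) (toPolyC b x.1.2) := x.2

lemma PairSet.ext {x y : PairSet a b Φ} (h1 : toPolyC a x.1.1 = toPolyC a y.1.1)
    (h2 : toPolyC b x.1.2 = toPolyC b y.1.2) : x = y :=
  Subtype.ext (Prod.ext (toPolyC_injective a h1) (toPolyC_injective b h2))

lemma PairSet.continuous_fst : Continuous fun x : PairSet a b Φ => x.1.1 :=
  Continuous.fst continuous_subtype_val

lemma PairSet.continuous_snd : Continuous fun x : PairSet a b Φ => x.1.2 :=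
  Continuous.snd continuous_subtype_val

/-- The map into `PairSet a b Φ` given by two continuous families of monic polynomials. -/
def PairSet.mk (P Q : T → ℂ[X]) (hP : CoeffContinuous P) (hQ : CoeffContinuous Q)
    (mP : ∀ t, (P t).Monic) (mQ : ∀ t, (Q t).Monic) (dP : ∀ t, (P t).natDegree = a)
    (dQ : ∀ t, (Q t).natDegree = b) (hΦ : ∀ t, Φ (P t) (Q t)) : C(T, PairSet a b Φ) where
  toFun t := ⟨(fun j => (P t).coeff j, fun j => (Q t).coeff j), by
    simpa only [PairSet, Set.mem_ofPred_eq, toPolyC_coeff_s1 (mP t) (dP t),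
      toPolyC_coeff_s1 (mQ t) (dQ t)] using hΦ t⟩
  continuous_toFun := by
    refine Continuous.subtype_mk (.prodMk ?_ ?_) _
    · exact continuous_pi fun j => hP j
    · exact continuous_pi fun j => hQ j

lemma PairSet.toPolyC_mk_fst (P Q : T → ℂ[X]) (hP : CoeffContinuous P) (hQ : CoeffContinuous Q)
    (mP : ∀ t, (P t).Monic) (mQ : ∀ t, (Q t).Monic) (dP : ∀ t, (P t).natDegree = a)
    (dQ : ∀ t, (Q t).natDegree = b) (hΦ : ∀ t, Φ (P t) (Q t)) (t : T) :
    toPolyC a (PairSet.mk P Q hP hQ mP mQ dP dQ hΦ t).1.1 = P t :=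
  toPolyC_coeff_s1 (mP t) (dP t)

lemma PairSet.toPolyC_mk_snd (P Q : T → ℂ[X]) (hP : CoeffContinuous P) (hQ : CoeffContinuous Q)
    (mP : ∀ t, (P t).Monic) (mQ : ∀ t, (Q t).Monic) (dP : ∀ t, (P t).natDegree = a)
    (dQ : ∀ t, (Q t).natDegree = b) (hΦ : ∀ t, Φ (P t) (Q t)) (t : T) :
    toPolyC b (PairSet.mk P Q hP hQ mP mQ dP dQ hΦ t).1.2 = Q t :=
  toPolyC_coeff_s1 (mQ t) (dQ t)

lemma PairSet.homotopic (f g : C(T, PairSet a b Φ)) (P Q : unitInterval × T → ℂ[X])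
    (hP : CoeffContinuous P) (hQ : CoeffContinuous Q)
    (mP : ∀ t, (P t).Monic) (mQ : ∀ t, (Q t).Monic) (dP : ∀ t, (P t).natDegree = a)
    (dQ : ∀ t, (Q t).natDegree = b) (hΦ : ∀ t, Φ (P t) (Q t))
    (f1 : ∀ x, P (0, x) = toPolyC a (f x).1.1) (f2 : ∀ x, Q (0, x) = toPolyC b (f x).1.2)
    (g1 : ∀ x, P (1, x) = toPolyC a (g x).1.1) (g2 : ∀ x, Q (1, x) = toPolyC b (g x).1.2) :
    f.Homotopic g := by
  refine ⟨⟨PairSet.mk P Q hP hQ mP mQ dP dQ hΦ, fun x => ?_, fun x => ?_⟩⟩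
  · apply PairSet.ext
    · exact (PairSet.toPolyC_mk_fst ..).trans (f1 x)
    · exact (PairSet.toPolyC_mk_snd ..).trans (f2 x)
  · apply PairSet.ext
    · exact (PairSet.toPolyC_mk_fst ..).trans (g1 x)
    · exact (PairSet.toPolyC_mk_snd ..).trans (g2 x)

lemma monic_taylor_toPolyC (k : ℕ) (c : Fin k → ℂ) (r : ℂ) : (taylor r (toPolyC k c)).Monic := by
  rw [Monic, leadingCoeff_taylor]
  exact toPolyC_monic k c

lemma natDegree_taylor_toPolyC (k : ℕ) (c : Fin k → ℂ) (r : ℂ) :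
    (taylor r (toPolyC k c)).natDegree = k := by
  rw [natDegree_taylor, natDegree_toPolyC]

/-- The map into `PairSet a b Ψ` which translates the arguments of pairs of polynomials. -/
noncomputable def PairSet.shift {Ψ : ℂ[X] → ℂ[X] → Prop} (r : PairSet a b Φ → ℂ)
    (hr : Continuous r)
    (hΨ : ∀ x : PairSet a b Φ,
      Ψ (taylor (r x) (toPolyC a x.1.1)) (taylor (r x) (toPolyC b x.1.2))) :
    C(PairSet a b Φ, PairSet a b Ψ) :=
  PairSet.mk (fun x => taylor (r x) (toPolyC a x.1.1)) (fun x => taylor (r x) (toPolyC b x.1.2))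
    (.taylor_toPolyC PairSet.continuous_fst hr) (.taylor_toPolyC PairSet.continuous_snd hr)
    (fun _ => monic_taylor_toPolyC _ _ _) (fun _ => monic_taylor_toPolyC _ _ _)
    (fun _ => natDegree_taylor_toPolyC _ _ _) (fun _ => natDegree_taylor_toPolyC _ _ _) hΨ

lemma PairSet.toPolyC_shift_fst {Ψ : ℂ[X] → ℂ[X] → Prop} (r : PairSet a b Φ → ℂ)
    (hr : Continuous r)
    (hΨ : ∀ x : PairSet a b Φ,
      Ψ (taylor (r x) (toPolyC a x.1.1)) (taylor (r x) (toPolyC b x.1.2))) (x : PairSet a b Φ) :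
    toPolyC a (PairSet.shift r hr hΨ x).1.1 = taylor (r x) (toPolyC a x.1.1) :=
  PairSet.toPolyC_mk_fst ..

lemma PairSet.toPolyC_shift_snd {Ψ : ℂ[X] → ℂ[X] → Prop} (r : PairSet a b Φ → ℂ)
    (hr : Continuous r)
    (hΨ : ∀ x : PairSet a b Φ,
      Ψ (taylor (r x) (toPolyC a x.1.1)) (taylor (r x) (toPolyC b x.1.2))) (x : PairSet a b Φ) :
    toPolyC b (PairSet.shift r hr hΨ x).1.2 = taylor (r x) (toPolyC b x.1.2) :=
  PairSet.toPolyC_mk_snd ..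

lemma PairSet.coe_shift_zero {Ψ : ℂ[X] → ℂ[X] → Prop}
    (hΨ : ∀ x : PairSet a b Φ,
      Ψ (taylor 0 (toPolyC a x.1.1)) (taylor 0 (toPolyC b x.1.2))) (x : PairSet a b Φ) :
    (PairSet.shift (fun _ => 0) continuous_const hΨ x).1 = x.1 := by
  apply Prod.ext
  · apply toPolyC_injective
    rw [PairSet.toPolyC_shift_fst, taylor_zero]
  · apply toPolyC_injective
    rw [PairSet.toPolyC_shift_snd, taylor_zero]

lemma PairSet.homotopic_id_of_taylor (f : C(PairSet a b Φ, PairSet a b Φ)) (r : PairSet a b Φ → ℂ)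
    (hr : Continuous r) (h1 : ∀ x, toPolyC a (f x).1.1 = taylor (r x) (toPolyC a x.1.1))
    (h2 : ∀ x, toPolyC b (f x).1.2 = taylor (r x) (toPolyC b x.1.2))
    (hΦ : ∀ (t : unitInterval) (x : PairSet a b Φ),
      Φ (taylor (t * r x) (toPolyC a x.1.1)) (taylor (t * r x) (toPolyC b x.1.2))) :
    f.Homotopic (ContinuousMap.id _) := by
  have hr' : Continuous fun x : unitInterval × PairSet a b Φ => (x.1 : ℂ) * r x.2 :=
    (Complex.continuous_ofReal.comp (continuous_subtype_val.comp _root_.continuous_fst)).mul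
      (hr.comp _root_.continuous_snd)
  refine (PairSet.homotopic _ _
      (fun x => taylor (x.1 * r x.2) (toPolyC a x.2.1.1))
      (fun x => taylor (x.1 * r x.2) (toPolyC b x.2.1.2))
      (.taylor_toPolyC (PairSet.continuous_fst.comp _root_.continuous_snd) hr')
      (.taylor_toPolyC (PairSet.continuous_snd.comp _root_.continuous_snd) hr')
      (fun _ => monic_taylor_toPolyC _ _ _) (fun _ => monic_taylor_toPolyC _ _ _)
      (fun _ => natDegree_taylor_toPolyC _ _ _) (fun _ => natDegree_taylor_toPolyC _ _ _)
      (fun x => hΦ x.1 x.2) ?_ ?_ ?_ ?_).symm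
  · intro x
    simp
  · intro x
    simp
  · intro x
    simp [h1]
  · intro x
    simp [h2]

end ContinuousFamilies

section HomotopyEquivalences

open ContinuousMap hiding C

lemma homotopic_id_of_sigma {ι : Type*} {A : ι → Type*} [∀ j, TopologicalSpace (A j)]
    (f : ∀ j, C(A j, A j)) (hf : ∀ j, (f j).Homotopic (ContinuousMap.id _)) :
    (ContinuousMap.sigma fun j => (sigmaMk j).comp (f j)).Homotopic
      (ContinuousMap.id (Σ j, A j)) := by
  let K : ∀ j, C(A j × unitInterval, Σ j, A j) := fun j =>
    (sigmaMk j).comp ((hf j).some.toContinuousMap.comp .prodSwap)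
  let G : C((Σ j, A j) × unitInterval, Σ j, A j) :=
    (ContinuousMap.sigma K).comp ⟨_, (Homeomorph.sigmaProdDistrib (X := A)).continuous⟩
  refine ⟨⟨G.comp .prodSwap, ?_, ?_⟩⟩
  · rintro ⟨j, x⟩
    exact congrArg (Sigma.mk j) ((hf j).some.apply_zero x)
  · rintro ⟨j, x⟩
    exact congrArg (Sigma.mk j) ((hf j).some.apply_one x)

/-- Homotopy equivalences between the summands induce one between topological sums. -/
def sigmaHomotopyEquiv {ι : Type*} {A B : ι → Type*} [∀ j, TopologicalSpace (A j)]
    [∀ j, TopologicalSpace (B j)] (e : ∀ j, A j ≃ₕ B j) : (Σ j, A j) ≃ₕ (Σ j, B j) where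
  toFun := ContinuousMap.sigma fun j => (sigmaMk j).comp (e j).toFun
  invFun := ContinuousMap.sigma fun j => (sigmaMk j).comp (e j).invFun
  left_inv := by
    convert homotopic_id_of_sigma _ fun j => (e j).left_inv using 1
    ext1 ⟨j, x⟩
    rfl
  right_inv := by
    convert homotopic_id_of_sigma _ fun j => (e j).right_inv using 1
    ext1 ⟨j, x⟩
    rfl

/-- The roots of the polynomial lie in the open upper half plane. -/
def UpperRoots (p : ℂ[X]) : Prop := ∀ z, p.eval z = 0 → 0 < z.im

/-- The predicate on pairs cutting out the half plane version of `X_{a,1}^i`. -/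
def UpperCommonDegreeLE (i : ℕ) (p q : ℂ[X]) : Prop :=
  CommonDegreeLE i p q ∧ UpperRoots p ∧ UpperRoots q

lemma UpperRoots.taylor_neg {p : ℂ[X]} (hp : UpperRoots p) {s : ℂ} (hs : 0 ≤ s.im) :
    UpperRoots (taylor (-s) p) := by
  intro z hz
  rw [taylor_eval] at hz
  have := hp _ hz
  simp at this
  linarith

lemma norm_lt_of_eval_toPolyC_eq_zero {k : ℕ} {c : Fin k → ℂ} {z : ℂ}
    (hz : (toPolyC k c).eval z = 0) : ‖z‖ < ‖c‖ + 1 := by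
  have h : ‖z‖ < cauchyBound (toPolyC k c) :=
    IsRoot.norm_lt_cauchyBound (toPolyC_monic k c).ne_zero hz
  refine h.trans_le ?_
  rw [cauchyBound, (toPolyC_monic k c).leadingCoeff, natDegree_toPolyC]
  simp only [nnnorm_one, div_one, NNReal.coe_add, NNReal.coe_one, add_le_add_iff_right]
  rw [← coe_nnnorm, NNReal.coe_le_coe]
  refine Finset.sup_le fun j hj => ?_
  rw [coeff_toPolyC, dif_pos (Finset.mem_range.1 hj)]
  exact nnnorm_le_pi_nnnorm c _

lemma upperRoots_taylor_toPolyC {k : ℕ} {c : Fin k → ℂ} {R : ℝ} (hR : ‖c‖ + 1 ≤ R) :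
    UpperRoots (taylor (-(R * Complex.I)) (toPolyC k c)) := by
  intro z hz
  rw [taylor_eval] at hz
  have h := (norm_lt_of_eval_toPolyC_eq_zero hz).trans_le hR
  have h' := (Complex.abs_im_le_norm _).trans_lt h
  simp [abs_lt] at h'
  linarith

variable (a b i : ℕ)

lemma continuous_shiftAmount {Φ : ℂ[X] → ℂ[X] → Prop} :
    Continuous fun x : PairSet a b Φ => -(((‖x.1‖ + 1 : ℝ) : ℂ) * Complex.I) := by
  fun_prop

/-- The inclusion of the half plane version. -/
noncomputable def upperInclusion :
    C(PairSet a b (UpperCommonDegreeLE i), PairSet a b (CommonDegreeLE i)) :=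
  PairSet.shift (fun _ => 0) continuous_const fun x => by
    simpa only [taylor_zero] using (PairSet.spec x).1

/-- Translating roots upwards. -/
noncomputable def shiftUp :
    C(PairSet a b (CommonDegreeLE i), PairSet a b (UpperCommonDegreeLE i)) :=
  PairSet.shift (fun x => -(((‖x.1‖ + 1 : ℝ) : ℂ) * Complex.I))
    (continuous_shiftAmount a b) fun x => ⟨CommonDegreeLE.map_taylor (PairSet.spec x) _,
      upperRoots_taylor_toPolyC (by gcongr; exact norm_fst_le _),
      upperRoots_taylor_toPolyC (by gcongr; exact norm_snd_le _)⟩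

lemma coe_upperInclusion (x : PairSet a b (UpperCommonDegreeLE i)) :
    (upperInclusion a b i x).1 = x.1 :=
  PairSet.coe_shift_zero _ x

lemma toPolyC_shiftUp_fst (x : PairSet a b (CommonDegreeLE i)) :
    toPolyC a (shiftUp a b i x).1.1 =
      taylor (-(((‖x.1‖ + 1 : ℝ) : ℂ) * Complex.I)) (toPolyC a x.1.1) :=
  PairSet.toPolyC_shift_fst ..

lemma toPolyC_shiftUp_snd (x : PairSet a b (CommonDegreeLE i)) :
    toPolyC b (shiftUp a b i x).1.2 =
      taylor (-(((‖x.1‖ + 1 : ℝ) : ℂ) * Complex.I)) (toPolyC b x.1.2) :=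
  PairSet.toPolyC_shift_snd ..

/-- Translating upwards identifies, up to homotopy, pairs with roots in the upper half plane and
arbitrary pairs. -/
noncomputable def upperHomotopyEquiv :
    PairSet a b (UpperCommonDegreeLE i) ≃ₕ PairSet a b (CommonDegreeLE i) where
  toFun := upperInclusion a b i
  invFun := shiftUp a b i
  left_inv := by
    refine PairSet.homotopic_id_of_taylor _ (fun x => -(((‖x.1‖ + 1 : ℝ) : ℂ) * Complex.I))
      (continuous_shiftAmount a b) (fun x => ?_) (fun x => ?_) fun t x => ?_
    · rw [comp_apply, toPolyC_shiftUp_fst, coe_upperInclusion]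
    · rw [comp_apply, toPolyC_shiftUp_snd, coe_upperInclusion]
    · rw [mul_neg]
      refine ⟨(PairSet.spec x).1.map_taylor _, (PairSet.spec x).2.1.taylor_neg ?_,
        (PairSet.spec x).2.2.taylor_neg ?_⟩
      all_goals
        have := t.2.1
        simp
        positivity
  right_inv := by
    refine PairSet.homotopic_id_of_taylor _ (fun x => -(((‖x.1‖ + 1 : ℝ) : ℂ) * Complex.I))
      (continuous_shiftAmount a b) (fun x => ?_) (fun x => ?_) fun t x =>
      CommonDegreeLE.map_taylor (PairSet.spec x) _
    · rw [comp_apply, coe_upperInclusion, toPolyC_shiftUp_fst]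
    · rw [comp_apply, coe_upperInclusion, toPolyC_shiftUp_snd]

end HomotopyEquivalences

section Reduction

open ContinuousMap hiding C

lemma monic_of_natDegree_le_of_coeff {p : ℂ[X]} {n : ℕ} (h : p.natDegree ≤ n)
    (h1 : p.coeff n = 1) : p.Monic ∧ p.natDegree = n :=
  ⟨monic_of_natDegree_le_of_coeff_eq_one n h h1,
    natDegree_eq_of_le_of_coeff_ne_zero h (by simp [h1])⟩

lemma coeff_X_pow_mul_of_monic {u : ℂ[X]} {a : ℕ} (hu : u.Monic) (ha : u.natDegree = a) (n : ℕ) :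
    (X ^ n * u).natDegree = a + n ∧ (X ^ n * u).coeff (a + n) = 1 := by
  have h : (X ^ n * u).natDegree = a + n := by
    rw [(monic_X_pow n).natDegree_mul hu, natDegree_X_pow, ha, add_comm]
  refine ⟨h, ?_⟩
  rw [← h]
  exact (monic_X_pow n).mul hu

/-- Adding a multiple of `z ^ (n + 1) u` raises the degree of the second polynomial. -/
lemma raise_degree {u w : ℂ[X]} {a n : ℕ} (hu : u.Monic) (ha : u.natDegree = a)
    (hw : w.natDegree = a + n) :
    (w + X ^ (n + 1) * u).Monic ∧ (w + X ^ (n + 1) * u).natDegree = a + (n + 1) := by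
  obtain ⟨h1, h2⟩ := coeff_X_pow_mul_of_monic hu ha (n + 1)
  apply monic_of_natDegree_le_of_coeff
  · exact (natDegree_add_le _ _).trans (max_le (by omega) h1.le)
  · rw [coeff_add, h2, coeff_eq_zero_of_natDegree_lt (by omega), zero_add]

lemma lower_degree {u w : ℂ[X]} {a n : ℕ} (hu : u.Monic) (ha : u.natDegree = a) (mw : w.Monic)
    (hw : w.natDegree = a + (n + 1)) {r : ℂ} (hr : r = 1 - (w - X ^ (n + 1) * u).coeff (a + n)) :
    (w - X ^ (n + 1) * u + C r * (X ^ n * u)).Monic ∧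
    (w - X ^ (n + 1) * u + C r * (X ^ n * u)).natDegree = a + n := by
  obtain ⟨h1, h2⟩ := coeff_X_pow_mul_of_monic hu ha (n + 1)
  obtain ⟨h3, h4⟩ := coeff_X_pow_mul_of_monic hu ha n
  have h5 : (w - X ^ (n + 1) * u).natDegree ≤ a + n := by
    rw [natDegree_le_iff_coeff_eq_zero]
    intro N hN
    rw [coeff_sub]
    rcases (Nat.succ_le_of_lt hN).eq_or_lt with rfl | hN'
    · have : w.coeff (a + (n + 1)) = 1 := hw ▸ mw
      rw [Nat.succ_eq_add_one, add_assoc, this, h2, sub_self]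
    · rw [coeff_eq_zero_of_natDegree_lt (by omega), coeff_eq_zero_of_natDegree_lt (by omega),
        sub_self]
  apply monic_of_natDegree_le_of_coeff
  · exact (natDegree_add_le _ _).trans (max_le h5 ((natDegree_C_mul_le _ _).trans h3.le))
  · rw [coeff_add, coeff_C_mul, h4, hr]
    ring

lemma monic_add_C_mul {u w : ℂ[X]} {a n : ℕ} (hu : u.Monic) (ha : u.natDegree = a) (mw : w.Monic)
    (hw : w.natDegree = a + (n + 1)) (r : ℂ) :
    (w + C r * (X ^ n * u)).Monic ∧ (w + C r * (X ^ n * u)).natDegree = a + (n + 1) := by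
  obtain ⟨h3, h4⟩ := coeff_X_pow_mul_of_monic hu ha n
  apply monic_of_natDegree_le_of_coeff
  · exact (natDegree_add_le _ _).trans (max_le hw.le ((natDegree_C_mul_le _ _).trans (by omega)))
  · have : w.coeff (a + (n + 1)) = 1 := hw ▸ mw
    rw [coeff_add, coeff_C_mul, this, coeff_eq_zero_of_natDegree_lt (p := X ^ n * u) (by omega)]
    simp

lemma CommonDegreeLE.lower {i : ℕ} {u w : ℂ[X]} (h : CommonDegreeLE i u w) (r : ℂ) (n : ℕ) :
    CommonDegreeLE i u (w - X ^ (n + 1) * u + C r * (X ^ n * u)) := by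
  have key : w - X ^ (n + 1) * u + C r * (X ^ n * u) = w + (C r * X ^ n - X ^ (n + 1)) * u := by
    ring
  rw [key]
  exact h.add_mul _

variable (a b i n : ℕ)

/-- The coefficient which has to be corrected when the degree of the second polynomial is
lowered by one. -/
noncomputable def defect (x : PairSet a (a + (n + 1)) (CommonDegreeLE i)) : ℂ :=
  1 - (toPolyC (a + (n + 1)) x.1.2 - X ^ (n + 1) * toPolyC a x.1.1).coeff (a + n)

lemma continuous_defect : Continuous (defect a i n) :=
  continuous_const.sub ((CoeffContinuous.toPolyC PairSet.continuous_snd).sub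
    ((CoeffContinuous.const _).mul (.toPolyC PairSet.continuous_fst)) _)

/-- Subtracting multiples of the first polynomial from the second one lowers the degree
of the second one. -/
noncomputable def lowerMap :
    C(PairSet a (a + (n + 1)) (CommonDegreeLE i), PairSet a (a + n) (CommonDegreeLE i)) :=
  PairSet.mk (fun x => toPolyC a x.1.1)
    (fun x => toPolyC (a + (n + 1)) x.1.2 - X ^ (n + 1) * toPolyC a x.1.1
      + C (defect a i n x) * (X ^ n * toPolyC a x.1.1))
    (.toPolyC PairSet.continuous_fst)
    (((CoeffContinuous.toPolyC PairSet.continuous_snd).sub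
      ((CoeffContinuous.const _).mul (.toPolyC PairSet.continuous_fst))).add
      ((CoeffContinuous.C (continuous_defect a i n)).mul
        ((CoeffContinuous.const _).mul (.toPolyC PairSet.continuous_fst))))
    (fun _ => toPolyC_monic _ _)
    (fun _ => (lower_degree (toPolyC_monic _ _) (natDegree_toPolyC _ _) (toPolyC_monic _ _)
      (natDegree_toPolyC _ _) rfl).1)
    (fun _ => natDegree_toPolyC _ _)
    (fun _ => (lower_degree (toPolyC_monic _ _) (natDegree_toPolyC _ _) (toPolyC_monic _ _)
      (natDegree_toPolyC _ _) rfl).2)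
    (fun x => (PairSet.spec x).lower _ _)

/-- Adding a multiple of the first polynomial to the second one raises the degree of the
second one. -/
noncomputable def raiseMap :
    C(PairSet a (a + n) (CommonDegreeLE i), PairSet a (a + (n + 1)) (CommonDegreeLE i)) :=
  PairSet.mk (fun x => toPolyC a x.1.1)
    (fun x => toPolyC (a + n) x.1.2 + X ^ (n + 1) * toPolyC a x.1.1)
    (.toPolyC PairSet.continuous_fst)
    ((CoeffContinuous.toPolyC PairSet.continuous_snd).add
      ((CoeffContinuous.const _).mul (.toPolyC PairSet.continuous_fst)))
    (fun _ => toPolyC_monic _ _)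
    (fun _ => (raise_degree (toPolyC_monic _ _) (natDegree_toPolyC _ _) (natDegree_toPolyC _ _)).1)
    (fun _ => natDegree_toPolyC _ _)
    (fun _ => (raise_degree (toPolyC_monic _ _) (natDegree_toPolyC _ _) (natDegree_toPolyC _ _)).2)
    (fun x => CommonDegreeLE.add_mul (PairSet.spec x) _)

lemma toPolyC_lowerMap_fst (x : PairSet a (a + (n + 1)) (CommonDegreeLE i)) :
    toPolyC a (lowerMap a i n x).1.1 = toPolyC a x.1.1 :=
  PairSet.toPolyC_mk_fst ..

lemma toPolyC_lowerMap_snd (x : PairSet a (a + (n + 1)) (CommonDegreeLE i)) :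
    toPolyC (a + n) (lowerMap a i n x).1.2 =
      toPolyC (a + (n + 1)) x.1.2 - X ^ (n + 1) * toPolyC a x.1.1
      + C (defect a i n x) * (X ^ n * toPolyC a x.1.1) :=
  PairSet.toPolyC_mk_snd ..

lemma toPolyC_raiseMap_fst (x : PairSet a (a + n) (CommonDegreeLE i)) :
    toPolyC a (raiseMap a i n x).1.1 = toPolyC a x.1.1 :=
  PairSet.toPolyC_mk_fst ..

lemma toPolyC_raiseMap_snd (x : PairSet a (a + n) (CommonDegreeLE i)) :
    toPolyC (a + (n + 1)) (raiseMap a i n x).1.2 =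
      toPolyC (a + n) x.1.2 + X ^ (n + 1) * toPolyC a x.1.1 :=
  PairSet.toPolyC_mk_snd ..

lemma defect_raiseMap (x : PairSet a (a + n) (CommonDegreeLE i)) :
    defect a i n (raiseMap a i n x) = 0 := by
  rw [defect, toPolyC_raiseMap_fst, toPolyC_raiseMap_snd, add_sub_cancel_right,
    coeff_toPolyC]
  simp

lemma homotopic_raiseMap_comp_lowerMap :
    (ContinuousMap.id _).Homotopic ((raiseMap a i n).comp (lowerMap a i n)) := by
  have cont : Continuous fun x : unitInterval × PairSet a (a + (n + 1)) (CommonDegreeLE i) =>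
      (x.1 : ℂ) * defect a i n x.2 :=
    (Complex.continuous_ofReal.comp (continuous_subtype_val.comp continuous_fst)).mul
      ((continuous_defect a i n).comp continuous_snd)
  have c1 := PairSet.continuous_fst.comp
    (continuous_snd (X := unitInterval) (Y := PairSet a (a + (n + 1)) (CommonDegreeLE i)))
  have c2 := PairSet.continuous_snd.comp
    (continuous_snd (X := unitInterval) (Y := PairSet a (a + (n + 1)) (CommonDegreeLE i)))
  apply PairSet.homotopic _ _ (fun x => toPolyC a x.2.1.1)
    (fun x => toPolyC (a + (n + 1)) x.2.1.2
      + C (x.1 * defect a i n x.2) * (X ^ n * toPolyC a x.2.1.1))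
  · exact .toPolyC c1
  · exact (CoeffContinuous.toPolyC c2).add
      ((CoeffContinuous.C cont).mul ((CoeffContinuous.const _).mul (.toPolyC c1)))
  · exact fun _ => toPolyC_monic _ _
  · exact fun _ => (monic_add_C_mul (toPolyC_monic _ _) (natDegree_toPolyC _ _) (toPolyC_monic _ _)
      (natDegree_toPolyC _ _) _).1
  · exact fun _ => natDegree_toPolyC _ _
  · exact fun _ => (monic_add_C_mul (toPolyC_monic _ _) (natDegree_toPolyC _ _) (toPolyC_monic _ _)
      (natDegree_toPolyC _ _) _).2
  · intro x
    simp only [← mul_assoc]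
    exact CommonDegreeLE.add_mul (PairSet.spec x.2) _
  · intro x
    rw [id_apply]
  · intro x
    simp only [id_apply, Set.Icc.coe_zero, Complex.ofReal_zero, zero_mul, map_zero, add_zero]
  · intro x
    rw [comp_apply, toPolyC_raiseMap_fst, toPolyC_lowerMap_fst]
  · intro x
    rw [comp_apply, toPolyC_raiseMap_snd, toPolyC_lowerMap_fst, toPolyC_lowerMap_snd,
      Set.Icc.coe_one, Complex.ofReal_one, one_mul]
    ring

lemma lowerMap_comp_raiseMap :
    (lowerMap a i n).comp (raiseMap a i n) = ContinuousMap.id _ := by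
  ext1 x
  apply PairSet.ext
  · rw [comp_apply, toPolyC_lowerMap_fst, toPolyC_raiseMap_fst, id_apply]
  · rw [comp_apply, toPolyC_lowerMap_snd, defect_raiseMap, toPolyC_raiseMap_fst,
      toPolyC_raiseMap_snd, id_apply, map_zero, zero_mul, add_zero, add_sub_cancel_right]

/-- Lowering the degree of the second polynomial by one is a homotopy equivalence. -/
noncomputable def lowerHomotopyEquiv :
    PairSet a (a + (n + 1)) (CommonDegreeLE i) ≃ₕ PairSet a (a + n) (CommonDegreeLE i) where
  toFun := lowerMap a i n
  invFun := raiseMap a i n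
  left_inv := (homotopic_raiseMap_comp_lowerMap a i n).symm
  right_inv := by
    rw [lowerMap_comp_raiseMap]

/-- The degree of the second polynomial can be lowered to that of the first one. -/
noncomputable def reduceHomotopyEquiv :
    ∀ n, PairSet a (a + n) (CommonDegreeLE i) ≃ₕ PairSet a a (CommonDegreeLE i)
  | 0 => .refl _
  | n + 1 => (lowerHomotopyEquiv a i n).trans (reduceHomotopyEquiv n)

/-- Exchanging the two polynomials. -/
noncomputable def swapHomeomorph :
    PairSet a b (CommonDegreeLE i) ≃ₜ PairSet b a (CommonDegreeLE i) :=
  (Homeomorph.prodComm _ _).subtype fun _ => ⟨fun h => h.symm, fun h => h.symm⟩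

/-- Tuples of two polynomials as pairs. -/
noncomputable def tupleHomeomorph : Xset a 1 i ≃ₜ PairSet a a (CommonDegreeLE i) :=
  Homeomorph.finTwoArrow.subtype fun f =>
    natDegree_gcd_le_iff_s1 (fun j => toPolyC a (f j)) (toPolyC_monic _ _).ne_zero i

lemma nonempty_homotopyEquiv_Xset_min (a b i : ℕ) :
    Nonempty (PairSet a b (CommonDegreeLE i) ≃ₕ Xset (min a b) 1 i) := by
  rcases le_total a b with h | h
  · obtain ⟨n, rfl⟩ := Nat.exists_eq_add_of_le h
    rw [min_eq_left h]
    exact ⟨(reduceHomotopyEquiv a i n).trans (tupleHomeomorph a i).symm.toHomotopyEquiv⟩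
  · obtain ⟨n, rfl⟩ := Nat.exists_eq_add_of_le h
    rw [min_eq_right h]
    exact ⟨((swapHomeomorph _ _ i).toHomotopyEquiv.trans (reduceHomotopyEquiv b i n)).trans
      (tupleHomeomorph b i).symm.toHomotopyEquiv⟩

end Reduction

section Conjugation

/-- The polynomial with complex conjugate coefficients. -/
noncomputable def conjPoly (p : ℂ[X]) : ℂ[X] := p.map (starRingEnd ℂ)

@[simp]
lemma conjPoly_conjPoly (p : ℂ[X]) : conjPoly (conjPoly p) = p := by
  ext n
  simp [conjPoly]

@[simp]
lemma conjPoly_mul (p q : ℂ[X]) : conjPoly (p * q) = conjPoly p * conjPoly q :=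
  Polynomial.map_mul _

lemma conjPoly_map_ofReal (p : ℝ[X]) :
    conjPoly (p.map Complex.ofRealHom) = p.map Complex.ofRealHom := by
  ext n
  simp [conjPoly]

@[simp]
lemma natDegree_conjPoly (p : ℂ[X]) : (conjPoly p).natDegree = p.natDegree :=
  natDegree_map _

lemma Polynomial.Monic.conjPoly {p : ℂ[X]} (hp : p.Monic) : (conjPoly p).Monic := hp.map _

lemma conjPoly_dvd_conjPoly {p q : ℂ[X]} (h : p ∣ q) : conjPoly p ∣ conjPoly q :=
  Polynomial.map_dvd _ h

lemma eval_conjPoly (p : ℂ[X]) (z : ℂ) :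
    (conjPoly p).eval z = starRingEnd ℂ (p.eval (starRingEnd ℂ z)) := by
  rw [conjPoly, eval_map, ← eval₂_hom, Complex.conj_conj]

lemma exists_map_ofReal_eq_mul_conjPoly (d : ℂ[X]) :
    ∃ e : ℝ[X], e.map Complex.ofRealHom = d * conjPoly d := by
  have h : d * conjPoly d ∈ lifts Complex.ofRealHom := by
    rw [lifts_iff_coeff_lifts]
    intro n
    have h : conjPoly (d * conjPoly d) = d * conjPoly d := by
      rw [conjPoly_mul, conjPoly_conjPoly, mul_comm]
    have h' := congrArg (fun p => p.coeff n) h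
    simp only [conjPoly, coeff_map] at h'
    obtain ⟨r, hr⟩ := Complex.conj_eq_iff_real.1 h'
    exact ⟨r, hr.symm⟩
  exact (mem_lifts _).1 h

/-- The roots of the polynomial lie in the open lower half plane. -/
def LowerRoots (p : ℂ[X]) : Prop := ∀ z, p.eval z = 0 → z.im < 0

lemma UpperRoots.conjPoly {p : ℂ[X]} (hp : UpperRoots p) : LowerRoots (conjPoly p) := by
  intro z hz
  rw [eval_conjPoly, map_eq_zero] at hz
  simpa using hp _ hz

lemma LowerRoots.conjPoly {p : ℂ[X]} (hp : LowerRoots p) : UpperRoots (conjPoly p) := by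
  intro z hz
  rw [eval_conjPoly, map_eq_zero] at hz
  simpa using hp _ hz

lemma UpperRoots.isCoprime {p q : ℂ[X]} (hp : UpperRoots p) (hq : LowerRoots q) :
    IsCoprime p q := by
  refine (isCoprime_iff_aeval_ne_zero_of_isAlgClosed ℂ ℂ p q).2 fun z => ?_
  by_contra! h
  simp only [coe_aeval_eq_eval] at h
  exact lt_asymm (hp z h.1) (hq z h.2)

/-- Common real divisors of `u * conjPoly w` and its conjugate correspond to common divisors of
`u` and `w`. -/
lemma natDegree_le_of_dvd_mul_conjPoly_iff {u w : ℂ[X]} (hu : UpperRoots u) (hw : UpperRoots w)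
    (i : ℕ) :
    (∀ e : ℝ[X], e.map Complex.ofRealHom ∣ u * conjPoly w →
      e.map Complex.ofRealHom ∣ conjPoly (u * conjPoly w) → e.natDegree ≤ 2 * i) ↔
    CommonDegreeLE i u w := by
  constructor
  · intro H d du dw
    obtain ⟨e, he⟩ := exists_map_ofReal_eq_mul_conjPoly d
    have h := H e
    rw [he, conjPoly_mul, conjPoly_conjPoly, mul_comm (conjPoly u)] at h
    have h' := h (mul_dvd_mul du (conjPoly_dvd_conjPoly dw))
      (mul_dvd_mul dw (conjPoly_dvd_conjPoly du))
    rcases eq_or_ne d 0 with rfl | hd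
    · simp
    · have hd' : conjPoly d ≠ 0 := by
        intro h0
        apply hd
        rw [← conjPoly_conjPoly d, h0, conjPoly, Polynomial.map_zero]
      rw [← natDegree_map Complex.ofRealHom, he, natDegree_mul hd hd', natDegree_conjPoly] at h'
      omega
  · intro H e h1 h2
    rw [conjPoly_mul, conjPoly_conjPoly] at h2
    have key : ∀ u w e₁ : ℂ[X], UpperRoots u → CommonDegreeLE i u w → e₁ ∣ u →
        e₁ ∣ conjPoly u * w → e₁.natDegree ≤ i := by
      intro u w e₁ hu H h1 h2
      refine H e₁ h1 (IsCoprime.dvd_of_dvd_mul_left ?_ h2)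
      exact (hu.isCoprime hu.conjPoly).of_isCoprime_of_dvd_left h1
    obtain ⟨e₁, e₂, he₁, he₂, he⟩ := exists_dvd_and_dvd_of_dvd_mul h1
    have d1 : e₁.natDegree ≤ i := by
      refine key u w e₁ hu H he₁ (dvd_trans ?_ h2)
      rw [he]
      exact dvd_mul_right _ _
    have d2 : e₂.natDegree ≤ i := by
      rw [← natDegree_conjPoly]
      refine key w u _ hw H.symm ?_ ?_
      · simpa using conjPoly_dvd_conjPoly he₂
      · rw [mul_comm]
        refine dvd_trans ?_ h1
        rw [← conjPoly_map_ofReal, he, conjPoly_mul]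
        exact dvd_mul_left _ _
    rw [← natDegree_map Complex.ofRealHom, he]
    exact natDegree_mul_le.trans (by omega)

lemma exists_upperRoots_mul_lowerRoots {p : ℂ[X]} (hp : p.Monic)
    (h : ∀ x : ℝ, p.eval (x : ℂ) ≠ 0) :
    ∃ u v : ℂ[X], u.Monic ∧ v.Monic ∧ UpperRoots u ∧ LowerRoots v ∧ p = u * v := by
  classical
  have hr : ∀ (s : Multiset ℂ) (z : ℂ), (s.map fun r => X - C r).prod.eval z = 0 → z ∈ s := by
    intro s z hz
    rw [← roots_multiset_prod_X_sub_C s]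
    exact (mem_roots (monic_multiset_prod_of_monic _ _ fun r _ => monic_X_sub_C r).ne_zero).2 hz
  refine ⟨((p.roots.filter fun r => 0 < r.im).map fun r => X - C r).prod,
    ((p.roots.filter fun r => ¬ 0 < r.im).map fun r => X - C r).prod,
    monic_multiset_prod_of_monic _ _ fun r _ => monic_X_sub_C r,
    monic_multiset_prod_of_monic _ _ fun r _ => monic_X_sub_C r, ?_, ?_, ?_⟩
  · intro z hz
    exact (Multiset.mem_filter.1 (hr _ _ hz)).2
  · intro z hz
    obtain ⟨h1, h2⟩ := Multiset.mem_filter.1 (hr _ _ hz)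
    refine (not_lt.1 h2).lt_of_ne fun h0 => h z.re ?_
    have hz' : (z.re : ℂ) = z := Complex.ext rfl (by simpa using h0.symm)
    rw [hz']
    exact isRoot_of_mem_roots h1
  · rw [← Multiset.prod_add, ← Multiset.map_add, Multiset.filter_add_not]
    exact (IsAlgClosed.splits p).eq_prod_roots_of_monic hp

lemma UpperRoots.abs_im_pow_le_norm_eval {p : ℂ[X]} (hp : UpperRoots p) (hm : p.Monic) {z : ℂ}
    (hz : z.im ≤ 0) : |z.im| ^ p.natDegree ≤ ‖p.eval z‖ := by
  have key : ∀ s : Multiset ℂ, (∀ r ∈ s, 0 < r.im) →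
      |z.im| ^ s.card ≤ ‖(s.map fun r => z - r).prod‖ := by
    intro s
    induction s using Multiset.induction with
    | empty => simp
    | cons r s ih =>
      intro hs
      rw [Multiset.card_cons, Multiset.map_cons, Multiset.prod_cons, norm_mul, pow_succ']
      have h1 : |z.im| ≤ ‖z - r‖ := by
        refine le_trans ?_ (Complex.abs_im_le_norm _)
        have := hs r (Multiset.mem_cons_self _ _)
        rw [Complex.sub_im, abs_of_nonpos hz, abs_of_nonpos (by linarith)]
        linarith
      exact mul_le_mul h1 (ih fun t ht => hs t (Multiset.mem_cons_of_mem ht)) (by positivity)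
        (norm_nonneg _)
  have hs := IsAlgClosed.splits p
  rw [hs.natDegree_eq_card_roots, hs.eval_eq_prod_roots_of_monic hm]
  exact key _ fun r hr => hp r (isRoot_of_mem_roots hr)

end Conjugation

section RealTuples

/-- A pair of real vectors `(p₀, p₁)` is encoded by the complex vector
`(p₀ + p₁) / 2 + I (p₁ - p₀) / 2`. -/
noncomputable def realTuple (k : ℕ) : (Fin k → ℂ) ≃ₜ (Fin 2 → Fin k → ℝ) where
  toFun h := ![fun j => (h j).re - (h j).im, fun j => (h j).re + (h j).im]
  invFun p j := ((p 0 j + p 1 j) / 2 : ℝ) + ((p 1 j - p 0 j) / 2 : ℝ) * Complex.I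
  left_inv h := by
    ext j
    apply Complex.ext <;> simp
  right_inv p := by
    ext n j
    fin_cases n <;> simp <;> ring
  continuous_toFun := by
    refine continuous_pi fun n => ?_
    fin_cases n <;> simp <;> fun_prop
  continuous_invFun := by fun_prop

lemma toPolyC_eq_realTuple {k : ℕ} (h : Fin k → ℂ) :
    toPolyC k h =
      C ((1 - Complex.I) / 2) * (toPolyR k (realTuple k h 0)).map Complex.ofRealHom +
      C ((1 + Complex.I) / 2) * (toPolyR k (realTuple k h 1)).map Complex.ofRealHom := by
  rw [map_toPolyR, map_toPolyR]
  ext n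
  simp only [coeff_add, coeff_C_mul, coeff_toPolyC]
  split_ifs with h1
  · apply Complex.ext <;> simp [realTuple] <;> ring
  · ring
  · ring

lemma conjPoly_toPolyC_eq_realTuple {k : ℕ} (h : Fin k → ℂ) :
    conjPoly (toPolyC k h) =
      C ((1 + Complex.I) / 2) * (toPolyR k (realTuple k h 0)).map Complex.ofRealHom +
      C ((1 - Complex.I) / 2) * (toPolyR k (realTuple k h 1)).map Complex.ofRealHom := by
  have h0 := conjPoly_map_ofReal (toPolyR k (realTuple k h 0))
  have h1 := conjPoly_map_ofReal (toPolyR k (realTuple k h 1))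
  simp only [conjPoly] at h0 h1
  rw [toPolyC_eq_realTuple, conjPoly, Polynomial.map_add, Polynomial.map_mul, Polynomial.map_mul,
    h0, h1]
  simp [sub_eq_add_neg, Complex.conj_ofNat]

lemma realTuple_zero_eq {k : ℕ} (h : Fin k → ℂ) :
    (toPolyR k (realTuple k h 0)).map Complex.ofRealHom =
      C ((1 + Complex.I) / 2) * toPolyC k h + C ((1 - Complex.I) / 2) * conjPoly (toPolyC k h) := by
  rw [conjPoly_toPolyC_eq_realTuple, toPolyC_eq_realTuple]
  ext n
  simp only [coeff_add, coeff_C_mul]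
  linear_combination (((toPolyR k (realTuple k h 0)).map Complex.ofRealHom).coeff n -
    ((toPolyR k (realTuple k h 1)).map Complex.ofRealHom).coeff n) / 2 * Complex.I_sq

lemma realTuple_one_eq {k : ℕ} (h : Fin k → ℂ) :
    (toPolyR k (realTuple k h 1)).map Complex.ofRealHom =
      C ((1 - Complex.I) / 2) * toPolyC k h + C ((1 + Complex.I) / 2) * conjPoly (toPolyC k h) := by
  rw [conjPoly_toPolyC_eq_realTuple, toPolyC_eq_realTuple]
  ext n
  simp only [coeff_add, coeff_C_mul]
  linear_combination (((toPolyR k (realTuple k h 1)).map Complex.ofRealHom).coeff n -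
    ((toPolyR k (realTuple k h 0)).map Complex.ofRealHom).coeff n) / 2 * Complex.I_sq

lemma dvd_realTuple_iff {k : ℕ} (h : Fin k → ℂ) (d : ℝ[X]) :
    (d ∣ toPolyR k (realTuple k h 0) ∧ d ∣ toPolyR k (realTuple k h 1)) ↔
      (d.map Complex.ofRealHom ∣ toPolyC k h ∧
        d.map Complex.ofRealHom ∣ conjPoly (toPolyC k h)) := by
  rw [← map_dvd_map' Complex.ofRealHom (x := d) (y := toPolyR k (realTuple k h 0)),
    ← map_dvd_map' Complex.ofRealHom (x := d) (y := toPolyR k (realTuple k h 1))]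
  constructor
  · rintro ⟨h0, h1⟩
    rw [conjPoly_toPolyC_eq_realTuple, toPolyC_eq_realTuple]
    exact ⟨dvd_add (h0.mul_left _) (h1.mul_left _), dvd_add (h0.mul_left _) (h1.mul_left _)⟩
  · rintro ⟨h0, h1⟩
    rw [realTuple_zero_eq, realTuple_one_eq]
    exact ⟨dvd_add (h0.mul_left _) (h1.mul_left _), dvd_add (h0.mul_left _) (h1.mul_left _)⟩

/-- Coefficient vectors of monic complex polynomials without real roots whose common real divisors
with their conjugate have degree at most `2 * i`. -/
def nonrealSet (k i : ℕ) : Set (Fin k → ℂ) :=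
  {h | (∀ x : ℝ, (toPolyC k h).eval (x : ℂ) ≠ 0) ∧
    ∀ e : ℝ[X], e.map Complex.ofRealHom ∣ toPolyC k h →
      e.map Complex.ofRealHom ∣ conjPoly (toPolyC k h) → e.natDegree ≤ 2 * i}

lemma eval_toPolyC_eq_zero_iff_realTuple {k : ℕ} (h : Fin k → ℂ) (x : ℝ) :
    (toPolyC k h).eval (x : ℂ) = 0 ↔ ∀ j, (toPolyR k (realTuple k h j)).eval x = 0 := by
  have hx : ∀ p : ℝ[X], p.eval x = 0 ↔ (p.map Complex.ofRealHom).eval (x : ℂ) = 0 := by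
    intro p
    rw [← Complex.ofRealHom_eq_coe, eval_map, eval₂_at_apply]
    simp
  rw [Fin.forall_fin_two, hx, hx]
  constructor
  · intro h0
    have h1 : (conjPoly (toPolyC k h)).eval (x : ℂ) = 0 := by
      rw [eval_conjPoly, Complex.conj_ofReal, h0, map_zero]
    rw [realTuple_zero_eq, realTuple_one_eq]
    simp [h0, h1]
  · rintro ⟨h0, h1⟩
    rw [toPolyC_eq_realTuple]
    simp only [eval_add, eval_mul, h0, h1, mul_zero, add_zero]

/-- The space `Y` is homeomorphic to a space of complex polynomials without real roots. -/
noncomputable def nonrealHomeomorph (k i : ℕ) : nonrealSet k i ≃ₜ Yset k 1 (2 * i) :=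
  (realTuple k).subtype fun h => by
    simp only [nonrealSet, Yset, RXset, Set.mem_ofPred_eq]
    rw [natDegree_gcd_le_iff_s1 _ (toPolyR_monic k _).ne_zero, and_comm]
    refine and_congr ?_ (forall_congr' fun x => ?_)
    · refine forall_congr' fun d => ?_
      rw [← and_imp, ← and_imp]
      exact imp_congr (dvd_realTuple_iff h d).symm Iff.rfl
    · rw [Ne, eval_toPolyC_eq_zero_iff_realTuple, not_forall]

end RealTuples

section Products

variable {a b k i : ℕ}

/-- The lower-order coefficients of the product of the first polynomial and the conjugate of the
second one. -/
noncomputable def prodCoeff (k : ℕ) (x : (Fin a → ℂ) × (Fin b → ℂ)) : Fin k → ℂ :=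
  fun j => (toPolyC a x.1 * conjPoly (toPolyC b x.2)).coeff j

lemma toPolyC_prodCoeff (hab : a + b = k) (x : (Fin a → ℂ) × (Fin b → ℂ)) :
    toPolyC k (prodCoeff k x) = toPolyC a x.1 * conjPoly (toPolyC b x.2) := by
  refine toPolyC_coeff_s1 ((toPolyC_monic _ _).mul (toPolyC_monic _ _).conjPoly) ?_
  rw [(toPolyC_monic _ _).natDegree_mul (toPolyC_monic _ _).conjPoly, natDegree_conjPoly,
    natDegree_toPolyC, natDegree_toPolyC, hab]

lemma continuous_prodCoeff : Continuous (prodCoeff k : (Fin a → ℂ) × (Fin b → ℂ) → Fin k → ℂ) :=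
  continuous_pi fun j =>
    (CoeffContinuous.toPolyC continuous_fst).mul (.star (.toPolyC continuous_snd)) j

lemma prodCoeff_mem_nonrealSet_iff (hab : a + b = k) {x : (Fin a → ℂ) × (Fin b → ℂ)}
    (h1 : UpperRoots (toPolyC a x.1)) (h2 : UpperRoots (toPolyC b x.2)) :
    prodCoeff k x ∈ nonrealSet k i ↔ CommonDegreeLE i (toPolyC a x.1) (toPolyC b x.2) := by
  rw [nonrealSet, Set.mem_ofPred_eq, toPolyC_prodCoeff hab,
    natDegree_le_of_dvd_mul_conjPoly_iff h1 h2]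
  refine and_iff_right fun x h => ?_
  rw [eval_mul, mul_eq_zero] at h
  rcases h with h | h
  · simpa using h1 _ h
  · simpa using h2.conjPoly _ h

/-- Multiplying the first polynomial with the conjugate of the second one. -/
noncomputable def prodMap (i : ℕ) (hab : a + b = k) :
    C(PairSet a b (UpperCommonDegreeLE i), nonrealSet k i) where
  toFun x := ⟨prodCoeff k x.1, (prodCoeff_mem_nonrealSet_iff hab x.2.2.1 x.2.2.2).2 x.2.1⟩
  continuous_toFun := (continuous_prodCoeff.comp continuous_subtype_val).subtype_mk _

lemma exists_norm_le_of_roots (k : ℕ) (R : ℝ) : ∃ M : ℝ, ∀ c : Fin k → ℂ,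
    (∀ z, (toPolyC k c).eval z = 0 → ‖z‖ ≤ R) → ‖c‖ ≤ M := by
  refine ⟨max R 1 ^ k * k.choose (k / 2), fun c hc => ?_⟩
  refine (pi_norm_le_iff_of_nonneg (by positivity)).2 fun j => ?_
  have h := coeff_bdd_of_roots_le (f := RingHom.id ℂ) (p := toPolyC k c) (B := R) (d := k)
    (toPolyC_monic k c) (IsAlgClosed.splits _) (natDegree_toPolyC k c).le (fun z hz =>
      hc z (by simpa using isRoot_of_mem_roots hz)) j
  simpa [coeff_toPolyC] using h

lemma exists_norm_le_of_norm_prodCoeff_lt (a b : ℕ) (hab : a + b = k) (R : ℝ) : ∃ M : ℝ,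
    ∀ x : (Fin a → ℂ) × (Fin b → ℂ), ‖prodCoeff k x‖ ≤ R → ‖x‖ ≤ M := by
  obtain ⟨M, hM⟩ := exists_norm_le_of_roots a (R + 1)
  obtain ⟨N, hN⟩ := exists_norm_le_of_roots b (R + 1)
  refine ⟨max M N, fun x hx => ?_⟩
  have key : ∀ z, (toPolyC a x.1).eval z * (conjPoly (toPolyC b x.2)).eval z = 0 →
      ‖z‖ ≤ R + 1 := by
    intro z hz
    rw [← eval_mul, ← toPolyC_prodCoeff hab] at hz
    linarith [norm_lt_of_eval_toPolyC_eq_zero hz]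
  refine max_le_max (hM _ fun z hz => key z ?_) (hN _ fun z hz => ?_)
  · rw [hz, zero_mul]
  · rw [← Complex.norm_conj]
    apply key
    rw [eval_conjPoly, Complex.conj_conj, hz, map_zero, mul_zero]

/-- A limit of monic polynomials with roots in the open upper half plane has no roots in the open
lower half plane. -/
lemma eval_ne_zero_of_tendsto {α : Type*} {l : Filter α} [l.NeBot] {f : α → Fin a → ℂ}
    {c : Fin a → ℂ} (hf : Filter.Tendsto f l (nhds c)) (hu : ∀ t, UpperRoots (toPolyC a (f t)))
    {z : ℂ} (hz : z.im < 0) : (toPolyC a c).eval z ≠ 0 := by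
  have hc : Continuous fun c : Fin a → ℂ => (toPolyC a c).eval z :=
    (CoeffContinuous.toPolyC continuous_id).eval (fun c => (natDegree_toPolyC a c).le) z
  have h : |z.im| ^ a ≤ ‖(toPolyC a c).eval z‖ := by
    refine ge_of_tendsto ((hc.tendsto c).norm.comp hf) (.of_forall fun t => ?_)
    have := (hu t).abs_im_pow_le_norm_eval (toPolyC_monic _ _) hz.le
    rwa [natDegree_toPolyC] at this
  rw [← norm_pos_iff]
  exact (pow_pos (abs_pos.2 hz.ne) a).trans_le h

lemma isProperMap_prodMap (i : ℕ) (hab : a + b = k) :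
    IsProperMap (prodMap i hab : PairSet a b (UpperCommonDegreeLE i) → nonrealSet k i) := by
  rw [isProperMap_iff_ultrafilter_of_t2]
  refine ⟨(prodMap i hab).continuous, fun 𝒰 y hy => ?_⟩
  have hy' : Filter.Tendsto (fun x : PairSet a b (UpperCommonDegreeLE i) => prodCoeff k x.1)
      (𝒰 : Filter (PairSet a b (UpperCommonDegreeLE i))) (nhds y.1) :=
    (continuous_subtype_val.tendsto y).comp hy
  obtain ⟨M, hM⟩ := exists_norm_le_of_norm_prodCoeff_lt a b hab (‖y.1‖ + 1)
  have hb : ∀ᶠ x in (𝒰 : Filter (PairSet a b (UpperCommonDegreeLE i))),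
      x.1 ∈ Metric.closedBall (0 : (Fin a → ℂ) × (Fin b → ℂ)) M := by
    filter_upwards [hy'.norm.eventually (gt_mem_nhds (lt_add_one ‖y.1‖))] with x hx
    rw [mem_closedBall_zero_iff]
    exact hM _ hx.le
  obtain ⟨x, -, hx⟩ := (isCompact_closedBall (0 : (Fin a → ℂ) × (Fin b → ℂ)) M).ultrafilter_le_nhds
    (𝒰.map Subtype.val) (Filter.le_principal_iff.2 hb)
  have hx' : Filter.Tendsto (fun x : PairSet a b (UpperCommonDegreeLE i) => x.1)
      (𝒰 : Filter (PairSet a b (UpperCommonDegreeLE i))) (nhds x) := hx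
  have hxy : prodCoeff k x = y.1 :=
    tendsto_nhds_unique ((continuous_prodCoeff.tendsto x).comp hx') hy'
  have hreal : ∀ z : ℂ, z.im = 0 →
      (toPolyC a x.1).eval z * (conjPoly (toPolyC b x.2)).eval z ≠ 0 := by
    intro z hz
    rw [← eval_mul, ← toPolyC_prodCoeff hab, hxy]
    have hz' : (z.re : ℂ) = z := Complex.ext rfl (by simpa using hz.symm)
    rw [← hz']
    exact y.2.1 _
  have h1 : UpperRoots (toPolyC a x.1) := by
    intro z hz
    refine (lt_trichotomy z.im 0).elim (fun h => ?_) fun h => h.elim (fun h => ?_) id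
    · exact absurd hz (eval_ne_zero_of_tendsto ((continuous_fst.tendsto x).comp hx')
        (fun t => t.2.2.1) h)
    · refine absurd ?_ (hreal z h)
      rw [hz, zero_mul]
  have h2 : UpperRoots (toPolyC b x.2) := by
    intro z hz
    refine (lt_trichotomy z.im 0).elim (fun h => ?_) fun h => h.elim (fun h => ?_) id
    · exact absurd hz (eval_ne_zero_of_tendsto ((continuous_snd.tendsto x).comp hx')
        (fun t => t.2.2.2) h)
    · refine absurd ?_ (hreal z h)
      rw [eval_conjPoly, Complex.conj_eq_iff_im.2 h, hz, map_zero, mul_zero]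
  refine ⟨⟨x, (prodCoeff_mem_nonrealSet_iff hab h1 h2).1 (hxy ▸ y.2), h1, h2⟩, ?_⟩
  exact tendsto_subtype_rng.2 hx'

lemma dvd_of_mul_conjPoly_eq {u w u' w' : ℂ[X]} (hu : UpperRoots u) (hw' : UpperRoots w')
    (h : u * conjPoly w = u' * conjPoly w') : u ∣ u' :=
  (hu.isCoprime hw'.conjPoly).dvd_of_dvd_mul_right (h ▸ dvd_mul_right _ _)

/-- Multiplication as a map on the disjoint union over all possible degrees. -/
noncomputable def sigmaProdMap (k i : ℕ) :
    (Σ q : Fin (k + 1), PairSet q.val (k - q.val) (UpperCommonDegreeLE i)) → nonrealSet k i :=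
  fun x => prodMap i (Nat.add_sub_of_le (Nat.le_of_lt_succ x.1.2)) x.2

lemma toPolyC_sigmaProdMap
    (x : Σ q : Fin (k + 1), PairSet q.val (k - q.val) (UpperCommonDegreeLE i)) :
    toPolyC k (sigmaProdMap k i x).1 =
      toPolyC x.1 x.2.1.1 * conjPoly (toPolyC (k - x.1) x.2.1.2) :=
  toPolyC_prodCoeff (Nat.add_sub_of_le (Nat.le_of_lt_succ x.1.2)) _

lemma continuous_sigmaProdMap : Continuous (sigmaProdMap k i) :=
  continuous_sigma fun q =>
    (prodMap i (Nat.add_sub_of_le (Nat.le_of_lt_succ q.2))).continuous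

lemma isClosedMap_sigmaProdMap : IsClosedMap (sigmaProdMap k i) := by
  intro s hs
  have : sigmaProdMap k i '' s = ⋃ q : Fin (k + 1),
      prodMap i (Nat.add_sub_of_le (Nat.le_of_lt_succ q.2)) ''
        ((fun x => ⟨q, x⟩) ⁻¹' s) := by
    ext y
    simp only [Set.mem_image, Set.mem_iUnion, Set.mem_preimage, Sigma.exists]
    rfl
  rw [this]
  exact isClosed_iUnion_of_finite fun q =>
    (isProperMap_prodMap i _).isClosedMap _ (hs.preimage continuous_sigmaMk)

lemma injective_sigmaProdMap : Function.Injective (sigmaProdMap k i) := by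
  intro x y hxy
  have h := congrArg (fun z : nonrealSet k i => toPolyC k z.1) hxy
  simp only [toPolyC_sigmaProdMap] at h
  obtain ⟨p, x⟩ := x
  obtain ⟨q, y⟩ := y
  have hu : toPolyC p x.1.1 = toPolyC q y.1.1 :=
    eq_of_monic_of_associated (toPolyC_monic _ _) (toPolyC_monic _ _)
      (associated_of_dvd_dvd (dvd_of_mul_conjPoly_eq x.2.2.1 y.2.2.2 h)
        (dvd_of_mul_conjPoly_eq y.2.2.1 x.2.2.2 h.symm))
  have hpq : p = q := by
    apply Fin.ext
    rw [← natDegree_toPolyC p x.1.1, hu, natDegree_toPolyC]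
  subst hpq
  congr 1
  refine PairSet.ext hu ?_
  simp only [hu] at h
  rw [← conjPoly_conjPoly (toPolyC _ x.1.2), mul_left_cancel₀ (toPolyC_monic _ _).ne_zero h,
    conjPoly_conjPoly]

lemma surjective_sigmaProdMap : Function.Surjective (sigmaProdMap k i) := by
  intro y
  obtain ⟨u, v, mu, mv, hu, hv, h⟩ := exists_upperRoots_mul_lowerRoots (toPolyC_monic k y.1) y.2.1
  have hdeg : u.natDegree + v.natDegree = k := by
    rw [← mu.natDegree_mul mv, ← h, natDegree_toPolyC]
  have hc1 : toPolyC u.natDegree (fun j => u.coeff j) = u := toPolyC_coeff_s1 mu rfl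
  have hc2 : toPolyC (k - u.natDegree) (fun j => (conjPoly v).coeff j) = conjPoly v :=
    toPolyC_coeff_s1 mv.conjPoly (by rw [natDegree_conjPoly]; omega)
  have hk : u.natDegree + (k - u.natDegree) = k := by omega
  let x : (Fin u.natDegree → ℂ) × (Fin (k - u.natDegree) → ℂ) :=
    (fun j => u.coeff j, fun j => (conjPoly v).coeff j)
  have hx1 : UpperRoots (toPolyC u.natDegree x.1) := hc1.symm ▸ hu
  have hx2 : UpperRoots (toPolyC (k - u.natDegree) x.2) := hc2.symm ▸ hv.conjPoly
  have hxy : prodCoeff k x = y.1 := by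
    apply toPolyC_injective
    rw [toPolyC_prodCoeff hk, h]
    simp only [x, hc1, hc2, conjPoly_conjPoly]
  exact ⟨⟨⟨u.natDegree, by omega⟩, ⟨x, (prodCoeff_mem_nonrealSet_iff hk hx1 hx2).1 (hxy ▸ y.2),
    hx1, hx2⟩⟩, Subtype.ext hxy⟩

/-- Polynomials without real roots are classified by the factors collecting the roots in the upper
and in the lower half plane. -/
noncomputable def sigmaProdHomeomorph (k i : ℕ) :
    (Σ q : Fin (k + 1), PairSet q.val (k - q.val) (UpperCommonDegreeLE i)) ≃ₜ nonrealSet k i :=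
  (Equiv.ofBijective (sigmaProdMap k i)
    ⟨injective_sigmaProdMap, surjective_sigmaProdMap⟩).toHomeomorphOfContinuousClosed
    continuous_sigmaProdMap isClosedMap_sigmaProdMap

end Products

/-- **Proposition C(ii).** For `k ≥ 1` and `i ≥ 0`, there is a homotopy equivalence between
`Y_{k,1}^{2i}` and the disjoint union over `q = 0, …, k` of the spaces `X_{min(q,k−q),1}^{i}`. -/
theorem propositionC_ii (k i : ℕ) (hk : 1 ≤ k) :
    Nonempty (ContinuousMap.HomotopyEquiv (Yset k 1 (2 * i))
      (Σ q : Fin (k + 1), ↥(Xset (min q.val (k - q.val)) 1 i))) := by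
  exact ⟨((nonrealHomeomorph k i).symm.trans (sigmaProdHomeomorph k i).symm).toHomotopyEquiv.trans
    (sigmaHomotopyEquiv fun q => (upperHomotopyEquiv q.val (k - q.val) i).trans
      (nonempty_homotopyEquiv_Xset_min q.val (k - q.val) i).some)⟩
end
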